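/- arXiv:2605.20719 — 7 statements merged into one kernel-verified Lean document; each statement's English description precedes it below -/
import Mathlib

section
/- Let q_1 < q_2 < … < q_r be distinct primes. For every real X ≥ 1, the sum of 1/n over positive integers n < X with gcd(n, q_1⋯q_r) = 1 equals ∏_{i=1}^{r}(1 − q_i^{−1})·(log X + γ_S) + O(X^{−1}), where the implied constant depends only on q_1, …, q_r. -/
/-- The sum of `1 / n` over the positive integers `n < X` coprime to `m`. -/
noncomputable def coprimeHarmonicSum (m : ℕ) (X : ℝ) : ℝ :=
  ∑ n ∈ (Finset.Ico 1 ⌈X⌉₊).filter fun n => Nat.Coprime n m, (1 : ℝ) / n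

lemma coprimeHarmonicSum_one (X : ℝ) :
    coprimeHarmonicSum 1 X = (harmonic (⌈X⌉₊ - 1) : ℝ) := by
  have h : ∀ N : ℕ, ∑ n ∈ Finset.Ico 1 N, (1 : ℝ) / n = (harmonic (N - 1) : ℝ) := by
    intro N
    rw [Finset.sum_Ico_eq_sum_range, harmonic]
    push_cast
    exact Finset.sum_congr rfl fun i _ => by rw [one_div, add_comm]
  simpa [coprimeHarmonicSum] using h ⌈X⌉₊

lemma coprimeHarmonicSum_mul_prime {m p : ℕ} (hp : p.Prime) (hpm : Nat.Coprime p m) (X : ℝ) :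
    coprimeHarmonicSum (p * m) X =
      coprimeHarmonicSum m X - (p : ℝ)⁻¹ * coprimeHarmonicSum m (X / p) := by
  have hp0 : (0 : ℝ) < p := by exact_mod_cast hp.pos
  have hmult : (p : ℝ)⁻¹ * coprimeHarmonicSum m (X / p) =
      ∑ n ∈ ((Finset.Ico 1 ⌈X⌉₊).filter fun n => Nat.Coprime n m).filter fun n => p ∣ n,
        (1 : ℝ) / n := by
    rw [coprimeHarmonicSum, Finset.mul_sum]
    refine Finset.sum_bij (fun n _ => p * n) ?_ ?_ ?_ ?_
    · intro n hn
      simp only [Finset.mem_filter, Finset.mem_Ico, Nat.lt_ceil] at hn ⊢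
      obtain ⟨⟨h1, h2⟩, h3⟩ := hn
      refine ⟨⟨⟨Nat.mul_pos hp.pos h1, ?_⟩, Nat.Coprime.mul_left hpm h3⟩, dvd_mul_right _ _⟩
      rw [lt_div_iff₀ hp0] at h2
      push_cast
      linarith
    · intro a _ b _ h
      exact Nat.eq_of_mul_eq_mul_left hp.pos h
    · intro n hn
      simp only [Finset.mem_filter, Finset.mem_Ico, Nat.lt_ceil] at hn
      obtain ⟨⟨⟨h1, h2⟩, h3⟩, k, rfl⟩ := hn
      refine ⟨k, ?_, rfl⟩
      simp only [Finset.mem_filter, Finset.mem_Ico, Nat.lt_ceil]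
      refine ⟨⟨Nat.pos_of_mul_pos_left h1, ?_⟩, Nat.Coprime.coprime_mul_left h3⟩
      rw [lt_div_iff₀ hp0]
      push_cast at h2
      linarith
    · intro n _
      push_cast
      rw [one_div, one_div, mul_inv]
  rw [hmult, eq_sub_iff_add_eq, coprimeHarmonicSum, coprimeHarmonicSum,
    ← Finset.sum_filter_not_add_sum_filter
      ((Finset.Ico 1 ⌈X⌉₊).filter fun n => Nat.Coprime n m) (fun n => p ∣ n)]
  congr 1
  rw [Finset.filter_filter]
  refine Finset.sum_congr (Finset.filter_congr fun n _ => ?_) fun _ _ => rfl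
  rw [Nat.coprime_mul_iff_right, Nat.coprime_comm, hp.coprime_iff_not_dvd, and_comm]

lemma abs_coprimeHarmonicSum_one_sub_le {X : ℝ} (hX : 0 < X) :
    |coprimeHarmonicSum 1 X - (Real.log X + Real.eulerMascheroniConstant)| ≤ 2 / X := by
  rw [coprimeHarmonicSum_one]
  obtain ⟨N, hN⟩ : ∃ N, ⌈X⌉₊ = N + 1 := Nat.exists_eq_succ_of_ne_zero (Nat.ceil_pos.2 hX).ne'
  have hXN : X ≤ N + 1 := by exact_mod_cast hN ▸ Nat.le_ceil X
  have hNX : (N : ℝ) < X := Nat.lt_ceil.1 (by omega)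
  rw [hN, Nat.add_sub_cancel]
  have hlow := Real.eulerMascheroniSeq_lt_eulerMascheroniConstant N
  have hupp := Real.eulerMascheroniConstant_lt_eulerMascheroniSeq' N
  simp only [Real.eulerMascheroniSeq, Real.eulerMascheroniSeq'] at hlow hupp
  have hX' : 0 < 1 / X := by positivity
  have h2 : 2 / X = 2 * (1 / X) := by ring
  rw [abs_le, h2]
  constructor
  · rcases Nat.eq_zero_or_pos N with rfl | hpos
    · have h1 : 1 ≤ 1 / X := by
        rw [le_div_iff₀ hX]; norm_num at hXN; linarith
      have h3 := Real.log_le_sub_one_of_pos hX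
      have h4 := Real.eulerMascheroniConstant_lt_two_thirds
      norm_num at hXN
      simp only [harmonic_zero, Rat.cast_zero]
      linarith
    · have hN1 : (1 : ℝ) ≤ N := by exact_mod_cast hpos
      rw [if_neg hpos.ne'] at hupp
      have h3 := Real.log_le_sub_one_of_pos (show 0 < X / N by positivity)
      rw [Real.log_div hX.ne' (by positivity)] at h3
      have h4 : X / N - 1 ≤ 2 * (1 / X) := by
        rw [← h2, div_sub_one (by positivity), div_le_div_iff₀ (by positivity) hX]
        nlinarith
      linarith
  · have h3 := Real.log_le_sub_one_of_pos (show 0 < (N + 1) / X by positivity)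
    rw [Real.log_div (by positivity) hX.ne'] at h3
    have h4 : (N + 1) / X - 1 ≤ 1 / X := by
      rw [div_sub_one hX.ne']
      gcongr
      linarith
    linarith

lemma exists_abs_coprimeHarmonicSum_prod_sub_le (s : Finset ℕ) (hs : ∀ p ∈ s, p.Prime) :
    ∃ C : ℝ, ∀ X : ℝ, 0 < X →
      |coprimeHarmonicSum (∏ p ∈ s, p) X - (∏ p ∈ s, (1 - (p : ℝ)⁻¹)) *
          (Real.log X + (Real.eulerMascheroniConstant +
            ∑ p ∈ s, ((p : ℝ)⁻¹ * Real.log p) / (1 - (p : ℝ)⁻¹)))| ≤ C / X := by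
  induction s using Finset.induction_on with
  | empty => exact ⟨2, fun X hX => by simpa using abs_coprimeHarmonicSum_one_sub_le hX⟩
  | insert p s hps ih =>
    obtain ⟨C, hC⟩ := ih fun l hl => hs l (Finset.mem_insert_of_mem hl)
    have hp : p.Prime := hs p (Finset.mem_insert_self p s)
    have hp1 : (1 : ℝ) < p := by exact_mod_cast hp.one_lt
    have hp0 : (0 : ℝ) < p := by linarith
    have hcop : Nat.Coprime p (∏ l ∈ s, l) := Nat.Coprime.prod_right fun l hl =>
      (Nat.coprime_primes hp (hs l (Finset.mem_insert_of_mem hl))).2 fun h => hps (h ▸ hl)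
    refine ⟨2 * C, fun X hX => ?_⟩
    rw [Finset.prod_insert hps, Finset.prod_insert hps, Finset.sum_insert hps,
      coprimeHarmonicSum_mul_prime hp hcop]
    have h1 := hC X hX
    have h2 := hC (X / p) (by positivity)
    rw [Real.log_div hX.ne' hp0.ne'] at h2
    generalize coprimeHarmonicSum (∏ l ∈ s, l) X = S at *
    generalize coprimeHarmonicSum (∏ l ∈ s, l) (X / p) = T at *
    generalize (∏ l ∈ s, (1 - (l : ℝ)⁻¹)) = A at *
    generalize (∑ l ∈ s, ((l : ℝ)⁻¹ * Real.log l) / (1 - (l : ℝ)⁻¹)) = G at *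
    have hne : (p : ℝ) - 1 ≠ 0 := by linarith
    have hsplit : S - (p : ℝ)⁻¹ * T - (1 - (p : ℝ)⁻¹) * A *
          (Real.log X + (Real.eulerMascheroniConstant +
            ((p : ℝ)⁻¹ * Real.log p / (1 - (p : ℝ)⁻¹) + G))) =
        (S - A * (Real.log X + (Real.eulerMascheroniConstant + G))) -
          (p : ℝ)⁻¹ *
            (T - A * (Real.log X - Real.log p + (Real.eulerMascheroniConstant + G))) := by
      field_simp
      ring
    rw [hsplit]
    refine (abs_sub _ _).trans ?_
    rw [abs_mul, abs_of_pos (inv_pos.2 hp0)]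
    calc _ ≤ C / X + (p : ℝ)⁻¹ * (C / (X / p)) := by gcongr
      _ = 2 * C / X := by field_simp; ring

/-- Let `q 0 < q 1 < … < q (r-1)` be distinct primes.  For every real `X ≥ 1`,
the sum of `1/n` over positive integers `n < X` coprime to `q 0 ⋯ q (r-1)` equals
`∏ i, (1 - (q i)⁻¹) * (log X + γ_S) + O (X⁻¹)`, where
`γ_S = γ + ∑ i, (q i)⁻¹ * log (q i) / (1 - (q i)⁻¹)` and `γ` is the Euler–Mascheroni
constant.  The implied constant depends only on `q`. -/
theorem stmt0 (r : ℕ) (q : Fin r → ℕ) (hq : ∀ i, (q i).Prime) (hmono : StrictMono q) :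
    ∃ C : ℝ, ∀ X : ℝ, 1 ≤ X →
      |(∑ n ∈ (Finset.Ico 1 ⌈X⌉₊).filter fun n => Nat.Coprime n (∏ i, q i), (1 : ℝ) / n) -
        (∏ i, (1 - (q i : ℝ)⁻¹)) *
          (Real.log X + (Real.eulerMascheroniConstant +
            ∑ i, ((q i : ℝ)⁻¹ * Real.log (q i)) / (1 - (q i : ℝ)⁻¹)))| ≤ C / X := by
  obtain ⟨C, hC⟩ := exists_abs_coprimeHarmonicSum_prod_sub_le (Finset.univ.image q) (by simpa)
  refine ⟨C, fun X hX => ?_⟩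
  have hinj : Set.InjOn q (Finset.univ : Finset (Fin r)) := hmono.injective.injOn
  have h := hC X (by linarith)
  rwa [Finset.prod_image hinj, Finset.prod_image hinj, Finset.sum_image hinj] at h
end

section
/- Let q_1 < … < q_r be distinct primes and let χ be a Dirichlet character such that χ(m) = 0 if and only if gcd(m, q_1⋯q_r) ≠ 1. Then for X ≥ 2, ∑_{n < X} d(n)χ(n) = δ(χ)·∏_{i=1}^{r}(1 − q_i^{−1})^2·(X log X + (2γ_S − 1)X) + O(X^{1/2}), where the sum is over positive integers n < X and the implied constant depends only on χ. -/
open scoped Classical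

/-- Dirichlet's hyperbola method for the divisor sum twisted by a completely multiplicative
function. -/
lemma sum_card_divisors_mul_eq_hyperbola (f : ℕ → ℂ) (hf : ∀ a b, f (a * b) = f a * f b) (K : ℕ) :
    ∑ n ∈ Finset.Ioc 0 K, (n.divisors.card : ℂ) * f n =
      2 * ∑ a ∈ Finset.Ioc 0 K.sqrt, f a * ∑ b ∈ Finset.Ioc 0 (K / a), f b -
        (∑ a ∈ Finset.Ioc 0 K.sqrt, f a) ^ 2 := by
  set M := K.sqrt
  have hMK : M * M ≤ K := Nat.sqrt_le K
  have hKM : K < (M + 1) * (M + 1) := Nat.lt_succ_sqrt K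
  have hU : ∑ n ∈ Finset.Ioc 0 K, (n.divisors.card : ℂ) * f n =
      ∑ x ∈ (Finset.Ioc 0 K ×ˢ Finset.Ioc 0 K).filter (fun x ↦ x.1 * x.2 ≤ K),
        f x.1 * f x.2 := by
    have hmap : ∀ x ∈ (Finset.Ioc 0 K ×ˢ Finset.Ioc 0 K).filter (fun x ↦ x.1 * x.2 ≤ K),
        x.1 * x.2 ∈ Finset.Ioc 0 K := by
      intro x hx
      simp only [Finset.mem_filter, Finset.mem_product, Finset.mem_Ioc] at hx ⊢
      exact ⟨Nat.mul_pos hx.1.1.1 hx.1.2.1, hx.2⟩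
    rw [← Finset.sum_fiberwise_of_maps_to hmap]
    refine Finset.sum_congr rfl fun n hn ↦ ?_
    rw [Finset.mem_Ioc] at hn
    have hfib : ((Finset.Ioc 0 K ×ˢ Finset.Ioc 0 K).filter (fun x ↦ x.1 * x.2 ≤ K)).filter
        (fun x ↦ x.1 * x.2 = n) = n.divisorsAntidiagonal := by
      rw [Nat.divisorsAntidiagonal_eq_prod_filter_of_le hn.1.ne' hn.2, Finset.filter_filter]
      refine Finset.filter_congr fun x _ ↦ ⟨fun h ↦ h.2, fun h ↦ ⟨h ▸ hn.2, h⟩⟩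
    rw [hfib, Finset.sum_congr rfl (g := fun _ ↦ f n), Finset.sum_const, nsmul_eq_mul,
      ← Nat.map_div_right_divisors, Finset.card_map]
    intro x hx
    rw [← hf, (Nat.mem_divisorsAntidiagonal.mp hx).1]
  set U := (Finset.Ioc 0 K ×ˢ Finset.Ioc 0 K).filter (fun x ↦ x.1 * x.2 ≤ K) with hUdef
  have hmemU : ∀ x : ℕ × ℕ, x ∈ U ↔ 0 < x.1 ∧ 0 < x.2 ∧ x.1 * x.2 ≤ K := by
    intro x
    simp only [hUdef, Finset.mem_filter, Finset.mem_product, Finset.mem_Ioc]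
    constructor
    · tauto
    · rintro ⟨h1, h2, h3⟩
      exact ⟨⟨⟨h1, by nlinarith⟩, ⟨h2, by nlinarith⟩⟩, h3⟩
  have hunion : U.filter (fun x ↦ x.1 ≤ M) ∪ U.filter (fun x ↦ x.2 ≤ M) = U := by
    rw [← Finset.filter_or, Finset.filter_true_of_mem]
    intro x hx
    by_contra! h
    have := ((hmemU x).mp hx).2.2
    nlinarith [Nat.mul_le_mul h.1 h.2]
  have hinter : U.filter (fun x ↦ x.1 ≤ M) ∩ U.filter (fun x ↦ x.2 ≤ M) =
      Finset.Ioc 0 M ×ˢ Finset.Ioc 0 M := by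
    ext x
    simp only [Finset.mem_inter, Finset.mem_filter, hmemU, Finset.mem_product, Finset.mem_Ioc]
    constructor
    · tauto
    · rintro ⟨⟨h1, h2⟩, h3, h4⟩
      have := (Nat.mul_le_mul h2 h4).trans hMK
      tauto
  have hleft : ∑ x ∈ U.filter (fun x ↦ x.1 ≤ M), f x.1 * f x.2 =
      ∑ a ∈ Finset.Ioc 0 M, f a * ∑ b ∈ Finset.Ioc 0 (K / a), f b := by
    simp_rw [Finset.mul_sum]
    refine Finset.sum_finset_product' (f := fun a b ↦ f a * f b) _ _ _ fun x ↦ ?_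
    simp only [Finset.mem_filter, hmemU, Finset.mem_Ioc]
    constructor
    · rintro ⟨⟨h1, h2, h3⟩, h4⟩
      exact ⟨⟨h1, h4⟩, h2, (Nat.le_div_iff_mul_le h1).mpr (by linarith)⟩
    · rintro ⟨⟨h1, h4⟩, h2, h3⟩
      have := (Nat.le_div_iff_mul_le h1).mp h3
      exact ⟨⟨h1, h2, by linarith⟩, h4⟩
  have hright : ∑ x ∈ U.filter (fun x ↦ x.2 ≤ M), f x.1 * f x.2 =
      ∑ a ∈ Finset.Ioc 0 M, f a * ∑ b ∈ Finset.Ioc 0 (K / a), f b := by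
    rw [← hleft]
    refine Finset.sum_nbij' Prod.swap Prod.swap ?_ ?_ ?_ ?_ ?_
    · intro x
      simp only [Finset.mem_filter, hmemU, Prod.fst_swap, Prod.snd_swap, mul_comm x.1]
      tauto
    · intro x
      simp only [Finset.mem_filter, hmemU, Prod.fst_swap, Prod.snd_swap, mul_comm x.1]
      tauto
    · simp
    · simp
    · intro x _
      simp [mul_comm]
  have hsplit := Finset.sum_union_inter (s₁ := U.filter (fun x ↦ x.1 ≤ M))
    (s₂ := U.filter (fun x ↦ x.2 ≤ M)) (f := fun x ↦ f x.1 * f x.2)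
  rw [hunion, hinter, hleft, hright, Finset.sum_product, ← Finset.sum_mul_sum] at hsplit
  rw [hU, eq_sub_iff_add_eq, pow_two, hsplit]
  ring

/-- The divisor sum up to a positive integer, given the asymptotics of the partial sums of `f k`
and of `f k / k`. -/
lemma exists_norm_sum_card_divisors_mul_sub_le (f : ℕ → ℂ) (hf : ∀ a b, f (a * b) = f a * f b)
    (hf1 : ∀ a, ‖f a‖ ≤ 1) (P g B : ℝ)
    (hA : ∀ n : ℕ, ‖∑ k ∈ Finset.Ioc 0 n, f k - (P * n : ℝ)‖ ≤ B)
    (hH : ∀ n : ℕ, 0 < n → ‖P * ∑ k ∈ Finset.Ioc 0 n, f k / k -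
      (P ^ 2 * (Real.log n + g) : ℝ)‖ ≤ B / n) :
    ∃ C : ℝ, 0 ≤ C ∧ ∀ K : ℕ, 0 < K →
      ‖∑ n ∈ Finset.Ioc 0 K, (n.divisors.card : ℂ) * f n -
        (P ^ 2 * (K * Real.log K + (2 * g - 1) * K) : ℝ)‖ ≤ C * Real.sqrt K := by
  have hB : 0 ≤ B := (norm_nonneg _).trans (hA 0)
  refine ⟨2 * (B + |P|) + 6 * B + 8 * P ^ 2 + 2 * |P| * B + B ^ 2, by positivity, fun K hK ↦ ?_⟩
  rw [sum_card_divisors_mul_eq_hyperbola f hf K]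
  have hM0 : 0 < K.sqrt := Nat.sqrt_pos.mpr hK
  have hMK : K.sqrt * K.sqrt ≤ K := Nat.sqrt_le K
  have hKM : K < (K.sqrt + 1) * (K.sqrt + 1) := Nat.lt_succ_sqrt K
  have hMs : (K.sqrt : ℝ) ≤ Real.sqrt K := Real.nat_sqrt_le_real_sqrt
  set M := K.sqrt
  have hM1 : (1 : ℝ) ≤ M := by exact_mod_cast hM0
  have hMp : (0 : ℝ) < M := by linarith
  have hMK' : (M : ℝ) * M ≤ K := by exact_mod_cast hMK
  have hKM' : (K : ℝ) ≤ M * M + 2 * M := by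
    have : K ≤ M * M + 2 * M := by linarith
    exact_mod_cast this
  have hKp : (0 : ℝ) < K := by exact_mod_cast hK
  set E₁ : ℂ := ∑ a ∈ Finset.Ioc 0 M,
    f a * (∑ b ∈ Finset.Ioc 0 (K / a), f b - (P * (K / a) : ℝ)) with hE₁
  set E₂ : ℂ := P * ∑ k ∈ Finset.Ioc 0 M, f k / k - (P ^ 2 * (Real.log M + g) : ℝ) with hE₂
  set E₃ : ℂ := ∑ k ∈ Finset.Ioc 0 M, f k - (P * M : ℝ) with hE₃
  have h1 : ‖E₁‖ ≤ M * (B + |P|) := by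
    suffices h : ∀ a ∈ Finset.Ioc 0 M,
        ‖f a * (∑ b ∈ Finset.Ioc 0 (K / a), f b - (P * (K / a) : ℝ))‖ ≤ B + |P| by
      simpa [hE₁, mul_add] using norm_sum_le_of_le _ h
    intro a ha
    rw [Finset.mem_Ioc] at ha
    have hap : (0 : ℝ) < a := by exact_mod_cast ha.1
    have hfl : |((K / a : ℕ) : ℝ) - K / a| ≤ 1 := by
      have h1 : ((K / a : ℕ) : ℝ) ≤ K / a := Nat.cast_div_le
      have h2 : (K : ℝ) / a < (K / a : ℕ) + 1 := by
        rw [div_lt_iff₀ hap]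
        have := Nat.lt_mul_div_succ K ha.1
        rw [mul_comm] at this
        exact_mod_cast this
      rw [abs_le]; constructor <;> linarith
    calc ‖f a * (∑ b ∈ Finset.Ioc 0 (K / a), f b - (P * (K / a) : ℝ))‖
        ≤ ‖∑ b ∈ Finset.Ioc 0 (K / a), f b - (P * (K / a) : ℝ)‖ := by
          rw [norm_mul]
          exact mul_le_of_le_one_left (norm_nonneg _) (hf1 a)
      _ = ‖(∑ b ∈ Finset.Ioc 0 (K / a), f b - (P * (K / a : ℕ) : ℝ)) +
            (P * ((K / a : ℕ) - K / a) : ℝ)‖ := by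
          congr 1; push_cast; ring
      _ ≤ B + |P| * 1 := by
          refine (norm_add_le _ _).trans (add_le_add (hA _) ?_)
          rw [Complex.norm_real, Real.norm_eq_abs, abs_mul]
          gcongr
      _ = B + |P| := by rw [mul_one]
  have h2 : ‖E₂‖ ≤ B / M := hH M hM0
  have h3 : ‖E₃‖ ≤ B := hA M
  set R : ℝ := 2 * K * Real.log M - K * Real.log K + (K - M * M) with hR
  have hRle : |R| ≤ 8 * M := by
    have hlog : Real.log K - 2 * Real.log M ≤ 2 / M := by
      have : Real.log (K / (M * M)) ≤ K / (M * M) - 1 :=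
        Real.log_le_sub_one_of_pos (by positivity)
      rw [Real.log_div hKp.ne' (by positivity), Real.log_mul hMp.ne' hMp.ne'] at this
      have h' : (K : ℝ) / (M * M) - 1 ≤ 2 / M := by
        rw [sub_le_iff_le_add, div_le_iff₀ (by positivity)]
        field_simp
        linarith
      linarith
    have hlog0 : 0 ≤ Real.log K - 2 * Real.log M := by
      have := Real.log_le_log (by positivity) hMK'
      rw [Real.log_mul hMp.ne' hMp.ne'] at this
      linarith
    have hup : K * (Real.log K - 2 * Real.log M) ≤ 6 * M := by
      calc K * (Real.log K - 2 * Real.log M) ≤ (3 * M * M) * (2 / M) := by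
            gcongr
            nlinarith
        _ = 6 * M := by field_simp; norm_num
    have hlo : 0 ≤ K * (Real.log K - 2 * Real.log M) := by positivity
    rw [abs_le]
    constructor <;> rw [hR] <;> linarith
  have hmain : 2 * ∑ a ∈ Finset.Ioc 0 M, f a * ∑ b ∈ Finset.Ioc 0 (K / a), f b -
      (∑ a ∈ Finset.Ioc 0 M, f a) ^ 2 - (P ^ 2 * (K * Real.log K + (2 * g - 1) * K) : ℝ) =
      2 * E₁ + 2 * K * E₂ + (P ^ 2 * R : ℝ) - 2 * (P * M : ℝ) * E₃ - E₃ ^ 2 := by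
    have hE₁' : E₁ = ∑ a ∈ Finset.Ioc 0 M, f a * ∑ b ∈ Finset.Ioc 0 (K / a), f b -
        K * (P * ∑ k ∈ Finset.Ioc 0 M, f k / k) := by
      rw [hE₁, Finset.mul_sum, Finset.mul_sum, ← Finset.sum_sub_distrib]
      refine Finset.sum_congr rfl fun a _ ↦ ?_
      push_cast
      ring
    rw [hE₁', hE₂, hE₃, hR]
    push_cast
    ring
  rw [hmain]
  have hKB : K * (B / M) ≤ 3 * B * M := by
    rw [mul_div_assoc', div_le_iff₀ hMp]
    nlinarith [mul_nonneg hB (by nlinarith : (0 : ℝ) ≤ 3 * M * M - K)]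
  calc ‖2 * E₁ + 2 * K * E₂ + (P ^ 2 * R : ℝ) - 2 * (P * M : ℝ) * E₃ - E₃ ^ 2‖
      ≤ ‖2 * E₁‖ + ‖2 * K * E₂‖ + ‖((P ^ 2 * R : ℝ) : ℂ)‖ + ‖2 * (P * M : ℝ) * E₃‖ +
          ‖E₃ ^ 2‖ := by
        refine (norm_sub_le _ _).trans (add_le_add_left ?_ _)
        refine (norm_sub_le _ _).trans (add_le_add_left ?_ _)
        exact norm_add₃_le
    _ = 2 * ‖E₁‖ + 2 * (K * ‖E₂‖) + P ^ 2 * |R| + 2 * (|P| * M) * ‖E₃‖ + ‖E₃‖ ^ 2 := by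
        simp only [norm_mul, norm_pow, Complex.norm_real, Complex.norm_natCast,
          Complex.norm_ofNat, Real.norm_eq_abs, sq_abs, Nat.abs_cast]
        ring
    _ ≤ 2 * (M * (B + |P|)) + 2 * (K * (B / M)) + P ^ 2 * (8 * M) + 2 * (|P| * M) * B +
          B ^ 2 := by gcongr
    _ ≤ 2 * (M * (B + |P|)) + 2 * (3 * B * M) + P ^ 2 * (8 * M) + 2 * (|P| * M) * B +
          B ^ 2 * M := by
        gcongr
        exact le_mul_of_one_le_right (by positivity) hM1
    _ = (2 * (B + |P|) + 6 * B + 8 * P ^ 2 + 2 * |P| * B + B ^ 2) * M := by ring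
    _ ≤ _ := by gcongr

/-- Sieving out the multiples of one further prime. -/
lemma sum_ite_coprime_mul (p Q : ℕ) (hp : p.Prime) (hpQ : p.Coprime Q) (w : ℕ → ℝ) (n : ℕ) :
    ∑ k ∈ Finset.Ioc 0 n, (if k.Coprime (p * Q) then w k else 0) =
      ∑ k ∈ Finset.Ioc 0 n, (if k.Coprime Q then w k else 0) -
        ∑ k ∈ Finset.Ioc 0 (n / p), (if k.Coprime Q then w (p * k) else 0) := by
  have hmult : ∑ k ∈ Finset.Ioc 0 (n / p), (if k.Coprime Q then w (p * k) else 0) =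
      ∑ k ∈ (Finset.Ioc 0 n).filter (p ∣ ·), (if k.Coprime Q then w k else 0) := by
    refine Finset.sum_nbij' (p * ·) (· / p) ?_ ?_ ?_ ?_ ?_
    · intro k hk
      simp only [Finset.mem_Ioc, Finset.mem_filter] at hk ⊢
      refine ⟨⟨Nat.mul_pos hp.pos hk.1, ?_⟩, dvd_mul_right _ _⟩
      rw [mul_comm]
      exact (Nat.le_div_iff_mul_le hp.pos).mp hk.2
    · intro k hk
      simp only [Finset.mem_Ioc, Finset.mem_filter] at hk ⊢
      exact ⟨Nat.div_pos (Nat.le_of_dvd hk.1.1 hk.2) hp.pos, Nat.div_le_div_right hk.1.2⟩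
    · intro k _
      exact Nat.mul_div_cancel_left k hp.pos
    · intro k hk
      exact Nat.mul_div_cancel' (Finset.mem_filter.mp hk).2
    · intro k _
      have hk : (p * k).Coprime Q ↔ k.Coprime Q := by
        rw [Nat.coprime_mul_iff_left, and_iff_right hpQ]
      simp only [hk]
  rw [hmult, Finset.sum_filter, ← Finset.sum_sub_distrib]
  refine Finset.sum_congr rfl fun k _ ↦ ?_
  have hkp : k.Coprime p ↔ ¬ p ∣ k := by rw [Nat.coprime_comm, hp.coprime_iff_not_dvd]
  by_cases h : p ∣ k <;> simp [Nat.coprime_mul_iff_right, hkp, h]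

lemma abs_floor_sub_le {x : ℝ} (hx : 0 < x) : |(⌊x⌋₊ : ℝ) - x| ≤ 1 := by
  have h1 := Nat.floor_le hx.le
  have h2 := Nat.lt_floor_add_one x
  rw [abs_le]
  constructor <;> linarith

/-- The harmonic sum up to a positive real, with a uniform error term. -/
lemma abs_sum_inv_sub_log_le {x : ℝ} (hx : 0 < x) :
    |∑ k ∈ Finset.Ioc 0 ⌊x⌋₊, (k : ℝ)⁻¹ - (Real.log x + Real.eulerMascheroniConstant)| ≤
      2 / x := by
  rcases lt_or_ge x 1 with hx1 | hx1
  · rw [Nat.floor_eq_zero.mpr hx1, Finset.Ioc_self, Finset.sum_empty, le_div_iff₀ hx]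
    have hlog : Real.log x ≤ 0 := Real.log_nonpos hx.le hx1.le
    have hγ := Real.one_half_lt_eulerMascheroniConstant
    have hγ' := Real.eulerMascheroniConstant_lt_two_thirds
    have hinv : -Real.log x ≤ x⁻¹ - 1 := by
      rw [← Real.log_inv]
      exact Real.log_le_sub_one_of_pos (by positivity)
    have hxx : x * x⁻¹ = 1 := mul_inv_cancel₀ hx.ne'
    rw [zero_sub, abs_neg]
    have hb : |Real.log x + Real.eulerMascheroniConstant| ≤ x⁻¹ := by
      have : 1 < x⁻¹ := (one_lt_inv₀ hx).mpr hx1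
      rw [abs_le]; constructor <;> linarith
    calc _ ≤ x⁻¹ * x := by gcongr
      _ ≤ 2 := by rw [mul_comm, hxx]; norm_num
  · set n := ⌊x⌋₊
    have hn1 : 1 ≤ n := Nat.one_le_floor_iff x |>.mpr hx1
    have hn1' : (1 : ℝ) ≤ n := by exact_mod_cast hn1
    have hnx : (n : ℝ) ≤ x := Nat.floor_le hx.le
    have hxn : x < n + 1 := Nat.lt_floor_add_one x
    have hsum : ∑ k ∈ Finset.Ioc 0 n, (k : ℝ)⁻¹ = (harmonic n : ℝ) := by
      rw [harmonic_eq_sum_Icc]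
      push_cast
      rfl
    have hlo := Real.eulerMascheroniSeq_lt_eulerMascheroniConstant n
    have hhi := Real.eulerMascheroniConstant_lt_eulerMascheroniSeq' n
    rw [Real.eulerMascheroniSeq] at hlo
    rw [Real.eulerMascheroniSeq', if_neg (by omega)] at hhi
    have h1 : Real.log (n + 1) - Real.log x ≤ 1 / x := by
      rw [← Real.log_div (by positivity) hx.ne']
      refine (Real.log_le_sub_one_of_pos (by positivity)).trans ?_
      rw [sub_le_iff_le_add, div_le_iff₀ hx]
      field_simp
      linarith
    have h2 : Real.log x - Real.log n ≤ 2 / x := by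
      rw [← Real.log_div hx.ne' (by positivity)]
      refine (Real.log_le_sub_one_of_pos (by positivity)).trans ?_
      rw [div_sub_one (by positivity), div_le_div_iff₀ (by positivity) hx]
      nlinarith
    have h3 : 1 / x ≤ 2 / x := by gcongr; norm_num
    rw [hsum, abs_le]
    constructor <;> linarith

/-- Counting function and harmonic sum of the integers coprime to a product of distinct primes. -/
lemma exists_abs_sum_coprime_sub_le {ι : Type*} (q : ι → ℕ) (hq : ∀ i, (q i).Prime)
    (hinj : Function.Injective q) (s : Finset ι) :
    ∃ B : ℝ, ∀ x : ℝ, 0 < x →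
      |∑ k ∈ Finset.Ioc 0 ⌊x⌋₊, (if k.Coprime (∏ i ∈ s, q i) then (1 : ℝ) else 0) -
        (∏ i ∈ s, (1 - (q i : ℝ)⁻¹)) * x| ≤ B ∧
      |∑ k ∈ Finset.Ioc 0 ⌊x⌋₊, (if k.Coprime (∏ i ∈ s, q i) then (k : ℝ)⁻¹ else 0) -
        (∏ i ∈ s, (1 - (q i : ℝ)⁻¹)) * (Real.log x + (Real.eulerMascheroniConstant +
          ∑ i ∈ s, ((q i : ℝ)⁻¹ * Real.log (q i)) / (1 - (q i : ℝ)⁻¹)))| ≤ B / x := by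
  induction s using Finset.induction_on with
  | empty =>
    refine ⟨2, fun x hx ↦ ⟨?_, ?_⟩⟩
    · simpa using (abs_floor_sub_le hx).trans one_le_two
    · simpa using abs_sum_inv_sub_log_le hx
  | insert j s hj ih =>
    obtain ⟨B, hB⟩ := ih
    refine ⟨2 * B, fun x hx ↦ ?_⟩
    have hcop : (q j).Coprime (∏ i ∈ s, q i) := by
      refine Nat.Coprime.prod_right fun i hi ↦ (Nat.coprime_primes (hq j) (hq i)).mpr ?_
      exact fun h ↦ hj (hinj h ▸ hi)
    have hp1 : (1 : ℝ) < q j := by exact_mod_cast (hq j).one_lt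
    have hp0 : (0 : ℝ) < q j := by linarith
    have hu : 1 - (q j : ℝ)⁻¹ ≠ 0 := by
      have := inv_lt_one_of_one_lt₀ hp1
      linarith
    obtain ⟨hA, hH⟩ := hB x hx
    obtain ⟨hA', hH'⟩ := hB (x / q j) (by positivity)
    rw [Finset.prod_insert hj, Finset.prod_insert hj, Finset.sum_insert hj,
      sum_ite_coprime_mul _ _ (hq j) hcop, sum_ite_coprime_mul _ _ (hq j) hcop,
      ← Nat.floor_div_natCast]
    set P := ∏ i ∈ s, (1 - (q i : ℝ)⁻¹)
    set g := ∑ i ∈ s, ((q i : ℝ)⁻¹ * Real.log (q i)) / (1 - (q i : ℝ)⁻¹)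
    constructor
    · calc _ = |(∑ k ∈ Finset.Ioc 0 ⌊x⌋₊, (if k.Coprime (∏ i ∈ s, q i) then (1 : ℝ) else 0) -
              P * x) - (∑ k ∈ Finset.Ioc 0 ⌊x / q j⌋₊,
                (if k.Coprime (∏ i ∈ s, q i) then (1 : ℝ) else 0) - P * (x / q j))| := by
            congr 1; ring
        _ ≤ B + B := (abs_sub _ _).trans (add_le_add hA hA')
        _ = 2 * B := by ring
    · have hscale : ∑ k ∈ Finset.Ioc 0 ⌊x / q j⌋₊,
          (if k.Coprime (∏ i ∈ s, q i) then ((q j * k : ℕ) : ℝ)⁻¹ else 0) =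
          (q j : ℝ)⁻¹ * ∑ k ∈ Finset.Ioc 0 ⌊x / q j⌋₊,
            (if k.Coprime (∏ i ∈ s, q i) then (k : ℝ)⁻¹ else 0) := by
        rw [Finset.mul_sum]
        refine Finset.sum_congr rfl fun k _ ↦ ?_
        split_ifs
        · push_cast; rw [mul_inv]
        · rw [mul_zero]
      rw [hscale]
      rw [Real.log_div hx.ne' hp0.ne'] at hH'
      set T := ∑ k ∈ Finset.Ioc 0 ⌊x⌋₊, (if k.Coprime (∏ i ∈ s, q i) then (k : ℝ)⁻¹ else 0)
      set T' := ∑ k ∈ Finset.Ioc 0 ⌊x / q j⌋₊,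
        (if k.Coprime (∏ i ∈ s, q i) then (k : ℝ)⁻¹ else 0)
      set γ := Real.eulerMascheroniConstant
      calc _ = |(T - P * (Real.log x + (γ + g))) -
            (q j : ℝ)⁻¹ * (T' - P * (Real.log x - Real.log (q j) + (γ + g)))| := by
            congr 1
            generalize (q j : ℝ)⁻¹ = u at hu
            field_simp
            ring
        _ ≤ B / x + (q j : ℝ)⁻¹ * (B / (x / q j)) := by
            refine (abs_sub _ _).trans (add_le_add hH ?_)
            rw [abs_mul, abs_of_pos (inv_pos.mpr hp0)]
            gcongr
        _ = 2 * B / x := by field_simp; ring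

/-- Partial sums of a nonprincipal Dirichlet character are bounded. -/
lemma norm_sum_dirichletCharacter_le {N : ℕ} [NeZero N] (χ : DirichletCharacter ℂ N) (hχ : χ ≠ 1)
    (n : ℕ) : ‖∑ k ∈ Finset.Ioc 0 n, χ (k : ZMod N)‖ ≤ N + 1 := by
  have hblock : ∀ m : ℕ, ∑ k ∈ Finset.range N, χ ((m + k : ℕ) : ZMod N) = 0 := by
    intro m
    rw [← MulChar.sum_eq_zero_of_ne_one hχ, ← Equiv.sum_comp (Equiv.addLeft (m : ZMod N))]
    refine Finset.sum_nbij' (fun k ↦ (k : ZMod N)) ZMod.val ?_ ?_ ?_ ?_ ?_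
    · simp
    · simp [ZMod.val_lt]
    · intro k hk
      exact ZMod.val_cast_of_lt (Finset.mem_range.mp hk)
    · simp
    · simp
  have hper : Function.Periodic (fun m ↦ ∑ k ∈ Finset.range m, χ (k : ZMod N)) N := by
    intro m
    simp only [Finset.sum_range_add, hblock, add_zero]
  have hrange : ∀ m : ℕ, ‖∑ k ∈ Finset.range m, χ (k : ZMod N)‖ ≤ N := by
    intro m
    rw [← hper.map_mod_nat m]
    refine (norm_sum_le_of_le _ fun (k : ℕ) _ ↦ χ.norm_le_one (k : ZMod N)).trans ?_
    simpa using (Nat.mod_lt m (NeZero.pos N)).le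
  have hIoc : ∑ k ∈ Finset.Ioc 0 n, χ (k : ZMod N) =
      ∑ k ∈ Finset.range (n + 1), χ (k : ZMod N) - χ ((0 : ℕ) : ZMod N) := by
    rw [Finset.range_eq_Ico, Finset.sum_eq_sum_Ico_succ_bot (by omega), add_sub_cancel_left]
    rfl
  rw [hIoc]
  exact (norm_sub_le _ _).trans (add_le_add (hrange _) (χ.norm_le_one _))

lemma abs_mul_log_add_sub_le (c : ℝ) {K X : ℝ} (hK : 1 ≤ K) (hKX : K ≤ X) (hXK : X ≤ K + 1) :
    |(X * Real.log X + c * X) - (K * Real.log K + c * K)| ≤ (2 + |c|) * Real.sqrt X := by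
  have hX : 1 ≤ X := hK.trans hKX
  have hs : 1 ≤ Real.sqrt X := Real.one_le_sqrt.mpr hX
  have hlog0 : 0 ≤ Real.log X := Real.log_nonneg hX
  have hlog : Real.log X ≤ 2 * (Real.sqrt X - 1) := by
    have := Real.log_le_sub_one_of_pos (by linarith : 0 < Real.sqrt X)
    rw [Real.log_sqrt (by linarith)] at this
    linarith
  have hmono : Real.log K ≤ Real.log X := Real.log_le_log (by linarith) hKX
  have hdiff : K * (Real.log X - Real.log K) ≤ 1 := by
    rw [← Real.log_div (by linarith) (by linarith)]
    calc K * Real.log (X / K) ≤ K * (X / K - 1) := by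
          gcongr
          exact Real.log_le_sub_one_of_pos (by positivity)
      _ = X - K := by field_simp
      _ ≤ 1 := by linarith
  have hdiff0 : 0 ≤ K * (Real.log X - Real.log K) :=
    mul_nonneg (by linarith) (by linarith)
  have hstep : (X - K) * Real.log X ≤ Real.log X :=
    mul_le_of_le_one_left hlog0 (by linarith)
  have hstep0 : 0 ≤ (X - K) * Real.log X := mul_nonneg (by linarith) hlog0
  calc _ = |((X - K) * Real.log X + K * (Real.log X - Real.log K)) + c * (X - K)| := by
        congr 1; ring
    _ ≤ 2 * Real.sqrt X + |c| * Real.sqrt X := by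
        refine (abs_add_le _ _).trans (add_le_add ?_ ?_)
        · rw [abs_of_nonneg (by linarith)]
          linarith
        · rw [abs_mul, abs_of_nonneg (by linarith : 0 ≤ X - K)]
          gcongr
          linarith
    _ = _ := by ring

/-- The divisor sum up to a real number, given the asymptotics of the partial sums of `f k`
and of `f k / k`. -/
lemma exists_norm_sum_Ico_card_divisors_mul_sub_le (f : ℕ → ℂ)
    (hf : ∀ a b, f (a * b) = f a * f b) (hf1 : ∀ a, ‖f a‖ ≤ 1) (P g B : ℝ)
    (hA : ∀ n : ℕ, ‖∑ k ∈ Finset.Ioc 0 n, f k - (P * n : ℝ)‖ ≤ B)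
    (hH : ∀ n : ℕ, 0 < n → ‖P * ∑ k ∈ Finset.Ioc 0 n, f k / k -
      (P ^ 2 * (Real.log n + g) : ℝ)‖ ≤ B / n) :
    ∃ C : ℝ, ∀ X : ℝ, 2 ≤ X →
      ‖∑ n ∈ Finset.Ico 1 ⌈X⌉₊, (n.divisors.card : ℂ) * f n -
        (P ^ 2 * (X * Real.log X + (2 * g - 1) * X) : ℝ)‖ ≤ C * Real.sqrt X := by
  obtain ⟨C, hC0, hC⟩ := exists_norm_sum_card_divisors_mul_sub_le f hf hf1 P g B hA hH
  refine ⟨C + P ^ 2 * (2 + |2 * g - 1|), fun X hX ↦ ?_⟩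
  obtain ⟨K, hK⟩ : ∃ K, ⌈X⌉₊ = K + 1 :=
    Nat.exists_eq_succ_of_ne_zero (Nat.ceil_pos.mpr (by linarith)).ne'
  have hXK : X ≤ K + 1 := by
    have := Nat.le_ceil X
    rw [hK] at this
    exact_mod_cast this
  have hKX : (K : ℝ) ≤ X := (Nat.lt_ceil.mp (by omega)).le
  have hK1 : (1 : ℝ) ≤ K := by linarith
  have hIco : Finset.Ico 1 ⌈X⌉₊ = Finset.Ioc 0 K := by
    ext n
    simp only [Finset.mem_Ico, Finset.mem_Ioc]
    omega
  rw [hIco]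
  set S := ∑ n ∈ Finset.Ioc 0 K, (n.divisors.card : ℂ) * f n
  calc _ = ‖(S - (P ^ 2 * (K * Real.log K + (2 * g - 1) * K) : ℝ)) -
        (P ^ 2 * ((X * Real.log X + (2 * g - 1) * X) -
          (K * Real.log K + (2 * g - 1) * K)) : ℝ)‖ := by
        congr 1; push_cast; ring
    _ ≤ C * Real.sqrt K + P ^ 2 * ((2 + |2 * g - 1|) * Real.sqrt X) := by
        refine (norm_sub_le _ _).trans (add_le_add (hC K (by exact_mod_cast hK1)) ?_)
        rw [Complex.norm_real, Real.norm_eq_abs, abs_mul, abs_of_nonneg (sq_nonneg P)]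
        gcongr
        exact abs_mul_log_add_sub_le _ hK1 hKX hXK
    _ ≤ C * Real.sqrt X + P ^ 2 * ((2 + |2 * g - 1|) * Real.sqrt X) := by gcongr
    _ = _ := by ring

/-- A character vanishing exactly on the integers not coprime to `Q ≠ 0` has nonzero modulus. -/
lemma modulus_ne_zero_of_eq_zero_iff {N Q : ℕ} (hQ : Q ≠ 0) (χ : DirichletCharacter ℂ N)
    (hχ : ∀ m : ℕ, χ (m : ZMod N) = 0 ↔ ¬ Nat.Coprime m Q) : N ≠ 0 := by
  rintro rfl
  have hne : χ ((Q + 1 : ℕ) : ZMod 0) ≠ 0 := by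
    rw [Ne, hχ, not_not]
    simp
  refine hne (χ.map_nonunit ?_)
  change ¬ IsUnit (((Q + 1 : ℕ) : ℤ))
  rw [Int.isUnit_iff]
  omega

/-- Let `q 0 < … < q (r-1)` be distinct primes and let `χ` be a Dirichlet
character (mod `N`) such that `χ m = 0` iff `gcd (m, q 0 ⋯ q (r-1)) ≠ 1`.  Then for `X ≥ 2`,
`∑_{n < X} d(n) χ(n) = δ(χ) ∏ (1 - (q i)⁻¹)^2 (X log X + (2 γ_S - 1) X) + O(√X)`,
where `d n` is the number of divisors, `δ(χ) = 1` iff `χ` is principal, and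
`γ_S = γ + ∑ i, (q i)⁻¹ log (q i) / (1 - (q i)⁻¹)`. -/
theorem stmt1 (r : ℕ) (q : Fin r → ℕ) (hq : ∀ i, (q i).Prime) (hmono : StrictMono q)
    (N : ℕ) (χ : DirichletCharacter ℂ N)
    (hχ : ∀ m : ℕ, χ (m : ZMod N) = 0 ↔ ¬ Nat.Coprime m (∏ i, q i)) :
    ∃ C : ℝ, ∀ X : ℝ, 2 ≤ X →
      ‖(∑ n ∈ Finset.Ico 1 ⌈X⌉₊, (n.divisors.card : ℂ) * χ (n : ZMod N)) -
        (if χ = 1 then 1 else 0) * (∏ i, (1 - (q i : ℂ)⁻¹) ^ 2) *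
          ((X * Real.log X + (2 * (Real.eulerMascheroniConstant +
            ∑ i, ((q i : ℝ)⁻¹ * Real.log (q i)) / (1 - (q i : ℝ)⁻¹)) - 1) * X : ℝ) : ℂ)‖ ≤
        C * Real.sqrt X := by
  have hN : N ≠ 0 := modulus_ne_zero_of_eq_zero_iff
    (Finset.prod_ne_zero_iff.mpr fun i _ ↦ (hq i).ne_zero) χ hχ
  have : NeZero N := ⟨hN⟩
  have hmul : ∀ a b : ℕ, χ ((a * b : ℕ) : ZMod N) = χ (a : ZMod N) * χ (b : ZMod N) := by
    intro a b
    rw [Nat.cast_mul, map_mul]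
  have hle : ∀ a : ℕ, ‖χ (a : ZMod N)‖ ≤ 1 := fun a ↦ χ.norm_le_one _
  by_cases h1 : χ = 1
  · obtain ⟨B, hB⟩ := exists_abs_sum_coprime_sub_le q hq hmono.injective Finset.univ
    have hval : ∀ k : ℕ, χ (k : ZMod N) =
        ((if k.Coprime (∏ i, q i) then (1 : ℝ) else 0 : ℝ) : ℂ) := by
      intro k
      by_cases hk : k.Coprime (∏ i, q i)
      · have hne : χ (k : ZMod N) ≠ 0 := fun h ↦ (hχ k).mp h hk
        have hunit : IsUnit (k : ZMod N) := by
          by_contra hu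
          exact hne (χ.map_nonunit hu)
        rw [if_pos hk, h1, MulChar.one_apply hunit, Complex.ofReal_one]
      · rw [if_neg hk, (hχ k).mpr hk, Complex.ofReal_zero]
    set P := ∏ i, (1 - (q i : ℝ)⁻¹) with hP
    set g := Real.eulerMascheroniConstant +
      ∑ i, ((q i : ℝ)⁻¹ * Real.log (q i)) / (1 - (q i : ℝ)⁻¹)
    have hB0 : 0 ≤ B := (abs_nonneg _).trans (hB 1 one_pos).1
    have hP1 : |P| ≤ 1 := by
      rw [hP, Finset.abs_prod]
      refine Finset.prod_le_one (fun _ _ ↦ abs_nonneg _) fun i _ ↦ ?_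
      have h1 : (q i : ℝ)⁻¹ ≤ 1 := Nat.cast_inv_le_one _
      have h0 : 0 ≤ (q i : ℝ)⁻¹ := by positivity
      rw [abs_of_nonneg (by linarith)]
      linarith
    have hA : ∀ n : ℕ, ‖∑ k ∈ Finset.Ioc 0 n, χ (k : ZMod N) - (P * n : ℝ)‖ ≤ B := by
      intro n
      rcases n.eq_zero_or_pos with rfl | hn
      · simpa using hB0
      have := (hB n (by exact_mod_cast hn)).1
      rw [Nat.floor_natCast] at this
      rw [Finset.sum_congr rfl fun k _ ↦ hval k, ← Complex.ofReal_sum, ← Complex.ofReal_sub,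
        Complex.norm_real, Real.norm_eq_abs]
      exact this
    have hH : ∀ n : ℕ, 0 < n → ‖P * ∑ k ∈ Finset.Ioc 0 n, χ (k : ZMod N) / k -
        (P ^ 2 * (Real.log n + g) : ℝ)‖ ≤ B / n := by
      intro n hn
      have := (hB n (by exact_mod_cast hn)).2
      rw [Nat.floor_natCast] at this
      have hdiv : ∀ k : ℕ, χ (k : ZMod N) / k =
          ((if k.Coprime (∏ i, q i) then (k : ℝ)⁻¹ else 0 : ℝ) : ℂ) := by
        intro k
        rw [hval]
        split_ifs <;> simp
      rw [Finset.sum_congr rfl fun k _ ↦ hdiv k, ← Complex.ofReal_sum, ← Complex.ofReal_mul,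
        ← Complex.ofReal_sub, Complex.norm_real, Real.norm_eq_abs, pow_two, mul_assoc, ← mul_sub,
        abs_mul]
      exact (mul_le_of_le_one_left (abs_nonneg _) hP1).trans this
    obtain ⟨C, hC⟩ := exists_norm_sum_Ico_card_divisors_mul_sub_le
      (fun n ↦ χ (n : ZMod N)) hmul hle P g B hA hH
    refine ⟨C, fun X hX ↦ ?_⟩
    have hPc : ∏ i, (1 - (q i : ℂ)⁻¹) ^ 2 = ((P ^ 2 : ℝ) : ℂ) := by
      rw [Finset.prod_pow, hP]
      push_cast
      rfl
    rw [if_pos h1, one_mul, hPc, ← Complex.ofReal_mul]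
    exact hC X hX
  · obtain ⟨C, hC⟩ := exists_norm_sum_Ico_card_divisors_mul_sub_le
      (fun n ↦ χ (n : ZMod N)) hmul hle 0 0 (N + 1)
      (fun n ↦ by simpa using norm_sum_dirichletCharacter_le χ h1 n)
      (fun n _ ↦ by simp; positivity)
    refine ⟨C, fun X hX ↦ ?_⟩
    rw [if_neg h1, zero_mul, zero_mul]
    simpa using hC X hX
end

section
/- Let q_1 < … < q_r be distinct primes and let μ_1, μ_2 be Dirichlet characters such that for i = 1,2, μ_i(m) = 0 if and only if gcd(m, q_1⋯q_r) ≠ 1. Let Φ : ℝ → ℂ be a smooth function of rapid decay (for every k ≥ 0, sup_{t∈ℝ} (1+|t|)^k |Φ(t)| < ∞). Then, as X → ∞, ∑_{n < X} (1/2π) ∫_{ℝ} Φ(t) · n^{−it} ∑_{d ∣ n} d^{2it} μ_1(d) μ_2(n/d) dt = (1/2)·δ(μ_1)·δ(μ_2)·∏_{i=1}^{r}(1 − q_i^{−1})^2·Φ(0)·X + o(X). -/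
open scoped Classical

open MeasureTheory Asymptotics Filter

open scoped FourierTransform Topology

/-- Pointwise symmetric Fourier inversion at a point of differentiability. -/
theorem tendsto_intervalIntegral_fourier {f : ℝ → ℂ} (hc : Continuous f)
    (hd : DifferentiableAt ℝ f 0) (hf : Integrable f) :
    Tendsto (fun L : ℝ => ∫ w in -L..L, 𝓕 f w) atTop (𝓝 (f 0)) := by
  set γ : ℝ → ℂ := fun t => Complex.exp (-Real.pi * 1 * (t : ℂ) ^ 2) with hγ
  have hγF : 𝓕 γ = γ := by
    have := fourier_gaussian_pi (b := 1) (by simp)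
    simpa [hγ] using this
  have hγi : Integrable γ := by
    have := integrable_cexp_neg_mul_sq (b := Real.pi) (by simpa using Real.pi_pos)
    simpa [hγ] using this
  have hγ1 : ∫ w, γ w = 1 := by
    have h := integral_gaussian_complex (b := Real.pi) (by simpa using Real.pi_pos)
    simpa [hγ, Real.pi_ne_zero] using h
  have hγd : Differentiable ℝ γ := by
    intro t
    have : DifferentiableAt ℝ (fun t : ℝ => (t : ℂ)) t := Complex.ofRealCLM.differentiableAt
    fun_prop
  set g : ℝ → ℂ := fun t => f t - f 0 * γ t with hg
  have hg0 : g 0 = 0 := by simp [hg, hγ]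
  have hgi : Integrable g := hf.sub (hγi.const_mul _)
  have hgd : DifferentiableAt ℝ g 0 := hd.sub ((hγd 0).const_mul _)
  have hgc : Continuous g := hc.sub (continuous_const.mul hγd.continuous)
  have hΨc : Continuous (dslope g 0) := by
    rw [← continuousOn_univ, continuousOn_dslope (by simp)]
    exact ⟨hgc.continuousOn, hgd⟩
  have hmul : ∀ t : ℝ, (t : ℂ) * dslope g 0 t = g t := by
    intro t
    have := sub_smul_dslope g 0 t
    simpa [hg0] using this
  have hΨi : Integrable (dslope g 0) := by
    rw [← integrableOn_univ, ← Set.union_compl_self (Set.Icc (-1 : ℝ) 1)]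
    refine (hΨc.integrableOn_Icc).union ?_
    refine Integrable.mono hgi.integrableOn hΨc.aestronglyMeasurable ?_
    filter_upwards [ae_restrict_mem measurableSet_Icc.compl] with t ht
    have ht1 : 1 ≤ |t| := by
      by_contra! h
      exact ht ⟨(abs_lt.1 h).1.le, (abs_lt.1 h).2.le⟩
    rw [← hmul t, norm_mul, Complex.norm_real, Real.norm_eq_abs]
    exact le_mul_of_one_le_left (norm_nonneg _) ht1
  have htΨ : Integrable (fun t : ℝ => t • dslope g 0 t) := by
    refine hgi.congr (Eventually.of_forall fun t => ?_)
    simp [hmul t]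
  have hder : ∀ w : ℝ, HasDerivAt (𝓕 (dslope g 0)) (-2 * Real.pi * Complex.I * 𝓕 g w) w := by
    intro w
    have := Real.hasDerivAt_fourier hΨi htΨ w
    have e : (fun x : ℝ => (-2 * Real.pi * Complex.I * x) • dslope g 0 x) =
        (-2 * Real.pi * Complex.I : ℂ) • g := by
      ext x
      rw [Pi.smul_apply, ← hmul x]
      simp [mul_assoc]
    rw [e] at this
    convert! this using 1
    rw [Real.fourier_real_eq, Real.fourier_real_eq, ← integral_const_mul]
    congr 1 with v
    simp only [Circle.smul_def, smul_eq_mul, Pi.smul_apply]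
    ring
  have hgFc : Continuous (𝓕 g) := by
    exact VectorFourier.fourierIntegral_continuous Real.continuous_fourierChar
      (by fun_prop) hgi
  have hint : ∀ L : ℝ, ∫ w in -L..L, 𝓕 g w =
      (-2 * Real.pi * Complex.I : ℂ)⁻¹ * (𝓕 (dslope g 0) L - 𝓕 (dslope g 0) (-L)) := by
    intro L
    rw [← intervalIntegral.integral_eq_sub_of_hasDerivAt (fun w _ => hder w)
      ((continuous_const.mul hgFc).intervalIntegrable _ _), intervalIntegral.integral_const_mul,
      inv_mul_cancel_left₀]
    simp [Real.pi_ne_zero]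
  have hRL := Real.zero_at_infty_fourier (dslope g 0)
  have h1 : Tendsto (fun L : ℝ => ∫ w in -L..L, 𝓕 g w) atTop (𝓝 0) := by
    simp_rw [hint]
    have a := hRL.mono_left atTop_le_cocompact
    have b := (hRL.mono_left atBot_le_cocompact).comp tendsto_neg_atTop_atBot
    simpa using (a.sub b).const_mul ((-2 * Real.pi * Complex.I : ℂ)⁻¹)
  have h2 : Tendsto (fun L : ℝ => ∫ w in -L..L, γ w) atTop (𝓝 1) := by
    rw [← hγ1]
    exact intervalIntegral_tendsto_integral hγi tendsto_neg_atTop_atBot tendsto_id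
  have hsplit : 𝓕 f = fun w => 𝓕 g w + f 0 * γ w := by
    ext w
    have hfe : f = fun t => g t + f 0 * γ t := by ext t; simp [hg]
    have h3 : Integrable (fun v => Real.fourierChar (-(v * w)) • g v) := by
      have := (Real.fourierIntegral_convergent_iff (f := g) w).2 hgi
      simpa [mul_comm] using this
    have h4 : Integrable (fun v => Real.fourierChar (-(v * w)) • γ v) := by
      have := (Real.fourierIntegral_convergent_iff (f := γ) w).2 hγi
      simpa [mul_comm] using this
    have h5 : γ w = 𝓕 γ w := by rw [hγF]
    rw [h5, Real.fourier_real_eq, Real.fourier_real_eq, Real.fourier_real_eq,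
      ← integral_const_mul, ← integral_add h3 (h4.const_mul _)]
    congr 1 with v
    conv_lhs => rw [hfe]
    simp only [Circle.smul_def, smul_eq_mul]
    ring
  rw [hsplit]
  have h3 : ∀ L : ℝ, ∫ w in -L..L, (𝓕 g w + f 0 * γ w) =
      (∫ w in -L..L, 𝓕 g w) + f 0 * ∫ w in -L..L, γ w := by
    intro L
    rw [intervalIntegral.integral_add (hgFc.intervalIntegrable _ _)
      ((hγi.const_mul _).intervalIntegrable), intervalIntegral.integral_const_mul]
  simp_rw [h3]
  simpa using h1.add (h2.const_mul (f 0))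

/-- The Fourier integral with kernel `exp (i u t)`. -/
noncomputable def expIntegral (Φ : ℝ → ℂ) (u : ℝ) : ℂ :=
  ∫ t : ℝ, Φ t * Complex.exp (Complex.I * u * t)

theorem expIntegral_eq_fourier (Φ : ℝ → ℂ) (u : ℝ) :
    expIntegral Φ u = 𝓕 Φ ((-(2 * Real.pi)⁻¹) * u) := by
  rw [expIntegral, Real.fourier_real_eq_integral_exp_smul]
  congr 1 with t
  rw [smul_eq_mul, mul_comm]
  congr 2
  push_cast
  have : (Real.pi : ℂ) ≠ 0 := by simp [Real.pi_ne_zero]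
  field_simp

theorem norm_expIntegral_le (Φ : ℝ → ℂ) (u : ℝ) : ‖expIntegral Φ u‖ ≤ ∫ t, ‖Φ t‖ := by
  refine (norm_integral_le_integral_norm _).trans_eq ?_
  congr 1 with t
  rw [norm_mul, mul_assoc, mul_comm Complex.I, ← Complex.ofReal_mul,
    Complex.norm_exp_ofReal_mul_I, mul_one]

theorem integrable_mul_exp {Φ : ℝ → ℂ} (h : Integrable Φ) (u : ℝ) :
    Integrable fun t : ℝ => Φ t * Complex.exp (Complex.I * u * t) := by
  refine Integrable.mono h (h.1.mul (by fun_prop)) (Eventually.of_forall fun t => ?_)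
  rw [norm_mul, mul_assoc, mul_comm Complex.I, ← Complex.ofReal_mul,
    Complex.norm_exp_ofReal_mul_I, mul_one]

theorem norm_expIntegral_sub_le {Φ : ℝ → ℂ} (h : Integrable Φ)
    (h' : Integrable fun t : ℝ => t * Φ t) (u v : ℝ) :
    ‖expIntegral Φ u - expIntegral Φ v‖ ≤ (∫ t : ℝ, ‖t * Φ t‖) * |u - v| := by
  rw [expIntegral, expIntegral, ← integral_sub (integrable_mul_exp h u) (integrable_mul_exp h v),
    ← integral_mul_const]
  refine norm_integral_le_of_norm_le (h'.norm.mul_const _) (Eventually.of_forall fun t => ?_)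
  have e : Φ t * Complex.exp (Complex.I * u * t) - Φ t * Complex.exp (Complex.I * v * t) =
      Φ t * (Complex.exp ((v * t : ℝ) * Complex.I) *
        (Complex.exp (Complex.I * ((u - v) * t : ℝ)) - 1)) := by
    rw [mul_sub, ← Complex.exp_add, mul_one, mul_sub]
    push_cast
    congr 3 <;> ring_nf
  rw [e, norm_mul, norm_mul, Complex.norm_exp_ofReal_mul_I, one_mul, norm_mul, Complex.norm_real]
  have := Real.norm_exp_I_mul_ofReal_sub_one_le (x := (u - v) * t)
  rw [Real.norm_eq_abs, abs_mul] at this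
  calc _ ≤ ‖Φ t‖ * (|u - v| * |t|) := by gcongr
    _ = _ := by rw [Real.norm_eq_abs]; ring

theorem tendsto_expIntegral_cocompact (Φ : ℝ → ℂ) :
    Tendsto (expIntegral Φ) (cocompact ℝ) (𝓝 0) := by
  have : expIntegral Φ = 𝓕 Φ ∘ fun u => (-(2 * Real.pi)⁻¹) * u :=
    funext (expIntegral_eq_fourier Φ)
  rw [this]
  refine (Real.zero_at_infty_fourier Φ).comp ?_
  exact tendsto_cocompact_mul_left₀ (by simp [Real.pi_ne_zero])

theorem tendsto_intervalIntegral_expIntegral {Φ : ℝ → ℂ} (hc : Continuous Φ)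
    (hd : DifferentiableAt ℝ Φ 0) (hΦ : Integrable Φ) :
    Tendsto (fun L : ℝ => ∫ u in -L..L, expIntegral Φ u) atTop (𝓝 (2 * Real.pi * Φ 0)) := by
  have h := tendsto_intervalIntegral_fourier hc hd hΦ
  have hL : Tendsto (fun L : ℝ => (2 * Real.pi)⁻¹ * L) atTop atTop :=
    tendsto_id.const_mul_atTop (by positivity)
  refine ((h.comp hL).const_mul (2 * Real.pi : ℂ)).congr fun L => ?_
  simp_rw [expIntegral_eq_fourier]
  rw [intervalIntegral.integral_comp_mul_left (fun w => 𝓕 Φ w) (by simp [Real.pi_ne_zero]),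
    intervalIntegral.integral_symm]
  simp

/-- Abel summation: weights with bounded discrepancy against a function whose increments are
dominated by those of `V`. -/
theorem norm_sum_Ioc_sub_integral_le {χ : ℕ → ℂ} {κ : ℂ} {B : ℝ}
    (hB : ∀ n : ℕ, ‖∑ j ∈ Finset.range (n + 1), χ j - κ * n‖ ≤ B) {h : ℝ → ℂ} {V : ℝ → ℝ} {m : ℕ}
    (hc : ContinuousOn h (Set.Ici (m : ℝ)))
    (hV : ∀ x y : ℝ, m ≤ x → x ≤ y → ‖h y - h x‖ ≤ V y - V x) {k : ℕ} (hmk : m ≤ k) :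
    ‖∑ n ∈ Finset.Ioc m k, χ n * h n - κ * ∫ x in (m : ℝ)..k, h x‖ ≤
      B * (‖h m‖ + ‖h k‖) + (‖κ‖ + B) * (V k - V m) := by
  set R : ℕ → ℂ := fun n => ∑ j ∈ Finset.range (n + 1), χ j - κ * n with hR
  have hRs : ∀ n, R (n + 1) = R n + χ (n + 1) - κ := by
    intro n
    simp only [hR]
    rw [Finset.sum_range_succ _ (n + 1)]
    push_cast
    ring
  have hint : ∀ a b : ℝ, m ≤ a → a ≤ b → IntervalIntegrable h volume a b := fun a b ha hab =>
    (hc.mono fun x hx => ha.trans (by rw [Set.uIcc_of_le hab] at hx; exact hx.1)).intervalIntegrable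
  have key : ‖∑ n ∈ Finset.Ioc m k, χ n * h n - κ * (∫ x in (m : ℝ)..k, h x)
      - R k * h k + R m * h m‖ ≤ (‖κ‖ + B) * (V k - V m) := by
    induction k, hmk using Nat.le_induction with
    | base => simp
    | succ k hmk ih =>
      have hmk' : (m : ℝ) ≤ k := by exact_mod_cast hmk
      have hk1 : (k : ℝ) ≤ (k + 1 : ℕ) := by push_cast; linarith
      have hsum : ∑ n ∈ Finset.Ioc m (k + 1), χ n * h n =
          ∑ n ∈ Finset.Ioc m k, χ n * h n + χ (k + 1) * h (k + 1 : ℕ) :=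
        Finset.sum_Ioc_succ_top hmk _
      have hI : ∫ x in (m : ℝ)..(k + 1 : ℕ), h x =
          (∫ x in (m : ℝ)..k, h x) + ∫ x in (k : ℝ)..(k + 1 : ℕ), h x :=
        (intervalIntegral.integral_add_adjacent_intervals (hint _ _ le_rfl hmk')
          (hint _ _ hmk' hk1)).symm
      have hd : ‖h (k + 1 : ℕ) - ∫ x in (k : ℝ)..(k + 1 : ℕ), h x‖ ≤ V (k + 1 : ℕ) - V k := by
        have e : h (k + 1 : ℕ) - ∫ x in (k : ℝ)..(k + 1 : ℕ), h x =
            ∫ x in (k : ℝ)..(k + 1 : ℕ), (h (k + 1 : ℕ) - h x) := by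
          rw [intervalIntegral.integral_sub (by simp) (hint _ _ hmk' hk1)]
          simp
        rw [e]
        refine (intervalIntegral.norm_integral_le_of_norm_le_const
          (C := V (k + 1 : ℕ) - V k) ?_).trans_eq (by simp)
        intro x hx
        rw [Set.uIoc_of_le hk1] at hx
        refine (hV x _ (hmk'.trans hx.1.le) hx.2).trans ?_
        have := (norm_nonneg _).trans (hV k x hmk' hx.1.le)
        linarith
      have hd2 := hV k (k + 1 : ℕ) hmk' hk1
      have e : ∑ n ∈ Finset.Ioc m (k + 1), χ n * h n - κ * (∫ x in (m : ℝ)..(k + 1 : ℕ), h x)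
          - R (k + 1) * h (k + 1 : ℕ) + R m * h m =
          (∑ n ∈ Finset.Ioc m k, χ n * h n - κ * (∫ x in (m : ℝ)..k, h x)
            - R k * h k + R m * h m) +
          κ * (h (k + 1 : ℕ) - ∫ x in (k : ℝ)..(k + 1 : ℕ), h x) -
          R k * (h (k + 1 : ℕ) - h k) := by
        rw [hsum, hI, hRs]
        ring
      rw [e]
      refine (norm_sub_le _ _).trans ((add_le_add (norm_add_le _ _) le_rfl).trans ?_)
      rw [norm_mul, norm_mul]
      have h1 := mul_le_mul_of_nonneg_left hd (norm_nonneg κ)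
      have h2 := mul_le_mul (hB k) hd2 (norm_nonneg _) ((norm_nonneg _).trans (hB k))
      linarith
  have e : ∑ n ∈ Finset.Ioc m k, χ n * h n - κ * ∫ x in (m : ℝ)..k, h x =
      (∑ n ∈ Finset.Ioc m k, χ n * h n - κ * (∫ x in (m : ℝ)..k, h x) - R k * h k + R m * h m)
        + R k * h k - R m * h m := by ring
  rw [e]
  refine (norm_sub_le _ _).trans ((add_le_add (norm_add_le _ _) le_rfl).trans ?_)
  rw [norm_mul, norm_mul]
  have h1 := mul_le_mul_of_nonneg_right (hB k) (norm_nonneg (h k))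
  have h2 := mul_le_mul_of_nonneg_right (hB m) (norm_nonneg (h m))
  linarith

theorem norm_sum_mul_id_sub_le {ψ : ℕ → ℂ} {κ : ℂ} {B : ℝ}
    (hB : ∀ n : ℕ, ‖∑ j ∈ Finset.range (n + 1), ψ j - κ * n‖ ≤ B) {y : ℝ} (hy : 0 ≤ y) :
    ‖∑ b ∈ Finset.Ioc 0 ⌊y⌋₊, ψ b * b - κ / 2 * (y ^ 2 : ℝ)‖ ≤ (2 * B + 2 * ‖κ‖) * y := by
  have hB0 : 0 ≤ B := (norm_nonneg _).trans (hB 0)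
  have h := norm_sum_Ioc_sub_integral_le hB (h := fun x => (x : ℂ)) (V := id) (m := 0)
    (by fun_prop) (fun x y _ hxy => by
      rw [← Complex.ofReal_sub, Complex.norm_real, Real.norm_of_nonneg (by linarith)]; rfl)
    (Nat.zero_le ⌊y⌋₊)
  have hn := Nat.floor_le hy
  have hn' := (Nat.lt_floor_add_one y).le
  set n := ⌊y⌋₊
  have hI : ∫ x in ((0 : ℕ) : ℝ)..(n : ℝ), (x : ℂ) = ((n ^ 2 / 2 : ℝ) : ℂ) := by
    rw [intervalIntegral.integral_ofReal]
    congr 1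
    simp
  rw [hI] at h
  have e : ∑ b ∈ Finset.Ioc 0 n, ψ b * b - κ / 2 * (y ^ 2 : ℝ) =
      (∑ b ∈ Finset.Ioc 0 n, ψ b * b - κ * (n ^ 2 / 2 : ℝ)) - κ * ((y ^ 2 - n ^ 2) / 2 : ℝ) := by
    push_cast
    ring
  rw [e]
  have hn0 : (0 : ℝ) ≤ n := Nat.cast_nonneg n
  have h2 : ‖κ * ((y ^ 2 - n ^ 2) / 2 : ℝ)‖ ≤ ‖κ‖ * y := by
    rw [norm_mul, Complex.norm_real, Real.norm_of_nonneg (by nlinarith)]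
    gcongr
    nlinarith
  refine (norm_sub_le _ _).trans ((add_le_add h h2).trans ?_)
  simp only [Nat.cast_zero, Complex.ofReal_zero, norm_zero, zero_add, id, sub_zero,
    Complex.norm_real, Real.norm_natCast]
  have := norm_nonneg κ
  nlinarith [mul_le_mul_of_nonneg_left hn hB0, mul_le_mul_of_nonneg_left hn this]

theorem norm_sum_log_sub_integral_le {χ : ℕ → ℂ} {κ : ℂ} {B : ℝ}
    (hB : ∀ n : ℕ, ‖∑ j ∈ Finset.range (n + 1), χ j - κ * n‖ ≤ B) {G : ℝ → ℂ} {C K : ℝ}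
    (hGc : Continuous G) (hC : ∀ u, ‖G u‖ ≤ C) (hK : ∀ u v, ‖G u - G v‖ ≤ K * |u - v|)
    {M b : ℕ} (hb : 0 < b) (hbM : b * b ≤ M) :
    ‖∑ a ∈ Finset.Ioc b (M / b), χ a * G (Real.log (a / b)) -
        κ * (b * ∫ s in (1 : ℝ)..(M / b ^ 2), G (Real.log s))‖ ≤
      (2 * B * C + (‖κ‖ + B) * K + ‖κ‖ * C) * (1 + Real.log M) := by
  have hB0 : 0 ≤ B := (norm_nonneg _).trans (hB 0)
  have hC0 : 0 ≤ C := (norm_nonneg _).trans (hC 0)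
  have hK0 : 0 ≤ K := by simpa using (norm_nonneg _).trans (hK 1 0)
  have hb' : (0 : ℝ) < b := by exact_mod_cast hb
  have hb1 : (1 : ℝ) ≤ b := by exact_mod_cast hb
  have hbk : b ≤ M / b := (Nat.le_div_iff_mul_le hb).2 hbM
  have hbk' : (b : ℝ) ≤ (M / b : ℕ) := by exact_mod_cast hbk
  have hM1 : (1 : ℝ) ≤ M := by exact_mod_cast (Nat.mul_pos hb hb).trans_le hbM
  have hdiv : ((M / b : ℕ) : ℝ) ≤ (M : ℝ) / b := Nat.cast_div_le
  have hdiv' : (M : ℝ) / b ≤ (M / b : ℕ) + 1 := by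
    rw [div_le_iff₀ hb']
    have := Nat.lt_div_mul_add (a := M) hb
    have h2 : M ≤ (M / b + 1) * b := by
      rw [add_mul, one_mul]; exact this.le
    exact_mod_cast h2
  have hcont : ContinuousOn (fun x : ℝ => G (Real.log (x / b))) (Set.Ici (b : ℝ)) := by
    refine hGc.comp_continuousOn (ContinuousOn.log (by fun_prop) fun x hx => ?_)
    exact (div_pos (hb'.trans_le hx) hb').ne'
  have h := norm_sum_Ioc_sub_integral_le hB (h := fun x => G (Real.log (x / b)))
    (V := fun x => K * Real.log x) hcont (fun x y hx hxy => by
      have hx0 := hb'.trans_le hx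
      refine (hK _ _).trans_eq ?_
      rw [Real.log_div (hx0.trans_le hxy).ne' hb'.ne', Real.log_div hx0.ne' hb'.ne',
        sub_sub_sub_cancel_right, abs_of_nonneg (sub_nonneg.2 (Real.log_le_log hx0 hxy)), mul_sub])
    hbk
  have hI : (b : ℂ) * ∫ s in (1 : ℝ)..(M / b ^ 2), G (Real.log s) =
      (∫ x in (b : ℝ)..(M / b : ℕ), G (Real.log (x / b))) +
        ∫ x in ((M / b : ℕ) : ℝ)..(M / b), G (Real.log (x / b)) := by
    rw [intervalIntegral.integral_add_adjacent_intervals]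
    · rw [intervalIntegral.integral_comp_div (fun s => G (Real.log s)) hb'.ne', div_self hb'.ne',
        div_div, ← sq, Complex.real_smul]
      simp
    · exact (hcont.mono fun x hx => by
        rw [Set.uIcc_of_le hbk'] at hx; exact hx.1).intervalIntegrable
    · exact (hcont.mono fun x hx => by
        rw [Set.uIcc_of_le hdiv] at hx; exact hbk'.trans hx.1).intervalIntegrable
  have h2 : ‖∫ x in ((M / b : ℕ) : ℝ)..(M / b), G (Real.log (x / b))‖ ≤ C := by
    refine (intervalIntegral.norm_integral_le_of_norm_le_const fun x _ => hC _).trans ?_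
    rw [abs_of_nonneg (sub_nonneg.2 hdiv)]
    exact mul_le_of_le_one_right hC0 (by linarith)
  rw [hI, mul_add, ← sub_sub]
  refine (norm_sub_le _ _).trans ((add_le_add h (by rw [norm_mul])).trans ?_)
  have hlog : Real.log (M / b : ℕ) - Real.log b ≤ Real.log M := by
    have h3 : Real.log (M / b : ℕ) ≤ Real.log M :=
      Real.log_le_log (hb'.trans_le hbk') (hdiv.trans (div_le_self (by linarith) hb1))
    have := Real.log_nonneg hb1
    linarith
  have hlogM := Real.log_nonneg hM1
  have hκ := norm_nonneg κ
  have i1 : B * (‖G (Real.log (b / b))‖ + ‖G (Real.log ((M / b : ℕ) / b))‖) ≤ B * (C + C) := by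
    gcongr <;> exact hC _
  have i2 : (‖κ‖ + B) * (K * Real.log (M / b : ℕ) - K * Real.log b) ≤
      (‖κ‖ + B) * (K * Real.log M) := by
    rw [← mul_sub]; gcongr
  have i3 := mul_le_mul_of_nonneg_left h2 hκ
  have i4 : 0 ≤ (2 * B * C + ‖κ‖ * C) * Real.log M := by positivity
  have i5 : 0 ≤ (‖κ‖ + B) * K := by positivity
  refine (add_le_add (add_le_add i1 i2) i3).trans ?_
  linarith

theorem sum_mul_integral_eq {ψ : ℕ → ℂ} {g : ℝ → ℂ} {M : ℕ}
    (hg : IntegrableOn g (Set.Ioc (1 : ℝ) M)) :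
    IntegrableOn (fun s : ℝ => (∑ b ∈ Finset.Ioc 0 ⌊√(M / s)⌋₊, ψ b * b) * g s)
      (Set.Ioc (1 : ℝ) M) ∧
    ∑ b ∈ Finset.Ioc 0 (Nat.sqrt M), ψ b * (b * ∫ s in (1 : ℝ)..(M / b ^ 2), g s) =
      ∫ s in Set.Ioc (1 : ℝ) M, (∑ b ∈ Finset.Ioc 0 ⌊√(M / s)⌋₊, ψ b * b) * g s := by
  have hpt : ∀ s ∈ Set.Ioc (1 : ℝ) M, ∑ b ∈ Finset.Ioc 0 (Nat.sqrt M),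
      ψ b * b * (Set.Iic ((M : ℝ) / b ^ 2)).indicator g s =
      (∑ b ∈ Finset.Ioc 0 ⌊√(M / s)⌋₊, ψ b * b) * g s := by
    intro s hs
    have hs0 : 0 < s := by linarith [hs.1]
    have hiff : ∀ b : ℕ, 0 < b → (s ≤ M / b ^ 2 ↔ b ≤ ⌊√(M / s)⌋₊) := by
      intro b hb
      have hb' : (0 : ℝ) < b := by exact_mod_cast hb
      rw [Nat.le_floor_iff (by positivity), Real.le_sqrt' hb',
        le_div_iff₀ (by positivity), le_div_iff₀ hs0, mul_comm]
    rw [Finset.sum_mul]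
    have hsub : Finset.Ioc 0 ⌊√(M / s)⌋₊ ⊆ Finset.Ioc 0 (Nat.sqrt M) := by
      refine Finset.Ioc_subset_Ioc_right ?_
      rw [← Real.nat_floor_real_sqrt_eq_nat_sqrt]
      exact Nat.floor_le_floor (Real.sqrt_le_sqrt (div_le_self (by positivity) hs.1.le))
    symm
    rw [← Finset.sum_subset hsub
      (f := fun b => ψ b * b * (Set.Iic ((M : ℝ) / b ^ 2)).indicator g s)]
    · refine Finset.sum_congr rfl fun b hb => ?_
      rw [Finset.mem_Ioc] at hb
      rw [Set.indicator_of_mem]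
      exact (hiff b hb.1).2 hb.2
    · intro b hb hb'
      rw [Finset.mem_Ioc] at hb hb'
      rw [Set.indicator_of_notMem, mul_zero]
      intro h
      exact hb' ⟨hb.1, (hiff b hb.1).1 h⟩
  have hint : ∀ b : ℕ, IntegrableOn (fun s => ψ b * b * (Set.Iic ((M : ℝ) / b ^ 2)).indicator g s)
      (Set.Ioc (1 : ℝ) M) := fun b => (hg.indicator measurableSet_Iic).const_mul _
  refine ⟨IntegrableOn.congr_fun (integrable_finsetSum _ fun b _ => hint b) hpt
    measurableSet_Ioc, ?_⟩
  rw [← setIntegral_congr_fun measurableSet_Ioc hpt, integral_finsetSum _ fun b _ => hint b]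
  refine Finset.sum_congr rfl fun b hb => ?_
  rw [Finset.mem_Ioc] at hb
  have hb' : (1 : ℝ) ≤ b := by exact_mod_cast hb.1
  have hbM : (b : ℝ) ^ 2 ≤ M := by
    have := Nat.le_sqrt'.1 hb.2
    exact_mod_cast this
  rw [integral_const_mul, setIntegral_indicator measurableSet_Iic,
    intervalIntegral.integral_of_le ((one_le_div (by positivity)).2 hbM), Set.Ioc_inter_Iic,
    min_eq_right (div_le_self (by positivity) (one_le_pow₀ hb')), mul_assoc]

theorem exists_norm_le_add_div {g : ℝ → ℂ} {C : ℝ} (hC : ∀ s, ‖g s‖ ≤ C)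
    (h0 : Tendsto g atTop (𝓝 0)) {ε : ℝ} (hε : 0 < ε) :
    ∃ A, 0 ≤ A ∧ ∀ s, 0 < s → ‖g s‖ ≤ ε + A / s := by
  have hC0 : 0 ≤ C := (norm_nonneg _).trans (hC 0)
  obtain ⟨S, hS⟩ := eventually_atTop.1
    ((tendsto_zero_iff_norm_tendsto_zero.1 h0).eventually_le_const hε)
  refine ⟨C * |S|, by positivity, fun s hs => ?_⟩
  rcases le_total S s with h | h
  · exact (hS s h).trans (by simpa using by positivity)
  · refine (hC s).trans ?_
    have : C ≤ C * |S| / s := by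
      rw [le_div_iff₀ hs]
      gcongr
      exact h.trans (le_abs_self S)
    linarith

theorem isLittleO_sqrt_mul_log_natCast :
    (fun M : ℕ => √(M : ℝ) * (1 + Real.log M)) =o[atTop] fun M : ℕ => (M : ℝ) := by
  have h1 : (fun x : ℝ => 1 + Real.log x) =o[atTop] fun x : ℝ => x ^ (1 / 2 : ℝ) := by
    refine IsLittleO.add ?_ (isLittleO_log_rpow_atTop (by norm_num))
    exact isLittleO_const_left.2 (Or.inr (tendsto_norm_atTop_atTop.comp
      (tendsto_rpow_atTop (by norm_num))))
  have h2 := ((isBigO_refl (fun x : ℝ => √x) atTop).mul_isLittleO h1).comp_tendsto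
    (tendsto_natCast_atTop_atTop (R := ℝ))
  refine h2.congr (fun _ => rfl) fun M => ?_
  simp only [Function.comp_def, ← Real.sqrt_eq_rpow]
  exact Real.mul_self_sqrt (Nat.cast_nonneg M)

theorem isLittleO_sqrt_natCast :
    (fun M : ℕ => √(M : ℝ)) =o[atTop] fun M : ℕ => (M : ℝ) := by
  refine IsBigO.trans_isLittleO (IsBigO.of_bound 1 ?_) isLittleO_sqrt_mul_log_natCast
  filter_upwards with M
  have := Real.log_natCast_nonneg M
  rw [one_mul, norm_mul]
  refine le_mul_of_one_le_right (norm_nonneg _) (le_trans ?_ (le_abs_self _))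
  linarith

theorem integral_sqrt_div_mul_le {ε A : ℝ} (hA : 0 ≤ A) (hε : 0 ≤ ε) {M : ℕ} (hM : 1 ≤ M) :
    IntegrableOn (fun s : ℝ => √(M / s) * (ε + A / s)) (Set.Ioc (1 : ℝ) M) ∧
    ∫ s in Set.Ioc (1 : ℝ) M, √(M / s) * (ε + A / s) ≤ 2 * ε * M + 2 * A * √M := by
  have hM' : (1 : ℝ) ≤ M := by exact_mod_cast hM
  have h0 : (0 : ℝ) ∉ Set.uIcc (1 : ℝ) M := by
    rw [Set.uIcc_of_le hM']
    intro h
    linarith [h.1]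
  have i1 : IntervalIntegrable (fun s : ℝ => s ^ (-1 / 2 : ℝ)) volume 1 M :=
    intervalIntegral.intervalIntegrable_rpow (Or.inr h0)
  have i2 : IntervalIntegrable (fun s : ℝ => s ^ (-3 / 2 : ℝ)) volume 1 M :=
    intervalIntegral.intervalIntegrable_rpow (Or.inr h0)
  have e : Set.EqOn (fun s : ℝ => √M * ε * s ^ (-1 / 2 : ℝ) + √M * A * s ^ (-3 / 2 : ℝ))
      (fun s : ℝ => √(M / s) * (ε + A / s)) (Set.Ioc (1 : ℝ) M) := by
    intro s hs
    have hs0 : 0 < s := by linarith [hs.1]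
    have h1 : s ^ (-3 / 2 : ℝ) = s ^ (-1 / 2 : ℝ) * s⁻¹ := by
      rw [← Real.rpow_neg_one s, ← Real.rpow_add hs0]
      norm_num
    have h2 : √(M / s) = √M * s ^ (-1 / 2 : ℝ) := by
      rw [Real.sqrt_div (Nat.cast_nonneg M), Real.sqrt_eq_rpow s, div_eq_mul_inv,
        ← Real.rpow_neg hs0.le]
      norm_num
    simp only [h1, h2]
    ring
  have hsum := (i1.const_mul (√M * ε)).add (i2.const_mul (√M * A))
  rw [intervalIntegrable_iff_integrableOn_Ioc_of_le hM'] at hsum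
  refine ⟨hsum.congr_fun e measurableSet_Ioc, ?_⟩
  rw [← setIntegral_congr_fun measurableSet_Ioc e, ← intervalIntegral.integral_of_le hM',
    intervalIntegral.integral_add (i1.const_mul _) (i2.const_mul _),
    intervalIntegral.integral_const_mul, intervalIntegral.integral_const_mul,
    integral_rpow (Or.inr ⟨by norm_num, h0⟩), integral_rpow (Or.inr ⟨by norm_num, h0⟩)]
  have h3 : (M : ℝ) ^ (-1 / 2 + 1 : ℝ) = √M := by
    rw [Real.sqrt_eq_rpow]; norm_num
  have h4 : 0 ≤ (M : ℝ) ^ (-3 / 2 + 1 : ℝ) := by positivity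
  rw [h3, Real.one_rpow, Real.one_rpow]
  have h5 : √(M : ℝ) * √M = M := Real.mul_self_sqrt (by linarith)
  have h6 : 0 ≤ √(M : ℝ) * ε := by positivity
  have h7 : 0 ≤ √(M : ℝ) * A * (M : ℝ) ^ (-3 / 2 + 1 : ℝ) := by positivity
  have e1 : √(M : ℝ) * ε * ((√M - 1) / (-1 / 2 + 1)) = 2 * ε * (√(M : ℝ) * √M) - 2 * (√M * ε) := by
    ring
  have e2 : √(M : ℝ) * A * (((M : ℝ) ^ (-3 / 2 + 1 : ℝ) - 1) / (-3 / 2 + 1)) =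
      2 * A * √M - 2 * (√M * A * (M : ℝ) ^ (-3 / 2 + 1 : ℝ)) := by
    ring
  rw [e1, e2, h5]
  linarith

theorem integral_comp_log_div {G : ℝ → ℂ} (hG : Continuous G) {x : ℝ} (hx : 1 ≤ x) :
    ∫ s in (1 : ℝ)..x, ((s⁻¹ : ℝ) : ℂ) * G (Real.log s) = ∫ u in (0 : ℝ)..Real.log x, G u := by
  have h0 : ∀ s ∈ Set.uIcc (1 : ℝ) x, s ≠ 0 := by
    intro s hs
    rw [Set.uIcc_of_le hx] at hs
    linarith [hs.1]
  have := intervalIntegral.integral_deriv_smul_comp (a := 1) (b := x) (f := Real.log)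
    (f' := fun s => s⁻¹) (g := G) (fun s hs => Real.hasDerivAt_log (h0 s hs))
    (continuousOn_inv₀.mono h0) hG
  rw [Real.log_one] at this
  rw [← this]
  simp

theorem isLittleO_sum_mul_integral {ψ : ℕ → ℂ} {κ : ℂ} {B : ℝ}
    (hB : ∀ n : ℕ, ‖∑ j ∈ Finset.range (n + 1), ψ j - κ * n‖ ≤ B) {G : ℝ → ℂ} {C : ℝ}
    (hGc : Continuous G) (hC : ∀ u, ‖G u‖ ≤ C) (h0 : Tendsto G atTop (𝓝 0)) :
    (fun M : ℕ => ∑ b ∈ Finset.Ioc 0 (Nat.sqrt M),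
        ψ b * (b * ∫ s in (1 : ℝ)..(M / b ^ 2), G (Real.log s)) -
      κ / 2 * M * ∫ u in (0 : ℝ)..Real.log M, G u) =o[atTop] fun M : ℕ => (M : ℝ) := by
  have hB0 : 0 ≤ B := (norm_nonneg _).trans (hB 0)
  set D := 2 * B + 2 * ‖κ‖
  have hD : 0 ≤ D := by positivity
  rw [isLittleO_iff]
  intro c hc
  obtain ⟨A, hA, hAb⟩ := exists_norm_le_add_div (g := fun s => G (Real.log s)) (fun s => hC _)
    (h0.comp Real.tendsto_log_atTop) (ε := c / (4 * (D + 1))) (by positivity)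
  set ε := c / (4 * (D + 1)) with hε
  have hε0 : 0 ≤ ε := by positivity
  have hDε : D * (2 * ε) ≤ c / 2 := by
    rw [hε]
    have : D * (2 * (c / (4 * (D + 1)))) = c / 2 * (D / (D + 1)) := by
      field_simp; norm_num
    rw [this]
    exact mul_le_of_le_one_right (by positivity) ((div_le_one (by positivity)).2 (by linarith))
  have hs := (isLittleO_sqrt_natCast.const_mul_left (D * (2 * A))).bound (half_pos hc)
  filter_upwards [eventually_ge_atTop 1, hs] with M hM hsM
  have hM' : (1 : ℝ) ≤ M := by exact_mod_cast hM
  have hgc : ContinuousOn (fun s => G (Real.log s)) (Set.Icc (1 : ℝ) M) :=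
    hGc.comp_continuousOn (Real.continuousOn_log.mono fun s hs => by
      have := hs.1
      simp only [Set.mem_compl_iff, Set.mem_singleton_iff]
      linarith)
  have hgi : IntegrableOn (fun s => G (Real.log s)) (Set.Ioc (1 : ℝ) M) :=
    (hgc.integrableOn_Icc).mono_set Set.Ioc_subset_Icc_self
  have hgi2 : IntegrableOn (fun s : ℝ => κ / 2 * M * (((s⁻¹ : ℝ) : ℂ) * G (Real.log s)))
      (Set.Ioc (1 : ℝ) M) := by
    refine (ContinuousOn.integrableOn_Icc ?_).mono_set Set.Ioc_subset_Icc_self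
    refine continuousOn_const.mul (ContinuousOn.mul ?_ hgc)
    refine Complex.continuous_ofReal.comp_continuousOn (continuousOn_inv₀.mono fun s hs => ?_)
    have := hs.1
    simp only [Set.mem_compl_iff, Set.mem_singleton_iff]
    linarith
  obtain ⟨hi, he⟩ := sum_mul_integral_eq (ψ := ψ) hgi
  obtain ⟨hj, hje⟩ := integral_sqrt_div_mul_le hA hε0 hM
  rw [he, ← integral_comp_log_div hGc hM', intervalIntegral.integral_of_le hM',
    ← integral_const_mul, ← integral_sub hi hgi2]
  have hle : ‖∫ s in Set.Ioc (1 : ℝ) M,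
      ((∑ b ∈ Finset.Ioc 0 ⌊√(M / s)⌋₊, ψ b * b) * G (Real.log s) -
        κ / 2 * M * (((s⁻¹ : ℝ) : ℂ) * G (Real.log s)))‖ ≤
      ∫ s in Set.Ioc (1 : ℝ) M, D * (√(M / s) * (ε + A / s)) := by
    refine norm_integral_le_of_norm_le (hj.const_mul D) ?_
    filter_upwards [ae_restrict_mem measurableSet_Ioc] with s hs
    have hs0 : 0 < s := by linarith [hs.1]
    have h1 := norm_sum_mul_id_sub_le hB (Real.sqrt_nonneg (M / s))
    rw [Real.sq_sqrt (by positivity)] at h1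
    have e : (∑ b ∈ Finset.Ioc 0 ⌊√(M / s)⌋₊, ψ b * b) * G (Real.log s) -
        κ / 2 * M * (((s⁻¹ : ℝ) : ℂ) * G (Real.log s)) =
        (∑ b ∈ Finset.Ioc 0 ⌊√(M / s)⌋₊, ψ b * b - κ / 2 * (M / s : ℝ)) * G (Real.log s) := by
      push_cast
      ring
    rw [e, norm_mul, ← mul_assoc]
    exact mul_le_mul h1 (hAb s hs0) (norm_nonneg _) (by positivity)
  refine hle.trans ?_
  rw [integral_const_mul, Real.norm_natCast]
  rw [Real.norm_natCast] at hsM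
  have h2 := (le_abs_self _).trans hsM
  have h3 := mul_le_mul_of_nonneg_left hje hD
  have h4 := mul_le_mul_of_nonneg_right hDε (by linarith : (0 : ℝ) ≤ M)
  linarith

theorem isLittleO_sum_upper_triangle {χ ψ : ℕ → ℂ} {κ κ' : ℂ} {B B' : ℝ}
    (hB : ∀ n : ℕ, ‖∑ j ∈ Finset.range (n + 1), χ j - κ * n‖ ≤ B)
    (hB' : ∀ n : ℕ, ‖∑ j ∈ Finset.range (n + 1), ψ j - κ' * n‖ ≤ B')
    (hψ : ∀ n, ‖ψ n‖ ≤ 1) {G : ℝ → ℂ} {C K : ℝ}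
    (hGc : Continuous G) (hC : ∀ u, ‖G u‖ ≤ C) (hK : ∀ u v, ‖G u - G v‖ ≤ K * |u - v|)
    (h0 : Tendsto G atTop (𝓝 0)) :
    (fun M : ℕ => ∑ b ∈ Finset.Ioc 0 (Nat.sqrt M), ∑ a ∈ Finset.Ioc b (M / b),
        χ a * ψ b * G (Real.log (a / b)) -
      κ * κ' / 2 * M * ∫ u in (0 : ℝ)..Real.log M, G u) =o[atTop] fun M : ℕ => (M : ℝ) := by
  have hmain := (isLittleO_sum_mul_integral hB' hGc hC h0).const_mul_left κ
  have hfirst : (fun M : ℕ => ∑ b ∈ Finset.Ioc 0 (Nat.sqrt M), ψ b *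
      (∑ a ∈ Finset.Ioc b (M / b), χ a * G (Real.log (a / b)) -
        κ * (b * ∫ s in (1 : ℝ)..(M / b ^ 2), G (Real.log s)))) =o[atTop]
      fun M : ℕ => (M : ℝ) := by
    have hbig := isLittleO_sqrt_mul_log_natCast.const_mul_left
      (2 * B * C + (‖κ‖ + B) * K + ‖κ‖ * C)
    refine IsBigO.trans_isLittleO (IsBigO.of_bound 1 ?_) hbig
    filter_upwards with M
    rw [one_mul]
    refine (norm_sum_le _ _).trans ?_
    set E := 2 * B * C + (‖κ‖ + B) * K + ‖κ‖ * C
    have hB0 : 0 ≤ B := (norm_nonneg _).trans (hB 0)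
    have hC0 : 0 ≤ C := (norm_nonneg _).trans (hC 0)
    have hK0 : 0 ≤ K := by simpa using (norm_nonneg _).trans (hK 1 0)
    have hE : 0 ≤ E * (1 + Real.log M) := by
      have := Real.log_natCast_nonneg M
      positivity
    calc _ ≤ ∑ b ∈ Finset.Ioc 0 (Nat.sqrt M), E * (1 + Real.log M) := by
          refine Finset.sum_le_sum fun b hb => ?_
          rw [Finset.mem_Ioc] at hb
          rw [norm_mul]
          exact (mul_le_of_le_one_left (norm_nonneg _) (hψ b)).trans
            (norm_sum_log_sub_integral_le hB hGc hC hK hb.1 (Nat.le_sqrt.1 hb.2))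
      _ = Nat.sqrt M * (E * (1 + Real.log M)) := by simp
      _ ≤ √M * (E * (1 + Real.log M)) := by gcongr; exact Real.nat_sqrt_le_real_sqrt
      _ = E * (√M * (1 + Real.log M)) := by ring
      _ ≤ _ := le_abs_self _
  refine (hfirst.add hmain).congr_left fun M => ?_
  simp only [mul_sub, Finset.sum_sub_distrib, Finset.mul_sum]
  have e : ∀ b : ℕ, ∀ I : ℂ, ψ b * (κ * (b * I)) = κ * (ψ b * (b * I)) := fun b I => by ring
  simp only [e]
  have e2 : ∀ a b : ℕ, ψ b * (χ a * G (Real.log (a / b))) = χ a * ψ b * G (Real.log (a / b)) :=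
    fun a b => by ring
  simp only [e2]
  ring

theorem exists_norm_sum_range_sub_le {N : ℕ} [NeZero N] {χ : ℕ → ℂ} (hχ : Function.Periodic χ N)
    {κ : ℂ} (hκ : ∑ j ∈ Finset.range N, χ j = κ * N) :
    ∃ B : ℝ, ∀ n : ℕ, ‖∑ j ∈ Finset.range (n + 1), χ j - κ * n‖ ≤ B := by
  set R : ℕ → ℂ := fun n => ∑ j ∈ Finset.range (n + 1), χ j - κ * n with hR
  have hRs : ∀ n, R (n + 1) = R n + χ (n + 1) - κ := by
    intro n
    simp only [hR]
    rw [Finset.sum_range_succ _ (n + 1)]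
    push_cast
    ring
  have hper : Function.Periodic R N := by
    intro n
    induction n with
    | zero =>
      have h := hχ 0
      simp only [hR, zero_add] at h ⊢
      rw [Finset.sum_range_succ, hκ, h]
      simp
    | succ n ih =>
      have h := hχ (n + 1)
      rw [show n + 1 + N = n + N + 1 by ring] at h ⊢
      rw [hRs, hRs, ih, h]
  refine ⟨∑ j ∈ Finset.range N, ‖R j‖, fun n => ?_⟩
  change ‖R n‖ ≤ _
  rw [← hper.map_mod_nat n]
  exact Finset.single_le_sum (f := fun j => ‖R j‖) (fun j _ => norm_nonneg _)
    (Finset.mem_range.2 (Nat.mod_lt _ (Nat.pos_of_neZero N)))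

theorem sum_range_dirichletCharacter {N : ℕ} [NeZero N] (χ : DirichletCharacter ℂ N) :
    ∑ j ∈ Finset.range N, χ (j : ZMod N) = if χ = 1 then (N.totient : ℂ) else 0 := by
  have h : ∑ j ∈ Finset.range N, χ (j : ZMod N) = ∑ x : ZMod N, χ x := by
    refine Finset.sum_bij' (fun j _ => (j : ZMod N)) (fun x _ => x.val) ?_ ?_ ?_ ?_ ?_
    · simp
    · intro x _
      exact Finset.mem_range.2 (ZMod.val_lt x)
    · intro j hj
      exact ZMod.val_cast_of_lt (Finset.mem_range.1 hj)
    · intro x _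
      exact ZMod.natCast_zmod_val x
    · simp
  rw [h]
  split_ifs with h1
  · rw [h1, MulChar.sum_one_eq_card_units, ZMod.card_units_eq_totient]
  · exact MulChar.sum_eq_zero_of_ne_one h1

section density

variable {r : ℕ} {q : Fin r → ℕ} {N : ℕ} {χ : DirichletCharacter ℂ N}

theorem ne_zero_of_support (hq : ∀ i, (q i).Prime)
    (h : ∀ m : ℕ, χ (m : ZMod N) = 0 ↔ ¬ Nat.Coprime m (∏ i, q i)) : N ≠ 0 := by
  rintro rfl
  set Q := ∏ i, q i
  have hQ : 0 < Q := Finset.prod_pos fun i _ => (hq i).pos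
  have h1 : Nat.Coprime (2 * Q + 1) Q := by simp
  have h2 : χ ((2 * Q + 1 : ℕ) : ZMod 0) ≠ 0 := fun h0 => (h _).1 h0 h1
  refine h2 (χ.map_nonunit fun hu => ?_)
  have h3 : IsUnit ((2 * Q + 1 : ℕ) : ℤ) := hu
  rw [Int.isUnit_iff] at h3
  omega

theorem totient_eq_prod_mul (hq : ∀ i, (q i).Prime) (hinj : Function.Injective q)
    (h : ∀ m : ℕ, χ (m : ZMod N) = 0 ↔ ¬ Nat.Coprime m (∏ i, q i)) :
    (N.totient : ℂ) = (∏ i, (1 - (q i : ℂ)⁻¹)) * N := by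
  have hN := ne_zero_of_support hq h
  have hpf : N.primeFactors = Finset.univ.image q := by
    ext p
    have hdvd : p.Prime → (p ∣ N ↔ p ∣ ∏ i, q i) := by
      intro hp
      have h1 : ¬ IsUnit (p : ZMod N) ↔ ¬ Nat.Coprime p (∏ i, q i) := by
        rw [← h p]
        exact ⟨χ.map_nonunit, fun h0 hu => (hu.map χ).ne_zero h0⟩
      rw [ZMod.isUnit_iff_coprime, hp.coprime_iff_not_dvd, hp.coprime_iff_not_dvd] at h1
      tauto
    rw [Nat.mem_primeFactors]
    simp only [Finset.mem_image, Finset.mem_univ, true_and]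
    constructor
    · rintro ⟨hp, hd, -⟩
      rw [hdvd hp, hp.prime.dvd_finsetProd_iff] at hd
      obtain ⟨i, -, hi⟩ := hd
      exact ⟨i, ((Nat.prime_dvd_prime_iff_eq hp (hq i)).1 hi).symm⟩
    · rintro ⟨i, rfl⟩
      exact ⟨hq i, (hdvd (hq i)).2 (Finset.dvd_prod_of_mem q (Finset.mem_univ i)), hN⟩
  have ht := Nat.totient_eq_mul_prod_factors N
  rw [hpf, Finset.prod_image fun i _ j _ hij => hinj hij] at ht
  have := congrArg (Rat.cast : ℚ → ℂ) ht
  push_cast at this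
  rw [this, mul_comm]

theorem exists_norm_sum_dirichletCharacter_sub_le (hq : ∀ i, (q i).Prime)
    (hinj : Function.Injective q)
    (h : ∀ m : ℕ, χ (m : ZMod N) = 0 ↔ ¬ Nat.Coprime m (∏ i, q i)) :
    ∃ B : ℝ, ∀ n : ℕ, ‖∑ j ∈ Finset.range (n + 1), χ (j : ZMod N) -
      (if χ = 1 then 1 else 0) * (∏ i, (1 - (q i : ℂ)⁻¹)) * n‖ ≤ B := by
  have : NeZero N := ⟨ne_zero_of_support hq h⟩
  refine exists_norm_sum_range_sub_le (N := N) (χ := fun j => χ (j : ZMod N)) (fun j => by simp) ?_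
  rw [sum_range_dirichletCharacter]
  split_ifs
  · rw [one_mul, totient_eq_prod_mul hq hinj h]
  · simp

end density

theorem sum_upper_triangle_eq (F : ℕ → ℕ → ℂ) (M : ℕ) :
    ∑ p ∈ (Finset.Ioc 0 M ×ˢ Finset.Ioc 0 M).filter (fun p => p.1 * p.2 ≤ M ∧ p.2 < p.1),
      F p.1 p.2 = ∑ b ∈ Finset.Ioc 0 (Nat.sqrt M), ∑ a ∈ Finset.Ioc b (M / b), F a b := by
  rw [Finset.sum_sigma']
  refine Finset.sum_bij' (fun p _ => ⟨p.2, p.1⟩) (fun x _ => (x.2, x.1)) ?_ ?_ ?_ ?_ ?_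
  · rintro ⟨a, b⟩ h
    simp only [Finset.mem_filter, Finset.mem_product, Finset.mem_Ioc, Finset.mem_sigma] at h ⊢
    obtain ⟨⟨⟨ha, haM⟩, hb, hbM⟩, hab, hlt⟩ := h
    refine ⟨⟨hb, Nat.le_sqrt.2 ((Nat.mul_le_mul_right b hlt.le).trans hab)⟩, hlt, ?_⟩
    exact (Nat.le_div_iff_mul_le hb).2 hab
  · rintro ⟨b, a⟩ h
    simp only [Finset.mem_filter, Finset.mem_product, Finset.mem_Ioc, Finset.mem_sigma] at h ⊢
    obtain ⟨⟨hb, hbM⟩, hlt, ha⟩ := h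
    have hab := (Nat.le_div_iff_mul_le hb).1 ha
    have ha0 : 0 < a := hb.trans hlt
    refine ⟨⟨⟨ha0, ha.trans (Nat.div_le_self _ _)⟩, hb, ?_⟩, hab, hlt⟩
    exact hlt.le.trans (ha.trans (Nat.div_le_self _ _))
  · simp
  · simp
  · simp

theorem sum_divisors_eq_sum_triangles (F : ℕ → ℕ → ℂ) (M : ℕ) :
    ∑ n ∈ Finset.Ico 1 (M + 1), ∑ d ∈ n.divisors, F d (n / d) =
      ∑ b ∈ Finset.Ioc 0 (Nat.sqrt M), ∑ a ∈ Finset.Ioc b (M / b), F a b +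
      ∑ b ∈ Finset.Ioc 0 (Nat.sqrt M), ∑ a ∈ Finset.Ioc b (M / b), F b a +
      ∑ b ∈ Finset.Ioc 0 (Nat.sqrt M), F b b := by
  set P := (Finset.Ioc 0 M ×ˢ Finset.Ioc 0 M).filter (fun p : ℕ × ℕ => p.1 * p.2 ≤ M) with hP
  have hall : ∑ n ∈ Finset.Ico 1 (M + 1), ∑ d ∈ n.divisors, F d (n / d) =
      ∑ p ∈ P, F p.1 p.2 := by
    rw [Finset.sum_sigma']
    refine Finset.sum_bij' (fun x _ => (x.2, x.1 / x.2)) (fun p _ => ⟨p.1 * p.2, p.1⟩)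
      ?_ ?_ ?_ ?_ ?_
    · rintro ⟨n, d⟩ h
      simp only [hP, Finset.mem_filter, Finset.mem_product, Finset.mem_Ioc, Finset.mem_sigma,
        Finset.mem_Ico, Nat.mem_divisors] at h ⊢
      obtain ⟨⟨hn, hnM⟩, hd, hn0⟩ := h
      have hdpos := Nat.pos_of_dvd_of_pos hd hn
      have hdn := Nat.le_of_dvd hn hd
      rw [Nat.mul_div_cancel' hd]
      exact ⟨⟨⟨hdpos, by omega⟩, Nat.div_pos hdn hdpos, (Nat.div_le_self _ _).trans (by omega)⟩,
        by omega⟩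
    · rintro ⟨a, b⟩ h
      simp only [hP, Finset.mem_filter, Finset.mem_product, Finset.mem_Ioc, Finset.mem_sigma,
        Finset.mem_Ico, Nat.mem_divisors] at h ⊢
      obtain ⟨⟨⟨ha, haM⟩, hb, hbM⟩, hab⟩ := h
      have := Nat.mul_pos ha hb
      exact ⟨⟨this, by omega⟩, Dvd.intro _ rfl, this.ne'⟩
    · rintro ⟨n, d⟩ h
      simp only [Finset.mem_sigma, Nat.mem_divisors] at h
      simp [Nat.mul_div_cancel' h.2.1]
    · rintro ⟨a, b⟩ h
      simp only [hP, Finset.mem_filter, Finset.mem_product, Finset.mem_Ioc] at h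
      simp [Nat.mul_div_cancel_left b h.1.1.1]
    · simp
  have h1 := sum_upper_triangle_eq F M
  have h2 := sum_upper_triangle_eq (fun a b => F b a) M
  have h2' : ∑ p ∈ (Finset.Ioc 0 M ×ˢ Finset.Ioc 0 M).filter
      (fun p => p.1 * p.2 ≤ M ∧ p.2 < p.1), F p.2 p.1 =
      ∑ p ∈ (Finset.Ioc 0 M ×ˢ Finset.Ioc 0 M).filter
      (fun p => p.1 * p.2 ≤ M ∧ p.1 < p.2), F p.1 p.2 := by
    refine Finset.sum_equiv (Equiv.prodComm ℕ ℕ) (fun p => ?_) (fun p _ => rfl)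
    simp only [Finset.mem_filter, Finset.mem_product, Equiv.prodComm_apply, Prod.fst_swap,
      Prod.snd_swap, mul_comm p.2 p.1]
    tauto
  have h3 : ∑ p ∈ (Finset.Ioc 0 M ×ˢ Finset.Ioc 0 M).filter
      (fun p => p.1 * p.2 ≤ M ∧ p.1 = p.2), F p.1 p.2 =
      ∑ b ∈ Finset.Ioc 0 (Nat.sqrt M), F b b := by
    refine Finset.sum_bij' (fun p _ => p.1) (fun b _ => (b, b)) ?_ ?_ ?_ ?_ ?_
    · rintro ⟨a, b⟩ h
      simp only [Finset.mem_filter, Finset.mem_product, Finset.mem_Ioc] at h ⊢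
      obtain ⟨h, hab, rfl⟩ := h
      exact ⟨h.1.1, Nat.le_sqrt.2 hab⟩
    · intro b h
      simp only [Finset.mem_filter, Finset.mem_product, Finset.mem_Ioc] at h ⊢
      have := (h.2.trans (Nat.sqrt_le_self M))
      exact ⟨⟨⟨h.1, this⟩, h.1, this⟩, Nat.le_sqrt.1 h.2, trivial⟩
    · rintro ⟨a, b⟩ h
      simp only [Finset.mem_filter] at h
      simp [h.2.2]
    · simp
    · rintro ⟨a, b⟩ h
      simp only [Finset.mem_filter] at h
      simp [h.2.2]
  rw [hall, ← h1, ← h2, h2', ← h3, ← Finset.sum_filter_add_sum_filter_not P (fun p => p.2 < p.1),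
    ← Finset.sum_filter_add_sum_filter_not (P.filter fun p => ¬ p.2 < p.1) (fun p => p.1 < p.2),
    ← add_assoc]
  simp only [hP, Finset.filter_filter]
  congr 2
  · congr 1
    refine Finset.filter_congr fun p _ => ?_
    grind
  · refine Finset.filter_congr fun p _ => ?_
    grind

theorem integral_mul_sum_divisors_eq_sum_expIntegral {Φ : ℝ → ℂ} (hΦ : Integrable Φ)
    (χ ψ : ℕ → ℂ) {n : ℕ} (hn : 0 < n) :
    ∫ t : ℝ, Φ t * (n : ℂ) ^ (-(Complex.I * (t : ℂ))) *
        ∑ d ∈ n.divisors, (d : ℂ) ^ (2 * Complex.I * (t : ℂ)) * χ d * ψ (n / d) =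
      ∑ d ∈ n.divisors, χ d * ψ (n / d) * expIntegral Φ (Real.log (d / (n / d : ℕ))) := by
  simp only [expIntegral, ← integral_const_mul]
  rw [← integral_finsetSum _ fun d _ => (integrable_mul_exp hΦ _).const_mul _]
  congr 1 with t
  rw [Finset.mul_sum]
  refine Finset.sum_congr rfl fun d hd => ?_
  obtain ⟨⟨b, rfl⟩, -⟩ := Nat.mem_divisors.1 hd
  obtain ⟨hd0, hb0⟩ : 0 < d ∧ 0 < b := CanonicallyOrderedAdd.mul_pos.1 hn
  rw [Nat.mul_div_cancel_left b hd0]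
  have hd' : (d : ℂ) ≠ 0 := by exact_mod_cast hd0.ne'
  have hb' : (b : ℂ) ≠ 0 := by exact_mod_cast hb0.ne'
  have hdr : (d : ℝ) ≠ 0 := by exact_mod_cast hd0.ne'
  have hbr : (b : ℝ) ≠ 0 := by exact_mod_cast hb0.ne'
  have e : ((d * b : ℕ) : ℂ) ^ (-(Complex.I * (t : ℂ))) * (d : ℂ) ^ (2 * Complex.I * (t : ℂ)) =
      Complex.exp (Complex.I * (Real.log (d / b) : ℝ) * t) := by
    rw [Complex.cpow_def_of_ne_zero (by exact_mod_cast hn.ne'), Complex.cpow_def_of_ne_zero hd',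
      ← Complex.exp_add, ← Complex.natCast_log, ← Complex.natCast_log, Nat.cast_mul,
      Real.log_mul hdr hbr, Real.log_div hdr hbr]
    congr 1
    push_cast
    ring
  rw [← e]
  ring

theorem isLittleO_sum_divisors {χ ψ : ℕ → ℂ} {κ κ' : ℂ} {B B' : ℝ}
    (hB : ∀ n : ℕ, ‖∑ j ∈ Finset.range (n + 1), χ j - κ * n‖ ≤ B)
    (hB' : ∀ n : ℕ, ‖∑ j ∈ Finset.range (n + 1), ψ j - κ' * n‖ ≤ B')
    (hχ : ∀ n, ‖χ n‖ ≤ 1) (hψ : ∀ n, ‖ψ n‖ ≤ 1) {G : ℝ → ℂ} {C K : ℝ} {Λ : ℂ}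
    (hGc : Continuous G) (hC : ∀ u, ‖G u‖ ≤ C) (hK : ∀ u v, ‖G u - G v‖ ≤ K * |u - v|)
    (h0 : Tendsto G (cocompact ℝ) (𝓝 0))
    (hΛ : Tendsto (fun L : ℝ => ∫ u in -L..L, G u) atTop (𝓝 Λ)) :
    (fun M : ℕ => ∑ n ∈ Finset.Ico 1 (M + 1), ∑ d ∈ n.divisors,
        χ d * ψ (n / d) * G (Real.log (d / (n / d : ℕ))) - κ * κ' / 2 * Λ * M) =o[atTop]
      fun M : ℕ => (M : ℝ) := by
  have h1 := isLittleO_sum_upper_triangle hB hB' hψ hGc hC hK (h0.mono_left atTop_le_cocompact)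
  have h2 := isLittleO_sum_upper_triangle hB' hB hχ (G := fun u => G (-u)) (hGc.comp continuous_neg)
    (fun u => hC _) (K := K) (fun u v => (hK _ _).trans_eq (by rw [neg_sub_neg, abs_sub_comm]))
    ((h0.mono_left atBot_le_cocompact).comp tendsto_neg_atTop_atBot)
  have h3 : (fun M : ℕ => ∑ b ∈ Finset.Ioc 0 (Nat.sqrt M), χ b * ψ b * G (Real.log (b / b)))
      =o[atTop] fun M : ℕ => (M : ℝ) := by
    have hC0 : 0 ≤ C := (norm_nonneg _).trans (hC 0)
    refine IsBigO.trans_isLittleO (IsBigO.of_bound 1 ?_)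
      (isLittleO_sqrt_natCast.const_mul_left C)
    filter_upwards with M
    rw [one_mul]
    calc _ ≤ ∑ b ∈ Finset.Ioc 0 (Nat.sqrt M), C := by
          refine norm_sum_le_of_le _ fun b _ => ?_
          rw [norm_mul, norm_mul]
          exact (mul_le_of_le_one_left (norm_nonneg _)
            (mul_le_one₀ (hχ b) (norm_nonneg _) (hψ b))).trans (hC _)
      _ = C * Nat.sqrt M := by simp [mul_comm]
      _ ≤ C * √M := by gcongr; exact Real.nat_sqrt_le_real_sqrt
      _ ≤ _ := le_abs_self _
  have h4 : (fun M : ℕ => κ * κ' / 2 * ((∫ u in -Real.log M..Real.log M, G u) - Λ) * (M : ℂ))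
      =o[atTop] fun M : ℕ => (M : ℝ) := by
    have ht : Tendsto (fun M : ℕ => κ * κ' / 2 * ((∫ u in -Real.log M..Real.log M, G u) - Λ))
        atTop (𝓝 0) := by
      have := (hΛ.comp (Real.tendsto_log_atTop.comp tendsto_natCast_atTop_atTop (α := ℕ)))
      simpa using (this.sub_const Λ).const_mul (κ * κ' / 2)
    have := ((isLittleO_one_iff ℝ).2 ht).mul_isBigO
      (IsBigO.of_bound 1 (f := fun M : ℕ => (M : ℂ)) (g := fun M : ℕ => (M : ℝ)) (l := atTop)
        (by filter_upwards with M; simp))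
    simpa using this
  refine (((h1.add h2).add h3).add h4).congr_left fun M => ?_
  have hI : ∫ u in -Real.log M..Real.log M, G u =
      (∫ u in (0 : ℝ)..Real.log M, G u) + ∫ u in (0 : ℝ)..Real.log M, G (-u) := by
    rw [intervalIntegral.integral_comp_neg (fun u => G u), neg_zero, add_comm,
      intervalIntegral.integral_add_adjacent_intervals (hGc.intervalIntegrable _ _)
        (hGc.intervalIntegrable _ _)]
  have hneg : ∀ a b : ℕ, ψ a * χ b * G (-Real.log (a / b)) = χ b * ψ a * G (Real.log (b / a)) := by
    intro a b
    rw [← Real.log_inv, inv_div, mul_comm (ψ a)]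
  rw [sum_divisors_eq_sum_triangles (fun a b => χ a * ψ b * G (Real.log (a / b))), hI]
  simp only [hneg]
  ring

theorem integrable_of_decay {f : ℝ → ℂ} (hc : Continuous f) {C : ℝ}
    (h : ∀ t, (1 + |t|) ^ 2 * ‖f t‖ ≤ C) : Integrable f := by
  refine Integrable.mono' (integrable_inv_one_add_sq.const_mul C) hc.aestronglyMeasurable
    (Eventually.of_forall fun t => ?_)
  rw [← div_eq_mul_inv, le_div_iff₀ (by positivity), mul_comm]
  refine le_trans (mul_le_mul_of_nonneg_right ?_ (norm_nonneg _)) (h t)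
  nlinarith [abs_nonneg t, sq_abs t]

/-- Let `q 0 < … < q (r-1)` be distinct primes and `μ₁, μ₂` Dirichlet
characters with `μᵢ m = 0` iff `gcd(m, q 0 ⋯ q (r-1)) ≠ 1`.  Let `Φ : ℝ → ℂ` be smooth of
rapid decay.  Then, as `X → ∞`,
`∑_{n < X} (1/2π) ∫_ℝ Φ(t) n^{-it} ∑_{d ∣ n} d^{2it} μ₁(d) μ₂(n/d) dt
  = (1/2) δ(μ₁) δ(μ₂) ∏ (1 - (q i)⁻¹)² Φ(0) X + o(X)`. -/
theorem stmt4 (r : ℕ) (q : Fin r → ℕ) (hq : ∀ i, (q i).Prime) (hmono : StrictMono q)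
    (N₁ N₂ : ℕ) (μ₁ : DirichletCharacter ℂ N₁) (μ₂ : DirichletCharacter ℂ N₂)
    (hμ₁ : ∀ m : ℕ, μ₁ (m : ZMod N₁) = 0 ↔ ¬ Nat.Coprime m (∏ i, q i))
    (hμ₂ : ∀ m : ℕ, μ₂ (m : ZMod N₂) = 0 ↔ ¬ Nat.Coprime m (∏ i, q i))
    (Φ : ℝ → ℂ) (hΦ : ContDiff ℝ (⊤ : ℕ∞) Φ)
    (hdecay : ∀ k : ℕ, ∃ C : ℝ, ∀ t : ℝ, (1 + |t|) ^ k * ‖Φ t‖ ≤ C) :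
    (fun X : ℝ =>
        (∑ n ∈ Finset.Ico 1 ⌈X⌉₊,
          (1 / (2 * Real.pi) : ℝ) •
            ∫ t : ℝ, Φ t * (n : ℂ) ^ (-(Complex.I * (t : ℂ))) *
              ∑ d ∈ n.divisors, (d : ℂ) ^ (2 * Complex.I * (t : ℂ)) * μ₁ (d : ZMod N₁) *
                μ₂ ((n / d : ℕ) : ZMod N₂)) -
        (1 / 2 : ℂ) * (if μ₁ = 1 then 1 else 0) * (if μ₂ = 1 then 1 else 0) *
          (∏ i, (1 - (q i : ℂ)⁻¹) ^ 2) * Φ 0 * (X : ℂ))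
      =o[atTop] fun X : ℝ => X := by
  obtain ⟨C₂, hC₂⟩ := hdecay 2
  obtain ⟨C₃, hC₃⟩ := hdecay 3
  have hi : Integrable Φ := integrable_of_decay hΦ.continuous hC₂
  have hi' : Integrable fun t : ℝ => t * Φ t := by
    refine integrable_of_decay (Complex.continuous_ofReal.mul hΦ.continuous) (C := C₃) fun t => ?_
    refine le_trans ?_ (hC₃ t)
    rw [norm_mul, Complex.norm_real, Real.norm_eq_abs, pow_succ _ 2, mul_assoc]
    gcongr
    linarith
  obtain ⟨B₁, hB₁⟩ := exists_norm_sum_dirichletCharacter_sub_le hq hmono.injective hμ₁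
  obtain ⟨B₂, hB₂⟩ := exists_norm_sum_dirichletCharacter_sub_le hq hmono.injective hμ₂
  have hlip := norm_expIntegral_sub_le hi hi'
  have hcont : Continuous (expIntegral Φ) := by
    refine (LipschitzWith.of_dist_le_mul (K := (∫ t : ℝ, ‖t * Φ t‖).toNNReal)
      fun u v => ?_).continuous
    rw [dist_eq_norm, Real.dist_eq, Real.coe_toNNReal _ (integral_nonneg fun t => norm_nonneg _)]
    exact hlip u v
  have hmain := isLittleO_sum_divisors (χ := fun d => μ₁ (d : ZMod N₁))
    (ψ := fun d => μ₂ (d : ZMod N₂)) hB₁ hB₂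
    (fun n => DirichletCharacter.norm_le_one μ₁ _) (fun n => DirichletCharacter.norm_le_one μ₂ _)
    hcont (norm_expIntegral_le Φ) hlip (tendsto_expIntegral_cocompact Φ)
    (tendsto_intervalIntegral_expIntegral hΦ.continuous
      (hΦ.differentiable (by simp)).differentiableAt hi)
  have hfloor : Tendsto (fun X : ℝ => ⌈X⌉₊ - 1) atTop atTop :=
    (tendsto_sub_atTop_nat 1).comp tendsto_nat_ceil_atTop
  set c : ℂ := (1 / 2 : ℂ) * (if μ₁ = 1 then 1 else 0) * (if μ₂ = 1 then 1 else 0) *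
    (∏ i, (1 - (q i : ℂ)⁻¹) ^ 2) * Φ 0 with hc
  have h1 := (hmain.comp_tendsto hfloor).const_smul_left (1 / (2 * Real.pi) : ℝ)
  have h2 : (fun X : ℝ => ((⌈X⌉₊ - 1 : ℕ) : ℝ)) =O[atTop] fun X : ℝ => X := by
    refine IsBigO.of_bound 1 ?_
    filter_upwards [eventually_gt_atTop 0] with X hX
    rw [one_mul, Real.norm_natCast, Real.norm_of_nonneg hX.le]
    have := Nat.ceil_lt_add_one hX.le
    rw [Nat.cast_sub (Nat.one_le_ceil_iff.2 hX)]
    push_cast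
    linarith
  have h3 : (fun X : ℝ => c * (((⌈X⌉₊ - 1 : ℕ) : ℂ) - X)) =o[atTop] fun X : ℝ => X := by
    refine IsLittleO.const_mul_left (IsBigO.trans_isLittleO (g := fun _ => (1 : ℝ))
      (IsBigO.of_bound 1 ?_) (isLittleO_const_id_atTop 1)) c
    filter_upwards [eventually_gt_atTop 0] with X hX
    have a := Nat.ceil_lt_add_one hX.le
    have b := Nat.le_ceil X
    rw [Nat.cast_sub (Nat.one_le_ceil_iff.2 hX)]
    have e : (((⌈X⌉₊ : ℂ) - (1 : ℕ)) - X) = ((⌈X⌉₊ - 1 - X : ℝ) : ℂ) := by push_cast; ring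
    rw [e, Complex.norm_real, Real.norm_eq_abs, norm_one, mul_one, abs_le]
    constructor <;> linarith
  refine ((h1.trans_isBigO h2).add h3).congr' ?_ EventuallyEq.rfl
  filter_upwards [eventually_gt_atTop 0] with X hX
  have hM : ⌈X⌉₊ - 1 + 1 = ⌈X⌉₊ := Nat.sub_add_cancel (Nat.one_le_ceil_iff.2 hX)
  have hpi : (Real.pi : ℂ) ≠ 0 := by simp [Real.pi_ne_zero]
  have hterm : ∀ n ∈ Finset.Ico 1 ⌈X⌉₊, ∑ d ∈ n.divisors, μ₁ (d : ZMod N₁) *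
      μ₂ ((n / d : ℕ) : ZMod N₂) * expIntegral Φ (Real.log (d / (n / d : ℕ))) =
      ∫ t : ℝ, Φ t * (n : ℂ) ^ (-(Complex.I * (t : ℂ))) *
        ∑ d ∈ n.divisors, (d : ℂ) ^ (2 * Complex.I * (t : ℂ)) * μ₁ (d : ZMod N₁) *
          μ₂ ((n / d : ℕ) : ZMod N₂) := fun n hn =>
    (integral_mul_sum_divisors_eq_sum_expIntegral hi (fun d => μ₁ (d : ZMod N₁))
      (fun d => μ₂ (d : ZMod N₂))
      (Finset.mem_Ico.1 hn).1).symm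
  simp only [Function.comp_apply, Pi.smul_apply, hM]
  rw [Finset.sum_congr rfl hterm, smul_sub, Finset.smul_sum, hc, Finset.prod_pow]
  have e : (1 / (2 * Real.pi) : ℝ) • ((if μ₁ = 1 then 1 else 0) * (∏ i, (1 - (q i : ℂ)⁻¹)) *
      ((if μ₂ = 1 then 1 else 0) * (∏ i, (1 - (q i : ℂ)⁻¹))) / 2 * (2 * Real.pi * Φ 0) *
      ((⌈X⌉₊ - 1 : ℕ) : ℂ)) = (1 / 2 : ℂ) * (if μ₁ = 1 then 1 else 0) *
      (if μ₂ = 1 then 1 else 0) * (∏ i, (1 - (q i : ℂ)⁻¹)) ^ 2 * Φ 0 * ((⌈X⌉₊ - 1 : ℕ) : ℂ) := by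
    rw [Complex.real_smul]
    push_cast
    field_simp
  rw [e]
  ring
end

section
/- Let Λ denote the completed Riemann zeta function Λ(s) = π^{−s/2} Γ(s/2) ζ(s). Then the limit as s → 0 (s ∈ ℂ, s ≠ 0) of 2·Λ′(1+2s)/Λ(1+2s) + 1/s exists and equals γ − 2 log 2 − log π, where γ is the Euler–Mascheroni constant. Equivalently, the constant term in the Laurent expansion at s = 0 of the logarithmic derivative (d/ds) log Λ(1+2s) is γ − 2 log 2 − log π. -/
open Filter

/-- If `f` agrees with `g w + 1 / (w - a)` near (but not at) `a`, with `g` analytic at `a`, then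
`f' / f + 1 / (w - a)` tends to `g a` as `w → a`. -/
theorem tendsto_logDeriv_add_inv_of_simple_pole {f g : ℂ → ℂ} {a : ℂ} (hg : AnalyticAt ℂ g a)
    (hf : ∀ᶠ w in nhdsWithin a {a}ᶜ, f w = g w + 1 / (w - a)) :
    Tendsto (fun w => deriv f w / f w + 1 / (w - a)) (nhdsWithin a {a}ᶜ) (nhds (g a)) := by
  have hsub : ContinuousAt (fun w : ℂ => w - a) a := by fun_prop
  have hden : ContinuousAt (fun w => 1 + (w - a) * g w) a :=
    continuousAt_const.add (hsub.mul hg.continuousAt)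
  have hlim : Tendsto (fun w => ((w - a) * deriv g w + g w) / (1 + (w - a) * g w))
      (nhds a) (nhds (g a)) := by
    have h : ContinuousAt
        (fun w => ((w - a) * deriv g w + g w) / (1 + (w - a) * g w)) a :=
      ((hsub.mul hg.deriv.continuousAt).add hg.continuousAt).div hden (by simp)
    simpa [ContinuousAt] using h
  refine (hlim.mono_left nhdsWithin_le_nhds).congr' ?_
  have hne : ∀ᶠ w in nhds a, 1 + (w - a) * g w ≠ 0 := hden.eventually_ne (by simp)
  filter_upwards [nhdsWithin_le_nhds hne, nhdsWithin_le_nhds hg.eventually_analyticAt,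
    eventually_eventually_nhdsWithin.mpr hf, hf, self_mem_nhdsWithin] with w hw hgw hfw hfw' hwa
  have hwa' : w - a ≠ 0 := sub_ne_zero.mpr hwa
  have hev : f =ᶠ[nhds w] fun w => g w + 1 / (w - a) := by
    rwa [nhdsWithin_eq_nhds.mpr (isOpen_compl_singleton.mem_nhds hwa)] at hfw
  have hderiv : deriv f w = deriv g w - 1 / (w - a) ^ 2 := by
    rw [hev.deriv_eq]
    have hinv : HasDerivAt (fun w : ℂ => 1 / (w - a)) (-1 / (w - a) ^ 2) w := by
      simpa only [one_div] using ((hasDerivAt_id' w).sub_const a).fun_inv hwa'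
    rw [(hgw.differentiableAt.hasDerivAt.fun_add hinv).deriv]
    ring
  have hfac : f w = (1 + (w - a) * g w) / (w - a) := by
    rw [hfw']
    field_simp
    ring
  rw [hderiv, hfac]
  field_simp
  ring

/-- The constant term at `1` of the logarithmic derivative of the completed zeta function. -/
theorem tendsto_logDeriv_completedRiemannZeta_add_inv :
    Tendsto (fun w => deriv completedRiemannZeta w / completedRiemannZeta w + 1 / (w - 1))
      (nhdsWithin 1 {(1 : ℂ)}ᶜ)
      (nhds ((Real.eulerMascheroniConstant - Complex.log (4 * Real.pi)) / 2)) := by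
  have hg : AnalyticAt ℂ (fun w => completedRiemannZeta₀ w - 1 / w) 1 :=
    (differentiable_completedZeta₀.analyticAt 1).sub
      (analyticAt_const.div analyticAt_id one_ne_zero)
  have h := tendsto_logDeriv_add_inv_of_simple_pole (f := completedRiemannZeta) hg
    (Eventually.of_forall fun w => by
      rw [completedRiemannZeta_eq, ← neg_sub w 1, div_neg, sub_neg_eq_add])
  simpa [completedRiemannZeta₀_one] using h

/-- Let `Λ = completedRiemannZeta` be the completed Riemann zeta function
`Λ(s) = π^{-s/2} Γ(s/2) ζ(s)`.  Then `2 Λ'(1+2s)/Λ(1+2s) + 1/s` tends, as `s → 0` with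
`s ≠ 0`, to `γ - 2 log 2 - log π`; i.e. the constant term of the Laurent expansion at
`s = 0` of `(d/ds) log Λ(1+2s)` is `γ - 2 log 2 - log π`. -/
theorem stmt5 :
    Tendsto (fun s : ℂ =>
        2 * deriv completedRiemannZeta (1 + 2 * s) / completedRiemannZeta (1 + 2 * s) + 1 / s)
      (nhdsWithin 0 {(0 : ℂ)}ᶜ)
      (nhds ((Real.eulerMascheroniConstant - 2 * Real.log 2 - Real.log Real.pi : ℝ) : ℂ)) := by
  have hmap : Tendsto (fun s : ℂ => 1 + 2 * s) (nhdsWithin 0 {(0 : ℂ)}ᶜ)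
      (nhdsWithin 1 {(1 : ℂ)}ᶜ) := by
    refine tendsto_nhdsWithin_iff.mpr ⟨?_, ?_⟩
    · have h : ContinuousAt (fun s : ℂ => 1 + 2 * s) 0 := by fun_prop
      simpa [ContinuousAt] using h.tendsto.mono_left nhdsWithin_le_nhds
    · filter_upwards [self_mem_nhdsWithin] with s hs
      simpa using hs
  have hlog : Complex.log (4 * Real.pi) = ((2 * Real.log 2 + Real.log Real.pi : ℝ) : ℂ) := by
    have h : Real.log (4 * Real.pi) = 2 * Real.log 2 + Real.log Real.pi := by
      rw [Real.log_mul (by norm_num) Real.pi_ne_zero, show (4 : ℝ) = 2 ^ 2 by norm_num,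
        Real.log_pow]
      norm_num
    rw [← h, Complex.ofReal_log (by positivity)]
    push_cast
    rfl
  have h := (tendsto_logDeriv_completedRiemannZeta_add_inv.comp hmap).const_mul 2
  rw [hlog] at h
  convert h.congr' ?_ using 2
  · push_cast
    ring
  · filter_upwards [self_mem_nhdsWithin] with s hs
    have hs' : s ≠ 0 := hs
    simp only [Function.comp_apply, add_sub_cancel_left]
    field_simp
end

section
/- Let p be a prime, let M ≥ 1 be an integer, and let μ : ℤ_p^× → ℂ^× be a continuous group homomorphism whose conductor exponent N (the least nonnegative integer such that μ is trivial on (1 + p^N ℤ_p) ∩ ℤ_p^×) satisfies N ≥ M + 1. Then ∫_{p^M ℤ_p} |x|_p · μ(1 + x) dx = −p^{2−2N}/(p + 1), where the integral is with respect to the additive Haar measure on ℚ_p normalized so that ℤ_p has measure 1. -/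
open MeasureTheory

/-- For `x : ℚ_p` with `‖1 + x‖ = 1`, the element `1 + x` as a unit of `ℤ_p`. -/
noncomputable def oneAddUnit (p : ℕ) [Fact p.Prime] (x : ℚ_[p]) (h : ‖(1 + x : ℚ_[p])‖ = 1) :
    ℤ_[p]ˣ :=
  let z : ℤ_[p] := ⟨1 + x, le_of_eq h⟩
  (PadicInt.isUnit_iff.mpr (show ‖z‖ = 1 from h)).unit

section Volume

open Filter Topology

variable {p : ℕ} [Fact p.Prime]

/-- The closed unit ball of `ℚ_[p]` is the union of the `p ^ k` translates of the ball of radius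
`p ^ (-k)` by the naturals below `p ^ k`. -/
lemma Padic.closedBall_one_eq_iUnion (k : ℕ) :
    Metric.closedBall (0 : ℚ_[p]) 1 =
      ⋃ n ∈ Finset.range (p ^ k), Metric.closedBall (n : ℚ_[p]) ((p : ℝ) ^ (-(k : ℤ))) := by
  ext x
  simp only [mem_closedBall_iff_norm, sub_zero, Set.mem_iUnion, Finset.mem_range, exists_prop]
  constructor
  · intro hx
    refine ⟨PadicInt.appr ⟨x, hx⟩ k, PadicInt.appr_lt _ _, ?_⟩
    have h := (PadicInt.norm_le_pow_iff_mem_span_pow _ _).2 (PadicInt.appr_spec k ⟨x, hx⟩)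
    exact h
  · rintro ⟨n, -, hn⟩
    have hk : (p : ℝ) ^ (-(k : ℤ)) ≤ 1 :=
      zpow_le_one_of_nonpos₀ (by exact_mod_cast (Fact.out : p.Prime).one_le) (by simp)
    have h := Padic.nonarchimedean (x - (n : ℚ_[p])) n
    rw [sub_add_cancel] at h
    exact h.trans (max_le (hn.trans hk) (by exact_mod_cast Padic.norm_int_le_one (p := p) n))

lemma Padic.pairwiseDisjoint_closedBall_natCast (k : ℕ) :
    (Finset.range (p ^ k) : Set ℕ).PairwiseDisjoint
      fun n ↦ Metric.closedBall (n : ℚ_[p]) ((p : ℝ) ^ (-(k : ℤ))) := by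
  intro m hm n hn hmn
  refine Set.disjoint_left.2 fun x hxm hxn ↦ hmn ?_
  simp only [Finset.coe_range, Set.mem_Iio] at hm hn
  rw [mem_closedBall_iff_norm] at hxm hxn
  have h := Padic.nonarchimedean (x - (n : ℚ_[p])) (-(x - (m : ℚ_[p])))
  rw [norm_neg] at h
  have h' : ‖(((m : ℤ) - n : ℤ) : ℚ_[p])‖ ≤ (p : ℝ) ^ (-(k : ℤ)) := by
    refine le_trans (le_of_eq ?_) (h.trans (max_le hxn hxm))
    congr 1
    push_cast
    ring
  rw [Padic.norm_int_le_pow_iff_dvd] at h'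
  have hmod : n ≡ m [MOD p ^ k] := (Nat.modEq_iff_dvd).2 (by exact_mod_cast h')
  exact (Nat.ModEq.eq_of_lt_of_lt hmod hn hm).symm

lemma Padic.le_norm_of_notMem_closedBall_succ {k : ℕ} {x : ℚ_[p]}
    (hx : x ∉ Metric.closedBall (0 : ℚ_[p]) ((p : ℝ) ^ (-((k + 1 : ℕ) : ℤ)))) :
    (p : ℝ) ^ (-(k : ℤ)) ≤ ‖x‖ := by
  rw [mem_closedBall_zero_iff, Padic.norm_le_pow_iff_norm_lt_pow_add_one, not_lt] at hx
  rwa [show -((k + 1 : ℕ) : ℤ) + 1 = -(k : ℤ) by push_cast; ring] at hx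

lemma Padic.norm_eq_of_mem_closedBall_sdiff {k : ℕ} {x : ℚ_[p]}
    (hx : x ∈ Metric.closedBall (0 : ℚ_[p]) ((p : ℝ) ^ (-(k : ℤ))) \
      Metric.closedBall 0 ((p : ℝ) ^ (-((k + 1 : ℕ) : ℤ)))) :
    ‖x‖ = (p : ℝ) ^ (-(k : ℤ)) :=
  le_antisymm (mem_closedBall_zero_iff.1 hx.1) (Padic.le_norm_of_notMem_closedBall_succ hx.2)

lemma Padic.closedBall_succ_subset (k : ℕ) :
    Metric.closedBall (0 : ℚ_[p]) ((p : ℝ) ^ (-((k + 1 : ℕ) : ℤ))) ⊆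
      Metric.closedBall 0 ((p : ℝ) ^ (-(k : ℤ))) :=
  Metric.closedBall_subset_closedBall <|
    zpow_le_zpow_right₀ (by exact_mod_cast (Fact.out : p.Prime).one_le) (by simp)

variable [MeasurableSpace ℚ_[p]] [BorelSpace ℚ_[p]] (ν : Measure ℚ_[p]) [ν.IsAddHaarMeasure]

lemma Padic.measureReal_closedBall_zero (hν : ν (Metric.closedBall 0 1) = 1) (k : ℕ) :
    ν.real (Metric.closedBall 0 ((p : ℝ) ^ (-(k : ℤ)))) = (p : ℝ) ^ (-(k : ℤ)) := by
  have hp : (p : ℝ) ≠ 0 := by exact_mod_cast (Fact.out : p.Prime).ne_zero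
  have h1 : ν.real (Metric.closedBall (0 : ℚ_[p]) 1) = 1 := by simp [measureReal_def, hν]
  rw [Padic.closedBall_one_eq_iUnion k,
    measureReal_biUnion_finset (Padic.pairwiseDisjoint_closedBall_natCast k)
      (fun _ _ ↦ Metric.isClosed_closedBall.measurableSet)
      (fun _ _ ↦ (isCompact_closedBall _ _).measure_ne_top)] at h1
  have h2 (n : ℚ_[p]) : ν.real (Metric.closedBall n ((p : ℝ) ^ (-(k : ℤ)))) =
      ν.real (Metric.closedBall 0 ((p : ℝ) ^ (-(k : ℤ)))) := by
    rw [measureReal_def, measureReal_def, Measure.addHaar_closedBall_center]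
  simp only [h2, Finset.sum_const, Finset.card_range, nsmul_eq_mul] at h1
  rw [zpow_neg, zpow_natCast] at h1 ⊢
  push_cast at h1
  exact eq_inv_of_mul_eq_one_right h1

lemma Padic.integrableOn_norm_closedBall (r : ℝ) :
    IntegrableOn (fun x : ℚ_[p] ↦ ‖x‖) (Metric.closedBall 0 r) ν :=
  continuous_norm.continuousOn.integrableOn_compact (isCompact_closedBall _ _)

lemma Padic.setIntegral_norm_closedBall_succ (hν : ν (Metric.closedBall 0 1) = 1) (k : ℕ) :
    ∫ x in Metric.closedBall 0 ((p : ℝ) ^ (-(k : ℤ))), ‖x‖ ∂ν =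
      (p : ℝ) ^ (-(k : ℤ)) * ((p : ℝ) ^ (-(k : ℤ)) - (p : ℝ) ^ (-((k + 1 : ℕ) : ℤ))) +
        ∫ x in Metric.closedBall 0 ((p : ℝ) ^ (-((k + 1 : ℕ) : ℤ))), ‖x‖ ∂ν := by
  have hmeas (r : ℝ) : MeasurableSet (Metric.closedBall (0 : ℚ_[p]) r) :=
    Metric.isClosed_closedBall.measurableSet
  rw [← sub_eq_iff_eq_add, ← setIntegral_sdiff (hmeas _) (Padic.integrableOn_norm_closedBall ν _)
    (Padic.closedBall_succ_subset k),
    setIntegral_congr_fun ((hmeas _).diff (hmeas _))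
      (fun x hx ↦ Padic.norm_eq_of_mem_closedBall_sdiff hx), setIntegral_const,
    measureReal_sdiff (Padic.closedBall_succ_subset k) (hmeas _)
      (isCompact_closedBall _ _).measure_ne_top,
    Padic.measureReal_closedBall_zero ν hν, Padic.measureReal_closedBall_zero ν hν, smul_eq_mul,
    mul_comm]

lemma Padic.setIntegral_norm_closedBall (hν : ν (Metric.closedBall 0 1) = 1) (k : ℕ) :
    ∫ x in Metric.closedBall 0 ((p : ℝ) ^ (-(k : ℤ))), ‖x‖ ∂ν =
      (p : ℝ) ^ (1 - 2 * (k : ℤ)) / (p + 1) := by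
  have hp1 : (1 : ℝ) < p := by exact_mod_cast (Fact.out : p.Prime).one_lt
  have hp : (p : ℝ) ≠ 0 := by positivity
  set A : ℕ → ℝ := fun k ↦ ∫ x in Metric.closedBall 0 ((p : ℝ) ^ (-(k : ℤ))), ‖x‖ ∂ν with hA
  set D : ℕ → ℝ := fun k ↦ A k - (p : ℝ) ^ (1 - 2 * (k : ℤ)) / (p + 1) with hD
  have hstep (k : ℕ) : D (k + 1) = D k := by
    have h := Padic.setIntegral_norm_closedBall_succ ν hν k
    change A k = _ + A (k + 1) at h
    have e1 : (p : ℝ) ^ (1 - 2 * ((k + 1 : ℕ) : ℤ)) = p * ((p : ℝ) ^ k)⁻¹ ^ 2 / p ^ 2 := by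
      rw [show 1 - 2 * ((k + 1 : ℕ) : ℤ) = 1 + -(k : ℤ) + -(k : ℤ) - 2 by push_cast; ring,
        zpow_sub₀ hp, zpow_add₀ hp, zpow_add₀ hp, zpow_neg, zpow_natCast, zpow_one]
      norm_cast
      ring
    have e2 : (p : ℝ) ^ (1 - 2 * (k : ℤ)) = p * ((p : ℝ) ^ k)⁻¹ ^ 2 := by
      rw [show 1 - 2 * (k : ℤ) = 1 + -(k : ℤ) + -(k : ℤ) by ring,
        zpow_add₀ hp, zpow_add₀ hp, zpow_neg, zpow_natCast, zpow_one]
      ring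
    simp only [hD, h, e1, e2, zpow_neg, zpow_natCast, pow_succ]
    field_simp
    ring
  have hconst (j : ℕ) : D (k + j) = D k := by
    induction j with
    | zero => rfl
    | succ j ih => rw [← add_assoc, hstep, ih]
  have hpow : Tendsto (fun k : ℕ ↦ (p : ℝ) ^ (-(k : ℤ))) atTop (𝓝 0) := by
    simpa [Function.comp_def] using
      tendsto_inv_atTop_zero.comp (tendsto_pow_atTop_atTop_of_one_lt hp1)
  have hA0 : Tendsto A atTop (𝓝 0) := by
    have hsq := hpow.mul hpow
    rw [mul_zero] at hsq
    refine squeeze_zero_norm (fun k ↦ ?_) hsq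
    have h := norm_setIntegral_le_of_norm_le_const (f := fun x : ℚ_[p] ↦ ‖x‖) (μ := ν)
      (s := Metric.closedBall 0 ((p : ℝ) ^ (-(k : ℤ)))) (C := (p : ℝ) ^ (-(k : ℤ)))
      (isCompact_closedBall _ _).measure_lt_top (fun x hx ↦ by simpa using hx)
    rwa [Padic.measureReal_closedBall_zero ν hν] at h
  have hpow2 : Tendsto (fun k : ℕ ↦ (p : ℝ) ^ (1 - 2 * (k : ℤ)) / (p + 1)) atTop (𝓝 0) := by
    have h := ((hpow.mul hpow).const_mul (p : ℝ)).div_const ((p : ℝ) + 1)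
    simp only [mul_zero, zero_div] at h
    refine h.congr fun k ↦ ?_
    rw [← zpow_add₀ hp, ← zpow_one_add₀ hp]
    congr 2
    ring
  have hD0 : Tendsto D atTop (𝓝 0) := by simpa using hA0.sub hpow2
  have hlim : Tendsto (fun j ↦ D (k + j)) atTop (𝓝 0) := by
    simpa only [add_comm k] using (tendsto_add_atTop_iff_nat k).2 hD0
  simp only [hconst] at hlim
  exact sub_eq_zero.1 (tendsto_nhds_unique tendsto_const_nhds hlim)

end Volume

section Character

variable {p : ℕ} [Fact p.Prime]

/-- The function `x ↦ μ (1 + x)`, extended by zero to those `x` for which `1 + x` is not a unit. -/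
noncomputable def shiftedCharacter (p : ℕ) [Fact p.Prime] (μ : ℤ_[p]ˣ →* ℂˣ) (x : ℚ_[p]) : ℂ :=
  if h : ‖(1 + x : ℚ_[p])‖ = 1 then ((μ (oneAddUnit p x h) : ℂˣ) : ℂ) else 0

lemma coe_oneAddUnit (x : ℚ_[p]) (h : ‖(1 + x : ℚ_[p])‖ = 1) :
    ((oneAddUnit p x h : ℤ_[p]) : ℚ_[p]) = 1 + x := rfl

lemma Padic.norm_eq_one_of_norm_sub_lt_one {x y : ℚ_[p]} (hx : ‖x‖ = 1) (h : ‖y - x‖ < 1) :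
    ‖y‖ = 1 :=
  (Padic.norm_eq_of_norm_sub_lt_right (h.trans_eq hx.symm)).trans hx

lemma Padic.max_norm_add_eq {x t : ℚ_[p]} {r : ℝ} (ht : ‖t‖ ≤ r) :
    max ‖x + t‖ r = max ‖x‖ r := by
  have h1 := Padic.nonarchimedean x t
  have h2 := Padic.nonarchimedean (x + t) (-t)
  rw [add_neg_cancel_right, norm_neg] at h2
  apply le_antisymm <;> grind

lemma Padic.pow_neg_lt_one {n : ℕ} (hn : 1 ≤ n) : (p : ℝ) ^ (-(n : ℤ)) < 1 :=
  zpow_lt_one_of_neg₀ (by exact_mod_cast (Fact.out : p.Prime).one_lt) (by omega)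

variable {μ : ℤ_[p]ˣ →* ℂˣ} {N : ℕ}

lemma map_eq_map_of_norm_sub_le
    (hN : ∀ u : ℤ_[p]ˣ, ‖((u : ℤ_[p]) : ℚ_[p]) - 1‖ ≤ (p : ℝ) ^ (-(N : ℤ)) → μ u = 1)
    {v w : ℤ_[p]ˣ} (h : ‖((w : ℤ_[p]) : ℚ_[p]) - (v : ℤ_[p])‖ ≤ (p : ℝ) ^ (-(N : ℤ))) :
    μ w = μ v := by
  have h1 : μ (w * v⁻¹) = 1 := by
    refine hN _ ?_
    have hv : (((v : ℤ_[p]) : ℚ_[p])) * ((v⁻¹ : ℤ_[p]ˣ) : ℤ_[p]) = 1 := by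
      exact_mod_cast congrArg (Subtype.val) (Units.mul_inv v)
    have hnorm : ‖(((v⁻¹ : ℤ_[p]ˣ) : ℤ_[p]) : ℚ_[p])‖ = 1 := PadicInt.norm_units v⁻¹
    rw [Units.val_mul, PadicInt.coe_mul, ← hv, ← sub_mul, norm_mul, hnorm, mul_one]
    exact h
  rwa [map_mul, map_inv, mul_inv_eq_one] at h1

lemma shiftedCharacter_eq_mul
    (hN : ∀ u : ℤ_[p]ˣ, ‖((u : ℤ_[p]) : ℚ_[p]) - 1‖ ≤ (p : ℝ) ^ (-(N : ℤ)) → μ u = 1)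
    (u : ℤ_[p]ˣ) {x y : ℚ_[p]} (hx : ‖1 + x‖ = 1) (hy : ‖1 + y‖ = 1)
    (h : ‖1 + y - (u : ℤ_[p]) * (1 + x)‖ ≤ (p : ℝ) ^ (-(N : ℤ))) :
    shiftedCharacter p μ y = μ u * shiftedCharacter p μ x := by
  have h1 : μ (oneAddUnit p y hy) = μ (u * oneAddUnit p x hx) :=
    map_eq_map_of_norm_sub_le hN (by
      rwa [Units.val_mul, PadicInt.coe_mul, coe_oneAddUnit, coe_oneAddUnit])
  rw [shiftedCharacter, shiftedCharacter, dif_pos hx, dif_pos hy, h1, map_mul, Units.val_mul]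

lemma shiftedCharacter_eq_of_norm_sub_le (hN1 : 1 ≤ N)
    (hN : ∀ u : ℤ_[p]ˣ, ‖((u : ℤ_[p]) : ℚ_[p]) - 1‖ ≤ (p : ℝ) ^ (-(N : ℤ)) → μ u = 1)
    {x y : ℚ_[p]} (h : ‖y - x‖ ≤ (p : ℝ) ^ (-(N : ℤ))) :
    shiftedCharacter p μ y = shiftedCharacter p μ x := by
  have hlt : ‖1 + y - (1 + x)‖ < 1 := by
    rw [add_sub_add_left_eq_sub]
    exact h.trans_lt (Padic.pow_neg_lt_one hN1)
  by_cases hx : ‖1 + x‖ = 1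
  · have hy := Padic.norm_eq_one_of_norm_sub_lt_one hx hlt
    simpa using shiftedCharacter_eq_mul hN 1 hx hy (by simpa using h)
  · have hy : ‖1 + y‖ ≠ 1 := fun hy ↦
      hx (Padic.norm_eq_one_of_norm_sub_lt_one hy (by rwa [norm_sub_rev]))
    rw [shiftedCharacter, shiftedCharacter, dif_neg hx, dif_neg hy]

lemma shiftedCharacter_eq_one (hN1 : 1 ≤ N)
    (hN : ∀ u : ℤ_[p]ˣ, ‖((u : ℤ_[p]) : ℚ_[p]) - 1‖ ≤ (p : ℝ) ^ (-(N : ℤ)) → μ u = 1)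
    {x : ℚ_[p]} (hx : ‖x‖ ≤ (p : ℝ) ^ (-(N : ℤ))) : shiftedCharacter p μ x = 1 := by
  have h1 : ‖1 + x‖ = 1 := Padic.norm_eq_one_of_norm_sub_lt_one (x := 1) norm_one
    (by simpa using hx.trans_lt (Padic.pow_neg_lt_one hN1))
  rw [shiftedCharacter, dif_pos h1, hN _ (by simpa [coe_oneAddUnit] using hx), Units.val_one]

lemma continuous_shiftedCharacter (hN1 : 1 ≤ N)
    (hN : ∀ u : ℤ_[p]ˣ, ‖((u : ℤ_[p]) : ℚ_[p]) - 1‖ ≤ (p : ℝ) ^ (-(N : ℤ)) → μ u = 1) :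
    Continuous (shiftedCharacter p μ) := by
  refine IsLocallyConstant.continuous ((IsLocallyConstant.iff_eventually_eq _).2 fun x ↦ ?_)
  have hpos : (0 : ℝ) < (p : ℝ) ^ (-(N : ℤ)) :=
    zpow_pos (by exact_mod_cast (Fact.out : p.Prime).pos) _
  filter_upwards [Metric.closedBall_mem_nhds x hpos] with y hy
  exact shiftedCharacter_eq_of_norm_sub_le hN1 hN (mem_closedBall_iff_norm.1 hy)

/-- Translating by `u - 1` with `u ≡ 1` modulo `p ^ K` multiplies `x ↦ μ (1 + x)` by `μ u`
on `p ℤ_p`, when `μ` is trivial on `1 + p ^ (K + 1) ℤ_p`. -/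
lemma shiftedCharacter_add {K : ℕ} (hK : 1 ≤ K)
    (hN : ∀ u : ℤ_[p]ˣ,
      ‖((u : ℤ_[p]) : ℚ_[p]) - 1‖ ≤ (p : ℝ) ^ (-((K + 1 : ℕ) : ℤ)) → μ u = 1)
    {u : ℤ_[p]ˣ} (hu : ‖((u : ℤ_[p]) : ℚ_[p]) - 1‖ ≤ (p : ℝ) ^ (-(K : ℤ)))
    {x : ℚ_[p]} (hx : ‖x‖ ≤ (p : ℝ) ^ (-1 : ℤ)) :
    shiftedCharacter p μ (x + ((u : ℤ_[p]) - 1)) = μ u * shiftedCharacter p μ x := by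
  have hp : (p : ℝ) ≠ 0 := by exact_mod_cast (Fact.out : p.Prime).ne_zero
  have hx1 : ‖x‖ < 1 := hx.trans_lt (by simpa using Padic.pow_neg_lt_one (p := p) le_rfl)
  have h1 : ‖1 + x‖ = 1 :=
    Padic.norm_eq_one_of_norm_sub_lt_one (x := 1) norm_one (by simpa using hx1)
  refine shiftedCharacter_eq_mul hN u h1 ?_ ?_
  · refine Padic.norm_eq_one_of_norm_sub_lt_one h1 ?_
    rw [add_sub_add_left_eq_sub, add_sub_cancel_left]
    exact hu.trans_lt (Padic.pow_neg_lt_one hK)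
  · rw [show 1 + (x + (((u : ℤ_[p]) : ℚ_[p]) - 1)) - (u : ℤ_[p]) * (1 + x) =
      -((((u : ℤ_[p]) : ℚ_[p]) - 1) * x) by ring, norm_neg, norm_mul,
      show -((K + 1 : ℕ) : ℤ) = -(K : ℤ) + -1 by push_cast; ring, zpow_add₀ hp]
    gcongr

lemma setIntegral_max_norm_mul_shiftedCharacter
    [MeasurableSpace ℚ_[p]] [BorelSpace ℚ_[p]] (ν : Measure ℚ_[p]) [ν.IsAddHaarMeasure]
    {M K : ℕ} (hM : 1 ≤ M) (hMK : M ≤ K)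
    (hN : ∀ u : ℤ_[p]ˣ,
      ‖((u : ℤ_[p]) : ℚ_[p]) - 1‖ ≤ (p : ℝ) ^ (-((K + 1 : ℕ) : ℤ)) → μ u = 1)
    {u : ℤ_[p]ˣ} (hu : ‖((u : ℤ_[p]) : ℚ_[p]) - 1‖ ≤ (p : ℝ) ^ (-(K : ℤ))) (hu1 : μ u ≠ 1) :
    ∫ x in Metric.closedBall 0 ((p : ℝ) ^ (-(M : ℤ))),
      ((max ‖x‖ ((p : ℝ) ^ (-(K : ℤ))) : ℝ) : ℂ) * shiftedCharacter p μ x ∂ν = 0 := by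
  have hp1 : (1 : ℝ) ≤ p := by exact_mod_cast (Fact.out : p.Prime).one_le
  set B := Metric.closedBall (0 : ℚ_[p]) ((p : ℝ) ^ (-(M : ℤ))) with hB
  set G : ℚ_[p] → ℂ := B.indicator fun x ↦
    ((max ‖x‖ ((p : ℝ) ^ (-(K : ℤ))) : ℝ) : ℂ) * shiftedCharacter p μ x with hG
  set t : ℚ_[p] := (u : ℤ_[p]) - 1 with ht
  have htM : ‖t‖ ≤ (p : ℝ) ^ (-(M : ℤ)) :=
    hu.trans (zpow_le_zpow_right₀ hp1 (by omega))
  have hmem (x : ℚ_[p]) : x + t ∈ B ↔ x ∈ B := by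
    have h := Padic.max_norm_add_eq (x := x) htM
    rw [hB, mem_closedBall_zero_iff, mem_closedBall_zero_iff, ← max_eq_right_iff, h,
      max_eq_right_iff]
  have htrans (x : ℚ_[p]) : G (x + t) = μ u * G x := by
    by_cases hx : x ∈ B
    · have hx1 : ‖x‖ ≤ (p : ℝ) ^ (-1 : ℤ) :=
        (mem_closedBall_zero_iff.1 hx).trans (zpow_le_zpow_right₀ hp1 (by omega))
      rw [hG, Set.indicator_of_mem hx, Set.indicator_of_mem ((hmem x).2 hx),
        Padic.max_norm_add_eq hu, shiftedCharacter_add (hM.trans hMK) hN hu hx1]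
      ring
    · rw [hG, Set.indicator_of_notMem hx, Set.indicator_of_notMem (mt (hmem x).1 hx), mul_zero]
  have h : ∫ x, G x ∂ν = μ u * ∫ x, G x ∂ν := by
    rw [← integral_const_mul, ← integral_add_right_eq_self G t]
    exact integral_congr_ae (.of_forall htrans)
  rw [← integral_indicator Metric.isClosed_closedBall.measurableSet]
  by_contra h0
  exact hu1 (Units.ext ((mul_eq_right₀ h0).1 h.symm))

end Character

/-- Let `p` be a prime, `M ≥ 1`, and `μ : ℤ_pˣ → ℂˣ` a continuous group
homomorphism whose conductor exponent `N` (least `N ≥ 0` with `μ` trivial on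
`(1 + p^N ℤ_p) ∩ ℤ_pˣ`) satisfies `N ≥ M + 1`.  Then
`∫_{p^M ℤ_p} |x|_p μ(1+x) dx = -p^{2-2N}/(p+1)`, the integral being w.r.t. the additive Haar
measure on `ℚ_p` normalized so that `ℤ_p` has measure 1. -/
theorem stmt7 (p : ℕ) [Fact p.Prime] (M : ℕ) (hM : 1 ≤ M)
    [MeasurableSpace ℚ_[p]] [BorelSpace ℚ_[p]]
    (μHaar : Measure ℚ_[p]) [μHaar.IsAddHaarMeasure]
    (hvol : μHaar {x : ℚ_[p] | ‖x‖ ≤ 1} = 1)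
    (μ : ℤ_[p]ˣ →* ℂˣ) (hμcont : Continuous μ)
    (N : ℕ)
    (hN : ∀ u : ℤ_[p]ˣ, ‖((u : ℤ_[p]) : ℚ_[p]) - 1‖ ≤ (p : ℝ) ^ (-(N : ℤ)) → μ u = 1)
    (hNleast : ∀ M' : ℕ, M' < N →
      ∃ u : ℤ_[p]ˣ, ‖((u : ℤ_[p]) : ℚ_[p]) - 1‖ ≤ (p : ℝ) ^ (-(M' : ℤ)) ∧ μ u ≠ 1)
    (hMN : M + 1 ≤ N) :
    ∫ x in {x : ℚ_[p] | ‖x‖ ≤ (p : ℝ) ^ (-(M : ℤ))},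
        ((‖x‖ : ℂ) * if h : ‖(1 + x : ℚ_[p])‖ = 1 then ((μ (oneAddUnit p x h) : ℂˣ) : ℂ)
          else 0) ∂μHaar =
      ((-(p : ℝ) ^ (2 - 2 * (N : ℤ)) / ((p : ℝ) + 1) : ℝ) : ℂ) := by
  rw [show {x : ℚ_[p] | ‖x‖ ≤ 1} = Metric.closedBall 0 1 by ext; simp] at hvol
  rw [show {x : ℚ_[p] | ‖x‖ ≤ (p : ℝ) ^ (-(M : ℤ))} = Metric.closedBall 0 ((p : ℝ) ^ (-(M : ℤ))) by
    ext; simp]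
  obtain ⟨K, rfl⟩ : ∃ K, N = K + 1 := ⟨N - 1, by omega⟩
  have hMK : M ≤ K := by omega
  obtain ⟨u, hu, hu1⟩ := hNleast K (by omega)
  have hp1 : (1 : ℝ) < p := by exact_mod_cast (Fact.out : p.Prime).one_lt
  have hp : (p : ℝ) ≠ 0 := by positivity
  set B := Metric.closedBall (0 : ℚ_[p]) ((p : ℝ) ^ (-(M : ℤ))) with hB
  set C := Metric.closedBall (0 : ℚ_[p]) ((p : ℝ) ^ (-((K + 1 : ℕ) : ℤ))) with hC
  have hCB : C ⊆ B := Metric.closedBall_subset_closedBall <|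
    zpow_le_zpow_right₀ hp1.le (by push_cast; omega)
  have hCmeas : MeasurableSet C := Metric.isClosed_closedBall.measurableSet
  have hBmeas : MeasurableSet B := Metric.isClosed_closedBall.measurableSet
  set r : ℝ := (p : ℝ) ^ (-(K : ℤ)) with hr
  have hcont : Continuous (shiftedCharacter p μ) :=
    continuous_shiftedCharacter (Nat.le_add_left 1 K) hN
  have hint (g : ℚ_[p] → ℝ) (hg : Continuous g) :
      IntegrableOn (fun x ↦ (g x : ℂ) * shiftedCharacter p μ x) B μHaar :=
    ((Complex.continuous_ofReal.comp hg).mul hcont).continuousOn.integrableOn_compact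
      (isCompact_closedBall _ _)
  have hzero : ∫ x in B, ((max ‖x‖ r : ℝ) : ℂ) * shiftedCharacter p μ x ∂μHaar = 0 :=
    setIntegral_max_norm_mul_shiftedCharacter μHaar hM hMK hN hu hu1
  have hdiff (x : ℚ_[p]) (_ : x ∈ B) :
      ((‖x‖ - max ‖x‖ r : ℝ) : ℂ) * shiftedCharacter p μ x =
        C.indicator (fun x ↦ ((‖x‖ - r : ℝ) : ℂ)) x := by
    by_cases hx : x ∈ C
    · rw [Set.indicator_of_mem hx,
        shiftedCharacter_eq_one (Nat.le_add_left 1 K) hN (mem_closedBall_zero_iff.1 hx), mul_one,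
        max_eq_right]
      exact mem_closedBall_zero_iff.1 (Padic.closedBall_succ_subset K hx)
    · rw [Set.indicator_of_notMem hx, max_eq_left, sub_self, Complex.ofReal_zero, zero_mul]
      exact Padic.le_norm_of_notMem_closedBall_succ hx
  calc ∫ x in B, (‖x‖ : ℂ) * shiftedCharacter p μ x ∂μHaar
      = ∫ x in B, (((max ‖x‖ r : ℝ) : ℂ) * shiftedCharacter p μ x +
          ((‖x‖ - max ‖x‖ r : ℝ) : ℂ) * shiftedCharacter p μ x) ∂μHaar := by
        congr 1 with x
        push_cast
        ring
    _ = ∫ x in B, C.indicator (fun x ↦ ((‖x‖ - r : ℝ) : ℂ)) x ∂μHaar := by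
        rw [integral_add (hint _ (by fun_prop)) (hint _ (by fun_prop)), hzero, zero_add,
          setIntegral_congr_fun hBmeas hdiff]
    _ = ((∫ x in C, (‖x‖ - r) ∂μHaar : ℝ) : ℂ) := by
        rw [setIntegral_indicator hCmeas, Set.inter_eq_right.2 hCB, integral_complex_ofReal]
    _ = _ := by
        congr 1
        rw [integral_sub (Padic.integrableOn_norm_closedBall μHaar _)
          (integrableOn_const (isCompact_closedBall _ _).measure_ne_top), setIntegral_const,
          Padic.setIntegral_norm_closedBall μHaar hvol,
          Padic.measureReal_closedBall_zero μHaar hvol, smul_eq_mul, hr, ← zpow_add₀ hp,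
          show -((K + 1 : ℕ) : ℤ) + -(K : ℤ) = 1 - 2 * ((K + 1 : ℕ) : ℤ) by push_cast; ring,
          show 2 - 2 * ((K + 1 : ℕ) : ℤ) = 1 - 2 * ((K + 1 : ℕ) : ℤ) + 1 by ring,
          zpow_add_one₀ hp]
        field_simp
        ring
end

section
/- Let p be a prime and k ≥ 0 an integer. Then ∫_{p^{−k} ℤ_p} min(v_p(x), 0) dx = −k p^{k} + (p^{k} − 1)/(p − 1), where the integral is with respect to the additive Haar measure on ℚ_p normalized so that ℤ_p has measure 1, and the integrand is interpreted as 0 at x = 0. -/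
open MeasureTheory

namespace Padic

variable {p : ℕ} [hp : Fact p.Prime]

lemma norm_mul_zpow_le_iff_norm_lt_one (n : ℤ) (y : ℚ_[p]) :
    ‖y * (p : ℚ_[p]) ^ (-(n + 1))‖ ≤ (p : ℝ) ^ n ↔ ‖y‖ < 1 := by
  have hpos : (0 : ℝ) < (p : ℝ) ^ (n + 1) := zpow_pos (mod_cast hp.out.pos) _
  rw [norm_le_pow_iff_norm_lt_pow_add_one, norm_mul, norm_p_zpow, neg_neg]
  exact mul_lt_iff_lt_one_left hpos

/-- The closed ball of radius `p ^ (n + 1)` is the union of `p` translates of the closed ball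
of radius `p ^ n`. -/
lemma closedBall_zpow_add_one (n : ℤ) :
    Metric.closedBall (0 : ℚ_[p]) ((p : ℝ) ^ (n + 1)) =
      ⋃ j ∈ Finset.range p,
        Metric.closedBall ((j : ℚ_[p]) * (p : ℚ_[p]) ^ (-(n + 1))) ((p : ℝ) ^ n) := by
  have hp0 : (p : ℚ_[p]) ≠ 0 := mod_cast hp.out.ne_zero
  have hpos : (0 : ℝ) < (p : ℝ) ^ (n + 1) := zpow_pos (mod_cast hp.out.pos) _
  set c : ℚ_[p] := (p : ℚ_[p]) ^ (-(n + 1)) with hc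
  have hc0 : c ≠ 0 := zpow_ne_zero _ hp0
  have hcn : ‖c‖ = (p : ℝ) ^ (n + 1) := by rw [hc, norm_p_zpow, neg_neg]
  ext x
  obtain ⟨y, rfl⟩ : ∃ y, x = y * c := ⟨x / c, (div_mul_cancel₀ x hc0).symm⟩
  simp only [Set.mem_iUnion, Finset.mem_range, exists_prop, mem_closedBall_iff_norm, sub_zero,
    ← sub_mul, hc, norm_mul_zpow_le_iff_norm_lt_one]
  rw [← hc, norm_mul, hcn, mul_le_iff_le_one_left hpos]
  constructor
  · intro hy
    obtain ⟨z, rfl⟩ : ∃ z : ℤ_[p], (z : ℚ_[p]) = y := ⟨⟨y, hy⟩, rfl⟩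
    have h := z.norm_sub_zmodRepr_lt_one
    rw [PadicInt.norm_def, PadicInt.coe_sub, PadicInt.coe_natCast] at h
    exact ⟨_, z.zmodRepr_lt_p, h⟩
  · rintro ⟨j, -, hj⟩
    have hj1 : ‖(j : ℚ_[p])‖ ≤ 1 := mod_cast norm_int_le_one (p := p) (j : ℤ)
    calc ‖y‖ = ‖(y - j) + j‖ := by rw [sub_add_cancel]
      _ ≤ max ‖y - j‖ ‖(j : ℚ_[p])‖ := nonarchimedean _ _
      _ ≤ 1 := max_le hj.le hj1

lemma pairwiseDisjoint_closedBall_zpow (n : ℤ) :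
    (Finset.range p : Set ℕ).PairwiseDisjoint fun j : ℕ ↦
      Metric.closedBall ((j : ℚ_[p]) * (p : ℚ_[p]) ^ (-(n + 1))) ((p : ℝ) ^ n) := by
  intro i hi j hj hij
  rw [Function.onFun, Set.disjoint_left]
  intro x hxi hxj
  refine hij ?_
  rw [mem_closedBall_iff_norm] at hxi hxj
  have h : ‖((i : ℚ_[p]) - j) * (p : ℚ_[p]) ^ (-(n + 1))‖ ≤ (p : ℝ) ^ n := by
    rw [show ((i : ℚ_[p]) - j) * (p : ℚ_[p]) ^ (-(n + 1)) =
      (x - j * (p : ℚ_[p]) ^ (-(n + 1))) + -(x - i * (p : ℚ_[p]) ^ (-(n + 1))) by ring]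
    exact (nonarchimedean _ _).trans (max_le hxj (by rwa [norm_neg]))
  rw [norm_mul_zpow_le_iff_norm_lt_one] at h
  have hdvd : (p : ℤ) ∣ (i : ℤ) - j := by
    rw [← norm_intCast_lt_one_iff]
    exact_mod_cast h
  have hi' : i < p := by simpa using hi
  have hj' : j < p := by simpa using hj
  have := Int.eq_zero_of_abs_lt_dvd hdvd (by rw [abs_lt]; constructor <;> omega)
  omega

/-- On the sphere of radius `p ^ n`, the valuation is `-n`. -/
lemma valuation_eq_neg_of_norm_eq_zpow {x : ℚ_[p]} {n : ℤ} (hx : ‖x‖ = (p : ℝ) ^ n) :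
    x.valuation = -n := by
  have hp1 : (1 : ℝ) < p := mod_cast hp.out.one_lt
  have hx0 : x ≠ 0 := by
    rintro rfl
    rw [norm_zero] at hx
    exact (zpow_pos (zero_lt_one.trans hp1) n).ne hx
  rw [norm_eq_zpow_neg_valuation hx0] at hx
  have := (zpow_right_strictMono₀ hp1).injective hx
  omega

section Measure

variable [MeasurableSpace ℚ_[p]] [BorelSpace ℚ_[p]] (μ : Measure ℚ_[p]) [μ.IsAddHaarMeasure]

lemma measureReal_closedBall_zpow_add_one (n : ℤ) :
    μ.real (Metric.closedBall 0 ((p : ℝ) ^ (n + 1))) =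
      p * μ.real (Metric.closedBall 0 ((p : ℝ) ^ n)) := by
  have htrans (a : ℚ_[p]) (r : ℝ) :
      μ.real (Metric.closedBall a r) = μ.real (Metric.closedBall 0 r) := by
    have h := measure_vadd μ a (Metric.closedBall (0 : ℚ_[p]) r)
    rw [Metric.vadd_closedBall, vadd_eq_add, add_zero] at h
    simp only [measureReal_def, h]
  rw [closedBall_zpow_add_one, measureReal_biUnion_finset (pairwiseDisjoint_closedBall_zpow n)
    (fun _ _ ↦ measurableSet_closedBall) (fun _ _ ↦ measure_closedBall_lt_top.ne)]
  simp [htrans]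

variable {μ}

lemma measureReal_closedBall_pow (hvol : μ (Metric.closedBall 0 1) = 1) (k : ℕ) :
    μ.real (Metric.closedBall 0 ((p : ℝ) ^ (k : ℤ))) = (p : ℝ) ^ k := by
  induction k with
  | zero => simp [measureReal_def, hvol]
  | succ k ih => rw [Nat.cast_succ, measureReal_closedBall_zpow_add_one, ih, pow_succ']

lemma integrableOn_and_setIntegral_min_valuation (hvol : μ (Metric.closedBall 0 1) = 1) (k : ℕ) :
    IntegrableOn (fun x : ℚ_[p] ↦ ((min x.valuation 0 : ℤ) : ℝ))
        (Metric.closedBall 0 ((p : ℝ) ^ (k : ℤ))) μ ∧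
      ∫ x in Metric.closedBall (0 : ℚ_[p]) ((p : ℝ) ^ (k : ℤ)),
        ((min x.valuation 0 : ℤ) : ℝ) ∂μ =
          -(k : ℝ) * (p : ℝ) ^ k + ((p : ℝ) ^ k - 1) / ((p : ℝ) - 1) := by
  have hp1 : (1 : ℝ) < p := mod_cast hp.out.one_lt
  induction k with
  | zero =>
    have h0 : Set.EqOn (fun x : ℚ_[p] ↦ ((min x.valuation 0 : ℤ) : ℝ)) (fun _ ↦ 0)
        (Metric.closedBall 0 ((p : ℝ) ^ ((0 : ℕ) : ℤ))) := by
      intro x hx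
      have hx1 : ‖x‖ ≤ 1 := by simpa using hx
      simp [(norm_le_one_iff_val_nonneg x).1 hx1]
    refine ⟨integrableOn_zero.congr_fun h0.symm measurableSet_closedBall, ?_⟩
    rw [setIntegral_congr_fun measurableSet_closedBall h0]
    simp
  | succ k ih =>
    obtain ⟨hint, hval⟩ := ih
    set B : ℕ → Set ℚ_[p] := fun k ↦ Metric.closedBall 0 ((p : ℝ) ^ (k : ℤ)) with hB
    have hmeas (k : ℕ) : MeasurableSet (B k) := measurableSet_closedBall
    have hsub : B k ⊆ B (k + 1) :=
      Metric.closedBall_subset_closedBall (zpow_le_zpow_right₀ hp1.le (by simp))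
    have hS : MeasurableSet (B (k + 1) \ B k) := (hmeas _).diff (hmeas _)
    have hSlt : μ (B (k + 1) \ B k) < ⊤ :=
      (measure_mono Set.sdiff_subset).trans_lt measure_closedBall_lt_top
    have hconst : Set.EqOn (fun x : ℚ_[p] ↦ ((min x.valuation 0 : ℤ) : ℝ))
        (fun _ ↦ -((k : ℝ) + 1)) (B (k + 1) \ B k) := by
      rintro x ⟨hx, hx'⟩
      simp only [hB, mem_closedBall_zero_iff] at hx hx'
      rw [norm_le_pow_iff_norm_lt_pow_add_one, not_lt] at hx'
      have hv := valuation_eq_neg_of_norm_eq_zpow (le_antisymm hx (by exact_mod_cast hx'))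
      have hmin : min x.valuation 0 = -((k : ℤ) + 1) := by omega
      simp only [hmin]
      push_cast
      ring
    have hintS : IntegrableOn (fun x : ℚ_[p] ↦ ((min x.valuation 0 : ℤ) : ℝ))
        (B (k + 1) \ B k) μ :=
      (integrableOn_const hSlt.ne).congr_fun hconst.symm hS
    have hunion : B (k + 1) = B k ∪ (B (k + 1) \ B k) := (Set.union_sdiff_cancel hsub).symm
    change IntegrableOn _ (B (k + 1)) μ ∧ ∫ x in B (k + 1), _ ∂μ = _
    refine ⟨hunion ▸ hint.union hintS, ?_⟩
    have hvolS : μ.real (B (k + 1) \ B k) = (p : ℝ) ^ (k + 1) - (p : ℝ) ^ k := by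
      rw [measureReal_sdiff hsub (hmeas k) measure_closedBall_lt_top.ne,
        measureReal_closedBall_pow hvol, measureReal_closedBall_pow hvol]
    rw [hunion, setIntegral_union Set.disjoint_sdiff_right hS hint hintS, hval,
      setIntegral_congr_fun hS hconst, setIntegral_const, hvolS, smul_eq_mul]
    have hne : (p : ℝ) - 1 ≠ 0 := (sub_pos.2 hp1).ne'
    push_cast
    field_simp
    ring

end Measure

end Padic

/-- Let `p` be a prime and `k ≥ 0`.  Then
`∫_{p^{-k} ℤ_p} min (v_p x) 0 dx = -k p^k + (p^k - 1)/(p - 1)`, w.r.t. the additive Haar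
measure on `ℚ_p` normalized so that `ℤ_p` has measure 1 (the integrand being `0` at `x = 0`,
which is Mathlib's convention `Padic.valuation 0 = 0`). -/
theorem stmt9 (p : ℕ) [Fact p.Prime] (k : ℕ)
    [MeasurableSpace ℚ_[p]] [BorelSpace ℚ_[p]]
    (μ : Measure ℚ_[p]) [μ.IsAddHaarMeasure]
    (hvol : μ {x : ℚ_[p] | ‖x‖ ≤ 1} = 1) :
    ∫ x in {x : ℚ_[p] | ‖x‖ ≤ (p : ℝ) ^ (k : ℤ)}, ((min (Padic.valuation x) 0 : ℤ) : ℝ) ∂μ =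
      -(k : ℝ) * (p : ℝ) ^ k + ((p : ℝ) ^ k - 1) / ((p : ℝ) - 1) := by
  have hball (r : ℝ) : {x : ℚ_[p] | ‖x‖ ≤ r} = Metric.closedBall 0 r := by
    ext x
    simp
  rw [hball] at hvol ⊢
  exact (Padic.integrableOn_and_setIntegral_min_valuation hvol k).2
end

section
/- Let φ ∈ C_c^∞(ℝ^2) be a smooth compactly supported function and let σ ∈ ℝ. Then there exists a constant C (depending on φ and σ) such that for every s ∈ ℂ with Re s = σ, |∫_{ℝ}∫_{ℝ} φ(x, ξ) · log((e^{ξ} − e^{−ξ})^2 + x^2) · e^{sξ} dx dξ| ≤ C (1 + |s|)^{−2}. -/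
open MeasureTheory

/-- Twofold integration by parts against `exp (s t)`. -/
lemma sq_mul_integral_mul_cexp {u u' u'' : ℝ → ℂ} (hu : ∀ t, HasDerivAt u (u' t) t)
    (hu' : ∀ t, HasDerivAt u' (u'' t) t) (hu'' : Continuous u'') {b : ℝ} (hb : u b = 0)
    (hb' : u' b = 0) (s : ℂ) :
    s ^ 2 * ∫ t in (0 : ℝ)..b, u t * Complex.exp (s * t) =
      (∫ t in (0 : ℝ)..b, u'' t * Complex.exp (s * t)) - s * u 0 + u' 0 := by
  have hcu : Continuous u := continuous_iff_continuousAt.2 fun t => (hu t).continuousAt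
  have hexp : ∀ t : ℝ, HasDerivAt (fun t : ℝ => Complex.exp (s * t)) (Complex.exp (s * t) * s) t :=
    fun t => by
      simpa using ((Complex.ofRealCLM.hasDerivAt (x := t)).const_mul s).cexp
  have key := intervalIntegral.integral_eq_sub_of_hasDerivAt (a := 0) (b := b)
    (f := fun t : ℝ => (s * u t - u' t) * Complex.exp (s * t))
    (f' := fun t : ℝ => s ^ 2 * (u t * Complex.exp (s * t)) - u'' t * Complex.exp (s * t))
    (fun t _ => by
      refine ((((hu t).const_mul s).fun_sub (hu' t)).fun_mul (hexp t)).congr_deriv ?_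
      ring)
    (Continuous.intervalIntegrable (by fun_prop) _ _)
  rw [intervalIntegral.integral_sub (Continuous.intervalIntegrable (by fun_prop) _ _)
    (Continuous.intervalIntegrable (by fun_prop) _ _), intervalIntegral.integral_const_mul] at key
  simp only [hb, hb', Complex.ofReal_zero, mul_zero, Complex.exp_zero] at key
  linear_combination key

lemma poissonKernel_eq {x : ℝ} (hx : x ≠ 0) (t : ℝ) :
    |x| / (x ^ 2 + t ^ 2) = |x|⁻¹ * (1 + (x⁻¹ * t) ^ 2)⁻¹ := by
  have h1 : |x| ≠ 0 := abs_ne_zero.2 hx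
  have h2 : x ^ 2 + t ^ 2 ≠ 0 := by positivity
  have h3 : 1 + (x⁻¹ * t) ^ 2 ≠ 0 := by positivity
  have h4 : 1 + (x⁻¹ * t) ^ 2 = (x ^ 2 + t ^ 2) / |x| ^ 2 := by
    rw [sq_abs]; field_simp
  rw [h4]; field_simp

lemma integrable_abs_div_sq_add_sq {x : ℝ} (hx : x ≠ 0) :
    Integrable fun t : ℝ => |x| / (x ^ 2 + t ^ 2) := by
  simp_rw [poissonKernel_eq hx]
  exact (integrable_inv_one_add_sq.comp_mul_left' (inv_ne_zero hx)).const_mul _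

lemma integral_abs_div_sq_add_sq {x : ℝ} (hx : x ≠ 0) :
    ∫ t : ℝ, |x| / (x ^ 2 + t ^ 2) = Real.pi := by
  simp_rw [poissonKernel_eq hx]
  rw [integral_const_mul, Measure.integral_comp_mul_left (fun t : ℝ => (1 + t ^ 2)⁻¹),
    integral_univ_inv_one_add_sq, inv_inv, smul_eq_mul, ← mul_assoc,
    inv_mul_cancel₀ (abs_ne_zero.2 hx), one_mul]

/-- A function dominated by a constant plus a multiple of the Poisson kernel has primitives bounded
independently of the scale `x` of the kernel. -/
lemma norm_intervalIntegral_le_of_le_const_add {x D₀ D₁ R b : ℝ} (hx : x ≠ 0)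
    (hD₁ : 0 ≤ D₁) (hb : |b| = R) {g : ℝ → ℂ}
    (hg : ∀ t, |t| ≤ R → ‖g t‖ ≤ D₀ + D₁ * (|x| / (x ^ 2 + t ^ 2))) :
    ‖∫ t in (0 : ℝ)..b, g t‖ ≤ R * D₀ + D₁ * Real.pi := by
  have hi := (integrable_abs_div_sq_add_sq hx).const_mul D₁
  have hc : IntegrableOn (fun _ : ℝ => D₀) (Set.uIoc 0 b) := by
    simp [Set.uIoc]
  rw [intervalIntegral.norm_integral_eq_norm_integral_uIoc]
  have hvol : volume.real (Set.uIoc 0 b) = R := by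
    rw [Set.uIoc, Real.volume_real_Ioc, ← hb, max_sub_min_eq_abs]; simp
  calc ‖∫ t in Set.uIoc 0 b, g t‖
      ≤ ∫ t in Set.uIoc 0 b, (D₀ + D₁ * (|x| / (x ^ 2 + t ^ 2))) := by
        refine norm_integral_le_of_norm_le (hc.add hi.integrableOn) ?_
        refine (ae_restrict_iff' measurableSet_uIoc).2 (.of_forall fun t ht => hg t ?_)
        have := Set.abs_sub_left_of_mem_uIcc (Set.uIoc_subset_uIcc ht)
        simpa [hb] using this
    _ = R * D₀ + ∫ t in Set.uIoc 0 b, D₁ * (|x| / (x ^ 2 + t ^ 2)) := by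
        rw [integral_add hc hi.integrableOn, setIntegral_const, hvol, smul_eq_mul]
    _ ≤ R * D₀ + ∫ t, D₁ * (|x| / (x ^ 2 + t ^ 2)) := by
        gcongr
        · exact .of_forall fun t => by positivity
        · exact Measure.restrict_le_self
    _ = R * D₀ + D₁ * Real.pi := by rw [integral_const_mul, integral_abs_div_sq_add_sq hx]

/-- For `x ≠ 0`, a smooth function of `t` which agrees on each of the half-lines `t ≤ 0` and `0 ≤ t`,
for a suitable value of `a`, with the primitive `logKernel` of the logarithm. -/
noncomputable def logPrimitive (x a t : ℝ) : ℝ :=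
  x * Real.log ((Real.exp t - Real.exp (-t)) ^ 2 + x ^ 2) - 2 * x
    - 2 * (Real.exp t - Real.exp (-t)) * Real.arctan ((Real.exp t - Real.exp (-t)) / x)
    + a * (Real.exp t - Real.exp (-t))

lemma hasDerivAt_exp_sub_exp_neg (t : ℝ) :
    HasDerivAt (fun t => Real.exp t - Real.exp (-t)) (Real.exp t + Real.exp (-t)) t := by
  refine ((Real.hasDerivAt_exp t).fun_sub (hasDerivAt_neg t).exp).congr_deriv ?_
  ring

lemma hasDerivAt_exp_add_exp_neg (t : ℝ) :
    HasDerivAt (fun t => Real.exp t + Real.exp (-t)) (Real.exp t - Real.exp (-t)) t := by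
  refine ((Real.hasDerivAt_exp t).fun_add (hasDerivAt_neg t).exp).congr_deriv ?_
  ring

lemma hasDerivAt_logPrimitive {x : ℝ} (hx : x ≠ 0) (a t : ℝ) :
    HasDerivAt (logPrimitive x a) ((Real.exp t + Real.exp (-t)) *
      (a - 2 * Real.arctan ((Real.exp t - Real.exp (-t)) / x))) t := by
  have hh := hasDerivAt_exp_sub_exp_neg t
  have hne : (Real.exp t - Real.exp (-t)) ^ 2 + x ^ 2 ≠ 0 := by positivity
  refine (((((((hh.fun_pow 2).add_const (x ^ 2)).log hne).const_mul x).sub_const (2 * x)).fun_sub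
    ((hh.const_mul 2).fun_mul (hh.div_const x).arctan)).fun_add
      (hh.const_mul a)).congr_deriv ?_
  generalize Real.exp t - Real.exp (-t) = h at *
  have h2 : x ^ 2 + h ^ 2 ≠ 0 := by rwa [add_comm]
  have : 1 + (h / x) ^ 2 = (h ^ 2 + x ^ 2) / x ^ 2 := by field_simp; ring
  rw [this]
  field_simp
  ring

lemma hasDerivAt_deriv_logPrimitive {x : ℝ} (hx : x ≠ 0) (a t : ℝ) :
    HasDerivAt (fun t => (Real.exp t + Real.exp (-t)) *
      (a - 2 * Real.arctan ((Real.exp t - Real.exp (-t)) / x)))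
      ((Real.exp t - Real.exp (-t)) *
      (a - 2 * Real.arctan ((Real.exp t - Real.exp (-t)) / x)) -
      2 * (Real.exp t + Real.exp (-t)) ^ 2 * (x / (x ^ 2 + (Real.exp t - Real.exp (-t)) ^ 2))) t := by
  have hh := hasDerivAt_exp_sub_exp_neg t
  refine ((hasDerivAt_exp_add_exp_neg t).fun_mul
    (((hh.div_const x).arctan.const_mul 2).const_sub a)).congr_deriv ?_
  generalize Real.exp t - Real.exp (-t) = h at *
  have h2 : x ^ 2 + h ^ 2 ≠ 0 := by positivity
  have : 1 + (h / x) ^ 2 = (x ^ 2 + h ^ 2) / x ^ 2 := by field_simp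
  rw [this]
  field_simp
  ring

lemma abs_mul_log_add_sq_le (h x : ℝ) :
    |x * Real.log (h ^ 2 + x ^ 2)| ≤ |x| * (h ^ 2 + x ^ 2) + 2 := by
  rcases eq_or_ne x 0 with rfl | hx
  · simp
  have hx0 : 0 < |x| := abs_pos.2 hx
  have ht : 0 < h ^ 2 + x ^ 2 := by positivity
  have h1 : Real.log (h ^ 2 + x ^ 2) ≤ h ^ 2 + x ^ 2 := Real.log_le_self ht.le
  have h2 : -(2 / |x|) ≤ Real.log (h ^ 2 + x ^ 2) := by
    have h3 : Real.log (x ^ 2) ≤ Real.log (h ^ 2 + x ^ 2) :=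
      Real.log_le_log (by positivity) (by nlinarith [sq_nonneg h])
    have h4 : Real.log |x|⁻¹ ≤ |x|⁻¹ := Real.log_le_self (by positivity)
    rw [Real.log_inv, Real.log_abs] at h4
    rw [Real.log_pow] at h3
    rw [div_eq_mul_inv]
    push_cast at h3
    linarith
  rw [abs_mul]
  have h5 : |Real.log (h ^ 2 + x ^ 2)| ≤ (h ^ 2 + x ^ 2) + 2 / |x| := by
    rw [abs_le]
    have : 0 < 2 / |x| := by positivity
    constructor <;> linarith
  calc _ ≤ |x| * ((h ^ 2 + x ^ 2) + 2 / |x|) := by gcongr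
    _ = _ := by field_simp

lemma sq_le_exp_sub_exp_neg_sq (t : ℝ) : t ^ 2 ≤ (Real.exp t - Real.exp (-t)) ^ 2 := by
  have h : Real.exp t - Real.exp (-t) = 2 * Real.sinh t := by rw [Real.sinh_eq]; ring
  have h1 : |t| ≤ |Real.sinh t| := by
    rw [Real.abs_sinh]; exact Real.self_le_sinh_iff.2 (abs_nonneg t)
  have := sq_le_sq.2 h1
  rw [h]; nlinarith [sq_nonneg (Real.sinh t)]

/-- A primitive in `x` of `log ((exp t - exp (-t)) ^ 2 + x ^ 2)`. -/
noncomputable def logKernel (x t : ℝ) : ℝ :=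
  x * Real.log ((Real.exp t - Real.exp (-t)) ^ 2 + x ^ 2) - 2 * x
    + 2 * (Real.exp t - Real.exp (-t)) * Real.arctan (x / (Real.exp t - Real.exp (-t)))

lemma hasDerivAt_logKernel {t : ℝ} (ht : t ≠ 0) (x : ℝ) :
    HasDerivAt (fun x => logKernel x t)
      (Real.log ((Real.exp t - Real.exp (-t)) ^ 2 + x ^ 2)) x := by
  unfold logKernel
  have hne : Real.exp t - Real.exp (-t) ≠ 0 := by
    intro h
    have := sq_le_exp_sub_exp_neg_sq t
    rw [h] at this
    have : 0 < t ^ 2 := by positivity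
    linarith
  generalize Real.exp t - Real.exp (-t) = h at *
  have hi := hasDerivAt_id' x
  have h1 : h ^ 2 + x ^ 2 ≠ 0 := by positivity
  refine (((hi.fun_mul (((hi.fun_pow 2).const_add (h ^ 2)).log h1)).fun_sub
    (hi.const_mul 2)).fun_add ((hi.div_const h).arctan.const_mul (2 * h))).congr_deriv ?_
  have : 1 + (x / h) ^ 2 = (h ^ 2 + x ^ 2) / h ^ 2 := by field_simp
  rw [this]
  field_simp
  ring

lemma measurable_logKernel : Measurable fun z : ℝ × ℝ => logKernel z.1 z.2 := by
  unfold logKernel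
  fun_prop

lemma abs_logKernel_le (x t : ℝ) :
    |logKernel x t| ≤ |x| * ((Real.exp t - Real.exp (-t)) ^ 2 + x ^ 2) + 2 + 2 * |x|
      + Real.pi * |Real.exp t - Real.exp (-t)| := by
  unfold logKernel
  generalize Real.exp t - Real.exp (-t) = h
  have h1 := abs_mul_log_add_sq_le h x
  have h2 : |2 * h * Real.arctan (x / h)| ≤ Real.pi * |h| := by
    have : |Real.arctan (x / h)| ≤ Real.pi / 2 :=
      abs_le.2 ⟨(Real.neg_pi_div_two_lt_arctan _).le, (Real.arctan_lt_pi_div_two _).le⟩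
    rw [abs_mul, abs_mul, abs_two]
    nlinarith [abs_nonneg h]
  have h3 : |2 * x| = 2 * |x| := by rw [abs_mul, abs_two]
  have h4 := abs_add_le (x * Real.log (h ^ 2 + x ^ 2) - 2 * x) (2 * h * Real.arctan (x / h))
  have h5 := abs_sub (x * Real.log (h ^ 2 + x ^ 2)) (2 * x)
  linarith

lemma logKernel_eq_logPrimitive {x t : ℝ} (hx : x ≠ 0) (ht : t ≠ 0) :
    logKernel x t = logPrimitive x (SignType.sign t * SignType.sign x * Real.pi) t := by
  have hs : ∀ y : ℝ, y ≠ 0 → Real.arctan y⁻¹ = SignType.sign y * (Real.pi / 2) - Real.arctan y := by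
    intro y hy
    rcases hy.lt_or_gt with hy | hy
    · rw [Real.arctan_inv_of_neg hy, sign_neg hy]; simp
    · rw [Real.arctan_inv_of_pos hy, sign_pos hy]; simp
  have hh : SignType.sign (Real.exp t - Real.exp (-t)) = SignType.sign t := by
    rcases ht.lt_or_gt with h | h
    · rw [sign_neg h, sign_neg]; rw [sub_neg, Real.exp_lt_exp]; linarith
    · rw [sign_pos h, sign_pos]; rw [sub_pos, Real.exp_lt_exp]; linarith
  have hne : Real.exp t - Real.exp (-t) ≠ 0 := by
    rw [← sign_ne_zero, hh, sign_ne_zero]; exact ht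
  have e : SignType.sign ((Real.exp t - Real.exp (-t)) / x) = SignType.sign t * SignType.sign x := by
    rw [div_eq_mul_inv, sign_mul, hh]
    congr 1
    rcases hx.lt_or_gt with h | h
    · rw [sign_neg h, sign_neg (inv_lt_zero.2 h)]
    · rw [sign_pos h, sign_pos (inv_pos.2 h)]
  rw [logKernel, logPrimitive, ← inv_div, hs _ (div_ne_zero hne hx), e]
  push_cast
  ring

lemma logKernel_of_nonneg {x t : ℝ} (hx : x ≠ 0) (ht : 0 ≤ t) :
    logKernel x t = logPrimitive x (SignType.sign x * Real.pi) t := by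
  rcases ht.eq_or_lt with rfl | ht
  · simp [logKernel, logPrimitive]
  · simp [logKernel_eq_logPrimitive hx ht.ne', sign_pos ht]

lemma logKernel_of_nonpos {x t : ℝ} (hx : x ≠ 0) (ht : t ≤ 0) :
    logKernel x t = logPrimitive x (-(SignType.sign x * Real.pi)) t := by
  rcases ht.eq_or_lt with rfl | ht
  · simp [logKernel, logPrimitive]
  · simp [logKernel_eq_logPrimitive hx ht.ne, sign_neg ht]

lemma abs_logPrimitive_le {x a t H : ℝ} (hx : |x| ≤ H) (ha : |a| ≤ Real.pi)
    (hH : Real.exp t + Real.exp (-t) ≤ H) :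
    |logPrimitive x a t| ≤ 2 * H ^ 3 + 2 + 2 * H + 2 * Real.pi * H := by
  unfold logPrimitive
  have hh : |Real.exp t - Real.exp (-t)| ≤ H := by
    have h1 := Real.exp_pos t
    have h2 := Real.exp_pos (-t)
    rw [abs_le]; constructor <;> linarith
  generalize Real.exp t - Real.exp (-t) = h at *
  have h0 : 0 ≤ H := (abs_nonneg _).trans hx
  have h1 := abs_mul_log_add_sq_le h x
  have h2 : |2 * h * Real.arctan (h / x)| ≤ Real.pi * H := by
    have : |Real.arctan (h / x)| ≤ Real.pi / 2 :=
      abs_le.2 ⟨(Real.neg_pi_div_two_lt_arctan _).le, (Real.arctan_lt_pi_div_two _).le⟩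
    rw [abs_mul, abs_mul, abs_two]
    calc 2 * |h| * |Real.arctan (h / x)| ≤ 2 * H * (Real.pi / 2) := by gcongr
      _ = _ := by ring
  have h3 : |2 * x| ≤ 2 * H := by rw [abs_mul, abs_two]; linarith
  have h4 : |a * h| ≤ Real.pi * H := by rw [abs_mul]; gcongr
  have h5 : |x| * (h ^ 2 + x ^ 2) ≤ 2 * H ^ 3 := by
    rw [← sq_abs h, ← sq_abs x]
    calc |x| * (|h| ^ 2 + |x| ^ 2) ≤ H * (H ^ 2 + H ^ 2) := by gcongr
      _ = _ := by ring
  have h6 := abs_add_le (x * Real.log (h ^ 2 + x ^ 2) - 2 * x - 2 * h * Real.arctan (h / x)) (a * h)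
  have h7 := abs_sub (x * Real.log (h ^ 2 + x ^ 2) - 2 * x) (2 * h * Real.arctan (h / x))
  have h8 := abs_sub (x * Real.log (h ^ 2 + x ^ 2)) (2 * x)
  linarith

lemma abs_sub_two_mul_arctan_le {a : ℝ} (ha : |a| ≤ Real.pi) (y : ℝ) :
    |a - 2 * Real.arctan y| ≤ 2 * Real.pi := by
  have h1 := Real.neg_pi_div_two_lt_arctan y
  have h2 := Real.arctan_lt_pi_div_two y
  rw [abs_le] at *
  constructor <;> linarith

/-- The part of the double integral over a half-line in `t`, at fixed `x`: up to a boundary term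
that only depends on `p 0`, it is bounded by a multiple of `‖s‖ ^ (-2)`, uniformly in `x`. -/
lemma norm_integral_mul_logPrimitive_le {p p' p'' : ℝ → ℂ} (hp : ∀ t, HasDerivAt p (p' t) t)
    (hp' : ∀ t, HasDerivAt p' (p'' t) t) (hp'' : Continuous p'') {A R E H x a b : ℝ}
    (hx : x ≠ 0) (hxH : |x| ≤ H) (ha : |a| ≤ Real.pi) (hb : |b| = R)
    (hpb : p b = 0) (hpb' : p' b = 0) (hA : ∀ t, ‖p t‖ ≤ A) (hA' : ∀ t, ‖p' t‖ ≤ A)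
    (hA'' : ∀ t, ‖p'' t‖ ≤ A) (hH : ∀ t, |t| ≤ R → Real.exp t + Real.exp (-t) ≤ H) {s : ℂ}
    (hE : ∀ t : ℝ, |t| ≤ R → ‖Complex.exp (s * t)‖ ≤ E) :
    ‖∫ t in (0 : ℝ)..b, p t * logPrimitive x a t * Complex.exp (s * t)‖ ≤
        A * (2 * H ^ 3 + 2 + 2 * H + 2 * Real.pi * H) * E * R ∧
    ‖s ^ 2 * (∫ t in (0 : ℝ)..b, p t * logPrimitive x a t * Complex.exp (s * t)) +
        s * (p 0 * logPrimitive x 0 0)‖ ≤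
      R * (A * ((2 * H ^ 3 + 2 + 2 * H + 2 * Real.pi * H) + 6 * Real.pi * H) * E)
        + A * (2 * H ^ 2) * E * Real.pi
        + A * ((2 * H ^ 3 + 2 + 2 * H + 2 * Real.pi * H) + 2 * Real.pi * H) := by
  set B := 2 * H ^ 3 + 2 + 2 * H + 2 * Real.pi * H
  have hR : 0 ≤ R := hb ▸ abs_nonneg b
  have hA0 : 0 ≤ A := (norm_nonneg _).trans (hA 0)
  have hE0 : 0 ≤ E := (norm_nonneg _).trans (hE 0 (by simpa))
  have hH0 : 0 ≤ H := (abs_nonneg _).trans hxH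
  have hB0 : 0 ≤ B := by positivity
  have hk : ∀ t, |t| ≤ R → ‖(logPrimitive x a t : ℂ)‖ ≤ B := fun t ht => by
    rw [Complex.norm_real]; exact abs_logPrimitive_le hxH ha (hH t ht)
  constructor
  · have := intervalIntegral.norm_integral_le_of_norm_le_const (a := 0) (b := b) (C := A * B * E)
      (f := fun t : ℝ => p t * logPrimitive x a t * Complex.exp (s * t)) (fun t ht => by
        have ht' : |t| ≤ R := by
          have := Set.abs_sub_left_of_mem_uIcc (Set.uIoc_subset_uIcc ht)
          simpa [hb] using this
        rw [norm_mul, norm_mul]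
        gcongr
        exacts [hA t, hk t ht', hE t ht'])
    simpa [hb] using this
  set k' : ℝ → ℝ := fun t => (Real.exp t + Real.exp (-t)) *
      (a - 2 * Real.arctan ((Real.exp t - Real.exp (-t)) / x)) with hk'
  set k'' : ℝ → ℝ := fun t => (Real.exp t - Real.exp (-t)) *
      (a - 2 * Real.arctan ((Real.exp t - Real.exp (-t)) / x)) -
      2 * (Real.exp t + Real.exp (-t)) ^ 2 * (x / (x ^ 2 + (Real.exp t - Real.exp (-t)) ^ 2))
      with hk''
  have hd : ∀ t, HasDerivAt (fun t => (logPrimitive x a t : ℂ)) (k' t) t :=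
    fun t => (hasDerivAt_logPrimitive hx a t).ofReal_comp
  have hd' : ∀ t, HasDerivAt (fun t => (k' t : ℂ)) (k'' t) t :=
    fun t => (hasDerivAt_deriv_logPrimitive hx a t).ofReal_comp
  have hck'' : Continuous k'' := by
    have h0 : ∀ t : ℝ, x ^ 2 + (Real.exp t - Real.exp (-t)) ^ 2 ≠ 0 := fun t => by positivity
    simp only [hk'']
    fun_prop (disch := assumption)
  have hck : Continuous fun t => (logPrimitive x a t : ℂ) :=
    continuous_iff_continuousAt.2 fun t => (hd t).continuousAt
  have hck' : Continuous fun t => (k' t : ℂ) :=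
    continuous_iff_continuousAt.2 fun t => (hd' t).continuousAt
  have hcp : Continuous p := continuous_iff_continuousAt.2 fun t => (hp t).continuousAt
  have hcp' : Continuous p' := continuous_iff_continuousAt.2 fun t => (hp' t).continuousAt
  have hbk' : ∀ t, |t| ≤ R → ‖(k' t : ℂ)‖ ≤ 2 * Real.pi * H := fun t ht => by
    rw [Complex.norm_real, Real.norm_eq_abs, hk', abs_mul, abs_of_pos (by positivity), mul_comm]
    gcongr
    exacts [abs_sub_two_mul_arctan_le ha _, hH t ht]
  have hbk'' : ∀ t, |t| ≤ R →
      ‖(k'' t : ℂ)‖ ≤ 2 * Real.pi * H + 2 * H ^ 2 * (|x| / (x ^ 2 + t ^ 2)) := fun t ht => by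
    rw [Complex.norm_real, Real.norm_eq_abs, hk'']
    refine (abs_sub _ _).trans ?_
    have hh : |Real.exp t - Real.exp (-t)| ≤ H := by
      have h1 := Real.exp_pos t
      have h2 := Real.exp_pos (-t)
      have h3 := hH t ht
      rw [abs_le]; constructor <;> linarith
    gcongr
    · rw [abs_mul, mul_comm]
      gcongr
      exact abs_sub_two_mul_arctan_le ha _
    · rw [abs_mul, abs_mul, abs_two, abs_div, abs_of_pos (by positivity : 0 <
        x ^ 2 + (Real.exp t - Real.exp (-t)) ^ 2), abs_of_pos (by positivity : 0 <
        (Real.exp t + Real.exp (-t)) ^ 2)]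
      gcongr 2 * ?_ ^ 2 * (|x| / (x ^ 2 + ?_))
      exacts [hH t ht, sq_le_exp_sub_exp_neg_sq t]
  have key := sq_mul_integral_mul_cexp (s := s) (b := b)
    (u := fun t => p t * logPrimitive x a t)
    (u' := fun t => p' t * logPrimitive x a t + p t * k' t)
    (u'' := fun t => (p'' t * logPrimitive x a t + p' t * k' t) + (p' t * k' t + p t * k'' t))
    (fun t => (hp t).fun_mul (hd t))
    (fun t => ((hp' t).fun_mul (hd t)).fun_add ((hp t).fun_mul (hd' t)))
    (by fun_prop) (by simp [hpb]) (by simp [hpb, hpb'])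
  have hk0 : logPrimitive x a 0 = logPrimitive x 0 0 := by simp [logPrimitive]
  rw [hk0] at key
  rw [key]
  have hD : ∀ t, |t| ≤ R → ‖((p'' t * logPrimitive x a t + p' t * k' t) +
      (p' t * k' t + p t * k'' t)) * Complex.exp (s * t)‖ ≤
      A * (B + 6 * Real.pi * H) * E + A * (2 * H ^ 2) * E * (|x| / (x ^ 2 + t ^ 2)) := by
    intro t ht
    have e1 : ‖p'' t * logPrimitive x a t‖ ≤ A * B := by
      rw [norm_mul]; gcongr; exacts [hA'' t, hk t ht]
    have e2 : ‖p' t * k' t‖ ≤ A * (2 * Real.pi * H) := by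
      rw [norm_mul]; gcongr; exacts [hA' t, hbk' t ht]
    have e3 : ‖p t * k'' t‖ ≤ A * (2 * Real.pi * H + 2 * H ^ 2 * (|x| / (x ^ 2 + t ^ 2))) := by
      rw [norm_mul]; gcongr; exacts [hA t, hbk'' t ht]
    rw [norm_mul]
    calc _ ≤ (A * B + A * (2 * Real.pi * H) + (A * (2 * Real.pi * H) +
          A * (2 * Real.pi * H + 2 * H ^ 2 * (|x| / (x ^ 2 + t ^ 2))))) * E := by
          gcongr
          · exact norm_add_le_of_le (norm_add_le_of_le e1 e2) (norm_add_le_of_le e2 e3)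
          · exact hE t ht
      _ = _ := by ring
  have hI := norm_intervalIntegral_le_of_le_const_add hx (by positivity) hb hD
  have h0 : ‖p' 0 * logPrimitive x 0 0 + p 0 * k' 0‖ ≤ A * (B + 2 * Real.pi * H) := by
    rw [mul_add, ← hk0]
    refine norm_add_le_of_le ?_ ?_
    · rw [norm_mul]; gcongr; exacts [hA' 0, hk 0 (by simpa)]
    · rw [norm_mul]; gcongr; exacts [hA 0, hbk' 0 (by simpa)]
  refine le_trans (le_of_eq ?_) (norm_add_le_of_le hI h0)
  congr 1
  ring

/-- At fixed `x ≠ 0`, the integral over `t` decays like `‖s‖ ^ (-2)`, uniformly in `x`. -/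
lemma norm_integral_mul_logKernel_le (A R E H : ℝ) : ∃ M : ℝ, ∀ (p p' p'' : ℝ → ℂ) (x : ℝ) (s : ℂ),
    (∀ t, HasDerivAt p (p' t) t) → (∀ t, HasDerivAt p' (p'' t) t) → Continuous p'' →
    x ≠ 0 → |x| ≤ H → 0 ≤ R → (∀ t, R ≤ |t| → p t = 0) → (∀ t, R ≤ |t| → p' t = 0) →
    (∀ t, ‖p t‖ ≤ A) → (∀ t, ‖p' t‖ ≤ A) → (∀ t, ‖p'' t‖ ≤ A) →
    (∀ t, |t| ≤ R → Real.exp t + Real.exp (-t) ≤ H) →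
    (∀ t : ℝ, |t| ≤ R → ‖Complex.exp (s * t)‖ ≤ E) →
    ‖∫ t : ℝ, p t * logKernel x t * Complex.exp (s * t)‖ ≤ M / (1 + ‖s‖) ^ 2 := by
  refine ⟨2 * (2 * (A * (2 * H ^ 3 + 2 + 2 * H + 2 * Real.pi * H) * E * R) +
    2 * (R * (A * ((2 * H ^ 3 + 2 + 2 * H + 2 * Real.pi * H) + 6 * Real.pi * H) * E)
        + A * (2 * H ^ 2) * E * Real.pi
        + A * ((2 * H ^ 3 + 2 + 2 * H + 2 * Real.pi * H) + 2 * Real.pi * H))), ?_⟩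
  intro p p' p'' x s hp hp' hp'' hx hxH hR hpR hpR' hA hA' hA'' hH hE
  have hsg : |(SignType.sign x : ℝ) * Real.pi| ≤ Real.pi := by
    rcases hx.lt_or_gt with h | h <;> simp [h, abs_of_pos Real.pi_pos]
  have h1 := norm_integral_mul_logPrimitive_le hp hp' hp'' hx hxH hsg (abs_of_nonneg hR)
    (hpR R (le_abs_self R)) (hpR' R (le_abs_self R)) hA hA' hA'' hH hE
  have h2 := norm_integral_mul_logPrimitive_le hp hp' hp'' hx hxH ((abs_neg _).le.trans hsg)
    (by rw [abs_neg, abs_of_nonneg hR] : |-R| = R)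
    (hpR (-R) (by rw [abs_neg]; exact le_abs_self R))
    (hpR' (-R) (by rw [abs_neg]; exact le_abs_self R)) hA hA' hA'' hH hE
  set I₁ := ∫ t in (0 : ℝ)..R, p t * logPrimitive x (SignType.sign x * Real.pi) t *
    Complex.exp (s * t)
  set I₂ := ∫ t in (0 : ℝ)..(-R), p t * logPrimitive x (-(SignType.sign x * Real.pi)) t *
    Complex.exp (s * t)
  have hcp : Continuous p := continuous_iff_continuousAt.2 fun t => (hp t).continuousAt
  have hc : ∀ a, Continuous fun t => (logPrimitive x a t : ℂ) := fun a =>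
    Complex.continuous_ofReal.comp
      (continuous_iff_continuousAt.2 fun t => (hasDerivAt_logPrimitive hx a t).continuousAt)
  have e1 : Set.EqOn (fun t : ℝ => p t * logPrimitive x (SignType.sign x * Real.pi) t *
      Complex.exp (s * t)) (fun t : ℝ => p t * logKernel x t * Complex.exp (s * t))
      (Set.uIcc 0 R) := fun t ht => by
    rw [Set.uIcc_of_le hR] at ht
    simp only [logKernel_of_nonneg hx ht.1]
  have e2 : Set.EqOn (fun t : ℝ => p t * logPrimitive x (-(SignType.sign x * Real.pi)) t *
      Complex.exp (s * t)) (fun t : ℝ => p t * logKernel x t * Complex.exp (s * t))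
      (Set.uIcc 0 (-R)) := fun t ht => by
    rw [Set.uIcc_of_ge (by linarith)] at ht
    simp only [logKernel_of_nonpos hx ht.2]
  have hint : ∀ a b : ℝ, IntervalIntegrable (fun t : ℝ => p t * logPrimitive x a t *
      Complex.exp (s * t)) volume 0 b := fun a b => by
    have := hc a
    exact Continuous.intervalIntegrable (by fun_prop) _ _
  have hsplit : ∫ t : ℝ, p t * logKernel x t * Complex.exp (s * t) = I₁ - I₂ := by
    rw [← intervalIntegral.integral_eq_integral_of_support_subset (a := -R) (b := R),
      ← intervalIntegral.integral_interval_sub_left (a := 0),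
      ← intervalIntegral.integral_congr e1, ← intervalIntegral.integral_congr e2]
    · exact (intervalIntegrable_congr (e1.mono Set.uIoc_subset_uIcc)).1 (hint _ _)
    · exact (intervalIntegrable_congr (e2.mono Set.uIoc_subset_uIcc)).1 (hint _ _)
    · intro t ht
      have : |t| < R := by
        by_contra! h
        simp [hpR t h] at ht
      rw [abs_lt] at this
      exact ⟨this.1, this.2.le⟩
  rw [hsplit, le_div_iff₀ (by positivity)]
  have h3 : ‖I₁ - I₂‖ ≤ _ := norm_sub_le_of_le h1.1 h2.1
  have h4 := norm_sub_le_of_le h1.2 h2.2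
  rw [add_sub_add_right_eq_sub, ← mul_sub, norm_mul, norm_pow] at h4
  have h5 : (1 + ‖s‖) ^ 2 ≤ 2 * (1 + ‖s‖ ^ 2) := by nlinarith [sq_nonneg (1 - ‖s‖)]
  calc _ ≤ ‖I₁ - I₂‖ * (2 * (1 + ‖s‖ ^ 2)) := by gcongr
    _ = 2 * (‖I₁ - I₂‖ + ‖s‖ ^ 2 * ‖I₁ - I₂‖) := by ring
    _ ≤ _ := by linarith

lemma hasDerivAt_comp_prodMk_left {f : ℝ × ℝ → ℂ} (hf : Differentiable ℝ f) (x t : ℝ) :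
    HasDerivAt (fun x => f (x, t)) (fderiv ℝ f (x, t) (1, 0)) x :=
  (hf (x, t)).hasFDerivAt.comp_hasDerivAt x ((hasDerivAt_id x).prodMk (hasDerivAt_const x t))

lemma hasDerivAt_comp_prodMk_right {f : ℝ × ℝ → ℂ} (hf : Differentiable ℝ f) (x t : ℝ) :
    HasDerivAt (fun t => f (x, t)) (fderiv ℝ f (x, t) (0, 1)) t :=
  (hf (x, t)).hasFDerivAt.comp_hasDerivAt t ((hasDerivAt_const t x).prodMk (hasDerivAt_id t))

/-- Let `φ ∈ C_c^∞(ℝ²)` and `σ ∈ ℝ`.  Then there is a constant `C`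
(depending on `φ` and `σ`) such that for every `s ∈ ℂ` with `Re s = σ`,
`|∫∫ φ(x,ξ) log((e^ξ - e^{-ξ})² + x²) e^{sξ} dx dξ| ≤ C (1 + |s|)^{-2}`. -/
theorem stmt10 (φ : ℝ × ℝ → ℂ) (hφ : ContDiff ℝ (⊤ : ℕ∞) φ) (hsupp : HasCompactSupport φ) (σ : ℝ) :
    ∃ C : ℝ, ∀ s : ℂ, s.re = σ →
      ‖∫ ξ : ℝ, ∫ x : ℝ, φ (x, ξ) *
          ((Real.log ((Real.exp ξ - Real.exp (-ξ)) ^ 2 + x ^ 2) : ℝ) : ℂ) *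
            Complex.exp (s * (ξ : ℂ))‖ ≤ C / (1 + ‖s‖) ^ 2 := by
  have hdiff : ∀ {f : ℝ × ℝ → ℂ} (v : ℝ × ℝ), ContDiff ℝ (⊤ : ℕ∞) f →
      ContDiff ℝ (⊤ : ℕ∞) (fun z => fderiv ℝ f z v) := fun v hf =>
    (hf.fderiv_right (by simp)).clm_apply contDiff_const
  set ψ : ℝ × ℝ → ℂ := fun z => fderiv ℝ φ z (1, 0)
  set ψ' : ℝ × ℝ → ℂ := fun z => fderiv ℝ ψ z (0, 1)
  set ψ'' : ℝ × ℝ → ℂ := fun z => fderiv ℝ ψ' z (0, 1)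
  have sψ : ContDiff ℝ (⊤ : ℕ∞) ψ := hdiff _ hφ
  have sψ' : ContDiff ℝ (⊤ : ℕ∞) ψ' := hdiff _ sψ
  have sψ'' : ContDiff ℝ (⊤ : ℕ∞) ψ'' := hdiff _ sψ'
  have cψ : HasCompactSupport ψ := hsupp.fderiv_apply ℝ _
  have cψ' : HasCompactSupport ψ' := cψ.fderiv_apply ℝ _
  have cψ'' : HasCompactSupport ψ'' := cψ'.fderiv_apply ℝ _
  obtain ⟨A₀, hA₀⟩ := cψ.exists_bound_of_continuous sψ.continuous
  obtain ⟨A₁, hA₁⟩ := cψ'.exists_bound_of_continuous sψ'.continuous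
  obtain ⟨A₂, hA₂⟩ := cψ''.exists_bound_of_continuous sψ''.continuous
  obtain ⟨R₀, hR₀⟩ := cψ.isCompact.isBounded.subset_closedBall 0
  set R := |R₀| + 1
  have hR0 : 0 ≤ R := by positivity
  have hzero : ∀ x t : ℝ, (R ≤ |x| ∨ R ≤ |t|) → (x, t) ∉ tsupport ψ := by
    intro x t h hmem
    have h1 := hR₀ hmem
    rw [mem_closedBall_zero_iff, Prod.norm_mk, max_le_iff, Real.norm_eq_abs,
      Real.norm_eq_abs] at h1
    have := le_abs_self R₀
    rcases h with h | h <;> linarith [h1.1, h1.2]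
  have zψ : ∀ x t : ℝ, (R ≤ |x| ∨ R ≤ |t|) → ψ (x, t) = 0 := fun x t h =>
    image_eq_zero_of_notMem_tsupport (hzero x t h)
  have zψ' : ∀ x t : ℝ, (R ≤ |x| ∨ R ≤ |t|) → ψ' (x, t) = 0 := fun x t h =>
    image_eq_zero_of_notMem_tsupport fun hm => hzero x t h (tsupport_fderiv_apply_subset ℝ _ hm)
  obtain ⟨M, hM⟩ := norm_integral_mul_logKernel_le (max A₀ (max A₁ A₂)) R (Real.exp (|σ| * R))
    (2 * Real.exp R)
  refine ⟨2 * R * M, fun s hs => ?_⟩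
  have hx_parts : ∀ t : ℝ, t ≠ 0 → ∫ x : ℝ, φ (x, t) *
      ((Real.log ((Real.exp t - Real.exp (-t)) ^ 2 + x ^ 2) : ℝ) : ℂ) * Complex.exp (s * t) =
      -∫ x : ℝ, ψ (x, t) * logKernel x t * Complex.exp (s * t) := by
    intro t ht
    have hne : ∀ x, (Real.exp t - Real.exp (-t)) ^ 2 + x ^ 2 ≠ 0 := fun x => by
      have := sq_le_exp_sub_exp_neg_sq t
      have : 0 < t ^ 2 := by positivity
      nlinarith [sq_nonneg x]
    have hcs : ∀ {f : ℝ × ℝ → ℂ}, HasCompactSupport f → HasCompactSupport fun x => f (x, t) :=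
      fun hf => hf.comp_isClosedEmbedding (Isometry.isClosedEmbedding
        (.of_dist_eq fun x y => by simp [Prod.dist_eq]))
    have hck : Continuous fun x => (logKernel x t : ℂ) := Complex.continuous_ofReal.comp
      (continuous_iff_continuousAt.2 fun x => (hasDerivAt_logKernel ht x).continuousAt)
    have hcφ : Continuous fun x => φ (x, t) := hφ.continuous.comp (by fun_prop)
    have hcψ : Continuous fun x => ψ (x, t) := sψ.continuous.comp (by fun_prop)
    have hcl : Continuous fun x : ℝ =>
        ((Real.log ((Real.exp t - Real.exp (-t)) ^ 2 + x ^ 2) : ℝ) : ℂ) :=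
      Complex.continuous_ofReal.comp (Continuous.log (by fun_prop) hne)
    rw [integral_mul_const, integral_mul_const, ← neg_mul]
    congr 1
    exact integral_mul_deriv_eq_deriv_mul_of_integrable
      (fun x _ => hasDerivAt_comp_prodMk_left (hφ.differentiable (by simp)) x t)
      (fun x _ => (hasDerivAt_logKernel ht x).ofReal_comp)
      ((hcφ.mul hcl).integrable_of_hasCompactSupport (hcs hsupp).mul_right)
      ((hcψ.mul hck).integrable_of_hasCompactSupport (hcs cψ).mul_right)
      ((hcφ.mul hck).integrable_of_hasCompactSupport (hcs hsupp).mul_right)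
  have hint : Integrable (Function.uncurry fun t x : ℝ =>
      ψ (x, t) * logKernel x t * Complex.exp (s * t)) (volume.prod volume) := by
    rw [← Measure.volume_eq_prod]
    have hb : Continuous fun z : ℝ × ℝ => ‖ψ (z.2, z.1)‖ * ((|z.2| * ((Real.exp z.1 -
        Real.exp (-z.1)) ^ 2 + z.2 ^ 2) + 2 + 2 * |z.2|
      + Real.pi * |Real.exp z.1 - Real.exp (-z.1)|) * ‖Complex.exp (s * z.1)‖) := by
      have := sψ.continuous
      fun_prop
    have hbs : HasCompactSupport fun z : ℝ × ℝ => ‖ψ (z.2, z.1)‖ :=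
      (cψ.comp_homeomorph (Homeomorph.prodComm ℝ ℝ)).norm
    refine (hb.integrable_of_hasCompactSupport hbs.mul_right).mono' ?_ (.of_forall fun z => ?_)
    · have h1 : Measurable fun z : ℝ × ℝ => (logKernel z.2 z.1 : ℂ) :=
        Complex.measurable_ofReal.comp (measurable_logKernel.comp measurable_swap)
      have h2 : Measurable fun z : ℝ × ℝ => ψ (z.2, z.1) :=
        (sψ.continuous.comp continuous_swap).measurable
      have h3 : Measurable fun z : ℝ × ℝ => Complex.exp (s * z.1) := by fun_prop
      exact ((h2.mul h1).mul h3).aestronglyMeasurable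
    · rw [Function.uncurry_def, norm_mul, norm_mul, Complex.norm_real, mul_assoc]
      gcongr
      exact abs_logKernel_le _ _
  have hae : ∀ᵐ t : ℝ, t ≠ 0 := by simp [ae_iff]
  rw [integral_congr_ae (hae.mono hx_parts), integral_neg, norm_neg, integral_integral_swap hint]
  have hE : ∀ t : ℝ, |t| ≤ R → ‖Complex.exp (s * t)‖ ≤ Real.exp (|σ| * R) := fun t ht => by
    rw [Complex.norm_exp, Complex.re_mul_ofReal, hs, Real.exp_le_exp]
    calc σ * t ≤ |σ * t| := le_abs_self _
      _ = |σ| * |t| := abs_mul _ _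
      _ ≤ _ := by gcongr
  have hH : ∀ t : ℝ, |t| ≤ R → Real.exp t + Real.exp (-t) ≤ 2 * Real.exp R := fun t ht => by
    rw [abs_le] at ht
    have h1 := Real.exp_le_exp.2 ht.2
    have h2 := Real.exp_le_exp.2 (neg_le.1 ht.1)
    linarith
  have hRexp : R ≤ 2 * Real.exp R := by
    have := Real.add_one_le_exp R
    linarith
  have hx_bound : ∀ x : ℝ, x ≠ 0 → |x| ≤ R →
      ‖∫ t : ℝ, ψ (x, t) * logKernel x t * Complex.exp (s * t)‖ ≤ M / (1 + ‖s‖) ^ 2 := by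
    intro x hx hxR
    exact hM (fun t => ψ (x, t)) (fun t => ψ' (x, t)) (fun t => ψ'' (x, t)) x s
      (fun t => hasDerivAt_comp_prodMk_right (sψ.differentiable (by simp)) x t)
      (fun t => hasDerivAt_comp_prodMk_right (sψ'.differentiable (by simp)) x t)
      (sψ''.continuous.comp (by fun_prop)) hx (hxR.trans hRexp) hR0
      (fun t ht => zψ x t (.inr ht)) (fun t ht => zψ' x t (.inr ht))
      (fun t => (hA₀ _).trans (by simp)) (fun t => (hA₁ _).trans (by simp))
      (fun t => (hA₂ _).trans (by simp)) hH hE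
  have hsub : Function.support (fun x : ℝ => ∫ t : ℝ, ψ (x, t) * logKernel x t *
      Complex.exp (s * t)) ⊆ Set.Ioc (-R) R := fun x hx => by
    have : |x| < R := by
      by_contra! h
      simp [zψ x _ (.inl h)] at hx
    rw [abs_lt] at this
    exact ⟨this.1, this.2.le⟩
  rw [← intervalIntegral.integral_eq_integral_of_support_subset hsub]
  refine (intervalIntegral.norm_integral_le_of_norm_le_const_ae (C := M / (1 + ‖s‖) ^ 2)
    (hae.mono fun x hx hm => ?_)).trans (le_of_eq ?_)
  · rw [Set.uIoc_of_le (by linarith)] at hm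
    exact hx_bound x hx (abs_le.2 ⟨hm.1.le, hm.2⟩)
  · rw [sub_neg_eq_add, abs_of_nonneg (by positivity)]
    ring
end
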